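/- For n ≥ 3, every element of finite order in M_n is conjugate in M_n to a power of one of the three elements α₀ = σ₁⋯σ_{n-1}, α₁ = σ₁⋯σ_{n-2}, or α₂ = σ₁⋯σ_{n-3}σ_{n-2}². -/

import Mathlib

/-!
The mapping class group `M n` of the `n`-punctured sphere, presented with
generators `σ₁, …, σ_{n-1}` and relations:
`σᵢσⱼ = σⱼσᵢ` for `|i - j| ≥ 2`; `σᵢσⱼσᵢ = σⱼσᵢσⱼ` for `|i - j| = 1`;
`σ₁⋯σ_{n-1} σ_{n-1}⋯σ₁ = 1`; `(σ₁⋯σ_{n-1})ⁿ = 1`.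
-/

namespace SphereMCG

/-- Generators: `i : Fin (n-1)` is the half-twist `σ_{i+1}`. -/
abbrev Gen (n : ℕ) := Fin (n - 1)

/-- The generator `σ_i` (for `1 ≤ i ≤ n - 1`) as an element of the free group. -/
def σf (n : ℕ) (i : ℕ) : FreeGroup (Gen n) :=
  if h : 1 ≤ i ∧ i ≤ n - 1 then FreeGroup.of (⟨i - 1, by omega⟩ : Gen n) else 1

/-- The word `σ_a σ_{a+1} ⋯ σ_b` in the free group. -/
def σfProd (n : ℕ) (a b : ℕ) : FreeGroup (Gen n) :=
  ((List.range' a (b + 1 - a)).map (σf n)).prod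

/-- The word `σ_b σ_{b-1} ⋯ σ_a` in the free group. -/
def σfProdRev (n : ℕ) (a b : ℕ) : FreeGroup (Gen n) :=
  ((List.range' a (b + 1 - a)).reverse.map (σf n)).prod

/-- The defining relations of the mapping class group of the `n`-punctured sphere. -/
def rels (n : ℕ) : Set (FreeGroup (Gen n)) :=
  { r | (∃ i j, 1 ≤ i ∧ i ≤ n - 1 ∧ 1 ≤ j ∧ j ≤ n - 1 ∧ (i + 2 ≤ j ∨ j + 2 ≤ i) ∧
          r = σf n i * σf n j * (σf n j * σf n i)⁻¹)
      ∨ (∃ i j, 1 ≤ i ∧ i ≤ n - 1 ∧ 1 ≤ j ∧ j ≤ n - 1 ∧ (i + 1 = j ∨ j + 1 = i) ∧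
          r = σf n i * σf n j * σf n i * (σf n j * σf n i * σf n j)⁻¹)
      ∨ r = σfProd n 1 (n - 1) * σfProdRev n 1 (n - 1)
      ∨ r = (σfProd n 1 (n - 1)) ^ n }

/-- The mapping class group of the `n`-punctured sphere, by its standard presentation. -/
abbrev M (n : ℕ) := PresentedGroup (rels n)

/-- The half-twist `σ_i` in `M n`. -/
def σ (n : ℕ) (i : ℕ) : M n := PresentedGroup.mk (rels n) (σf n i)

/-- `α₀ = σ₁ ⋯ σ_{n-1}` in `M n`. -/
def α₀ (n : ℕ) : M n := PresentedGroup.mk (rels n) (σfProd n 1 (n - 1))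

/-- `α₁ = σ₁ ⋯ σ_{n-2}` in `M n`. -/
def α₁ (n : ℕ) : M n := PresentedGroup.mk (rels n) (σfProd n 1 (n - 2))

/-- `α₂ = σ₁ ⋯ σ_{n-3} σ_{n-2}²` in `M n`. -/
def α₂ (n : ℕ) : M n := PresentedGroup.mk (rels n) (σfProd n 1 (n - 2) * σf n (n - 2))

end SphereMCG

set_option linter.unusedSectionVars false

namespace BraidAction

open FreeGroup (of lift)

section FreeGroupFacts

variable {ι : Type*}

theorem not_commute_of {a b : ι} (hab : a ≠ b) : ¬ Commute (of a) (of b) := by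
  classical
  intro h
  have h3 := congrArg FreeGroup.toWord h.eq
  revert h3
  simp [FreeGroup.toWord_mul, FreeGroup.reduce.cons, hab]

/-- An element commuting with a `t` that some homomorphism to `ℤ` sends to a generator is a power
of `t`. -/
theorem mem_zpowers_of_commute {t g : FreeGroup ι} (e : FreeGroup ι →* Multiplicative ℤ)
    (ht : e t = Multiplicative.ofAdd 1) (hg : Commute g t) : g ∈ Subgroup.zpowers t := by
  set H : Subgroup (FreeGroup ι) := Subgroup.closure {g, t} with hH
  have hcomm : ∀ a b : H, a * b = b * a := by
    have h1 : H ≤ Subgroup.centralizer {g, t} := by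
      rw [hH, Subgroup.closure_le]
      rintro x (rfl | rfl)
      · rw [SetLike.mem_coe, Subgroup.mem_centralizer_iff]
        rintro y (rfl | rfl)
        · rfl
        · exact hg.eq.symm
      · rw [SetLike.mem_coe, Subgroup.mem_centralizer_iff]
        rintro y (rfl | rfl)
        · exact hg.eq
        · rfl
    have h2 : H ≤ Subgroup.centralizer (H : Set (FreeGroup ι)) := by
      rw [Subgroup.le_centralizer_iff, hH, Subgroup.closure_le, ← hH]
      intro y hy
      rw [SetLike.mem_coe, Subgroup.mem_centralizer_iff]
      intro x hx
      exact ((Subgroup.mem_centralizer_iff.mp (h1 hx)) y hy).symm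
    intro a b
    exact Subtype.ext ((Subgroup.mem_centralizer_iff.mp (h2 b.2)) a a.2)
  let E := IsFreeGroup.mulEquiv H
  have hsub : ∀ a b : IsFreeGroup.Generators H, a = b := by
    intro a b
    by_contra hab
    exact not_commute_of hab (E.injective (by rw [map_mul, map_mul, hcomm]))
  have htH : t ∈ H := Subgroup.subset_closure (by simp)
  have hgH : g ∈ H := Subgroup.subset_closure (by simp)
  have hne : Nonempty (IsFreeGroup.Generators H) := by
    by_contra hne
    rw [not_nonempty_iff] at hne
    have h1 : E.symm ⟨t, htH⟩ = 1 := Subsingleton.elim _ _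
    rw [EmbeddingLike.map_eq_one_iff] at h1
    have h2 : t = 1 := congrArg Subtype.val h1
    rw [h2, map_one] at ht
    have h3 := congrArg Multiplicative.toAdd ht
    simp at h3
  obtain ⟨c⟩ := hne
  have hz : ∀ w : FreeGroup (IsFreeGroup.Generators H), w ∈ Subgroup.zpowers (of c) := by
    intro w
    induction w using FreeGroup.induction_on with
    | C1 => exact one_mem _
    | of a => rw [hsub a c]; exact Subgroup.mem_zpowers _
    | inv_of a _ => rw [hsub a c]; exact inv_mem (Subgroup.mem_zpowers _)
    | mul x y hx hy => exact mul_mem hx hy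
  set z : FreeGroup ι := ((E (of c) : H) : FreeGroup ι) with hzdef
  have key : ∀ y ∈ H, ∃ i : ℤ, y = z ^ i := by
    intro y hy
    obtain ⟨i, hi⟩ := Subgroup.mem_zpowers_iff.mp (hz (E.symm ⟨y, hy⟩))
    refine ⟨i, ?_⟩
    have := congrArg (fun u => ((E u : H) : FreeGroup ι)) hi
    simp only [map_zpow, MulEquiv.apply_symm_apply] at this
    rw [← this]; simp [hzdef]
  obtain ⟨i, hi⟩ := key t htH
  obtain ⟨j, hj⟩ := key g hgH
  have h1 : i * Multiplicative.toAdd (e z) = 1 := by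
    rw [hi, map_zpow] at ht
    simpa using congrArg Multiplicative.toAdd ht
  have h2 : i = 1 ∨ i = -1 := Int.isUnit_iff.mp (IsUnit.of_mul_eq_one _ h1)
  rw [Subgroup.mem_zpowers_iff]
  rcases h2 with rfl | rfl
  · exact ⟨j, by rw [hj, hi, zpow_one]⟩
  · exact ⟨-j, by rw [hj, hi, ← zpow_mul]; simp⟩

theorem eq_one_of_forall_commute [Nontrivial ι] {g : FreeGroup ι}
    (h : ∀ i, Commute g (of i)) : g = 1 := by
  classical
  obtain ⟨a, b, hab⟩ := exists_pair_ne ι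
  let e (i : ι) : FreeGroup ι →* Multiplicative ℤ :=
    lift fun j => if j = i then Multiplicative.ofAdd 1 else 1
  obtain ⟨k, hk⟩ := Subgroup.mem_zpowers_iff.mp
    (mem_zpowers_of_commute (e a) (t := of a) (by simp [e]) (h a))
  obtain ⟨l, hl⟩ := Subgroup.mem_zpowers_iff.mp
    (mem_zpowers_of_commute (e b) (t := of b) (by simp [e]) (h b))
  have h1 := congrArg (e a) (hk.trans hl.symm)
  have h2 : k = 0 := by simpa [e, hab, hab.symm, ← ofAdd_zsmul] using congrArg Multiplicative.toAdd h1
  rw [← hk, h2, zpow_zero]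

theorem isConj_of_iff {a b : ι} : IsConj (of a) (of b) ↔ a = b := by
  classical
  refine ⟨fun h => ?_, fun h => h ▸ IsConj.refl _⟩
  by_contra hab
  let e : FreeGroup ι →* Multiplicative ℤ :=
    lift fun j => if j = a then Multiplicative.ofAdd 1 else 1
  have h1 := isConj_iff_eq.mp (e.map_isConj h)
  simp only [e, FreeGroup.lift_apply_of, if_true, if_neg (Ne.symm hab)] at h1
  have := congrArg Multiplicative.toAdd h1
  simp at this

end FreeGroupFacts

section Twist

variable {ι : Type*} [DecidableEq ι]

/-- The half-twist automorphism `x_a ↦ x_a x_b x_a⁻¹`, `x_b ↦ x_a` of a free group. -/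
def twist (a b : ι) (hab : a ≠ b) : MulAut (FreeGroup ι) :=
  MonoidHom.toMulEquiv
    (lift fun c => if c = a then of a * of b * (of a)⁻¹ else if c = b then of a else of c)
    (lift fun c => if c = a then of b else if c = b then (of b)⁻¹ * of a * of b else of c)
    (by
      ext c
      by_cases h : c = a
      · subst h; simp [hab.symm]; group
      · by_cases h' : c = b
        · subst h'; simp [h]
        · simp [h, h'])
    (by
      ext c
      by_cases h : c = a
      · subst h; simp [hab.symm]
      · by_cases h' : c = b
        · subst h'; simp [h]; group
        · simp [h, h'])

variable {a b c d : ι}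

theorem twist_left (hab : a ≠ b) : twist a b hab (of a) = of a * of b * (of a)⁻¹ := by
  simp [twist]

theorem twist_right (hab : a ≠ b) : twist a b hab (of b) = of a := by
  simp [twist, hab.symm]

theorem twist_other (hab : a ≠ b) (ha : c ≠ a) (hb : c ≠ b) : twist a b hab (of c) = of c := by
  simp [twist, ha, hb]

omit [DecidableEq ι] in
theorem mulAut_ext {f g : MulAut (FreeGroup ι)} (h : ∀ i, f (of i) = g (of i)) : f = g := by
  have : f.toMonoidHom = g.toMonoidHom := FreeGroup.ext_hom _ _ h
  exact MulEquiv.ext fun x => DFunLike.congr_fun this x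

theorem twist_commute (hab : a ≠ b) (hcd : c ≠ d) (hac : a ≠ c) (had : a ≠ d) (hbc : b ≠ c)
    (hbd : b ≠ d) : twist a b hab * twist c d hcd = twist c d hcd * twist a b hab := by
  apply mulAut_ext
  intro i
  simp only [MulAut.mul_apply]
  by_cases h1 : i = a
  · subst h1
    simp [twist_left, twist_other, *]
  by_cases h2 : i = b
  · subst h2
    simp [twist_right, twist_other, *]
  by_cases h3 : i = c
  · subst h3
    rw [twist_left, twist_other hab h1 h2, map_mul, map_mul, map_inv, twist_other hab h1 h2,
      twist_other hab had.symm hbd.symm, twist_left]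
  by_cases h4 : i = d
  · subst h4
    rw [twist_right, twist_other hab h1 h2, twist_other hab hac.symm hbc.symm, twist_right]
  rw [twist_other hab h1 h2, twist_other hcd h3 h4, twist_other hab h1 h2]

theorem twist_braid (hab : a ≠ b) (hbc : b ≠ c) (hac : a ≠ c) :
    twist a b hab * twist b c hbc * twist a b hab =
      twist b c hbc * twist a b hab * twist b c hbc := by
  apply mulAut_ext
  intro i
  have e1 : twist a b hab (of c) = of c := twist_other hab hac.symm hbc.symm
  have e2 : twist b c hbc (of a) = of a := twist_other hbc hab hac
  simp only [MulAut.mul_apply]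
  by_cases h1 : i = a
  · subst h1
    simp only [twist_left, twist_right, map_mul, map_inv, e1, e2]
    group
  by_cases h2 : i = b
  · subst h2
    simp only [twist_left, twist_right, map_mul, map_inv, e1, e2]
  by_cases h3 : i = c
  · subst h3
    simp only [twist_right, e1, e2]
  rw [twist_other hab h1 h2, twist_other hbc h2 h3, twist_other hab h1 h2, twist_other hbc h2 h3]

end Twist

section Periodic

variable (n : ℕ)

/-- The generators of the free group of rank `n`, indexed periodically by `ℤ`. -/
def x (k : ℤ) : FreeGroup (ZMod n) := of (k : ZMod n)

/-- The partial products `x_0 ⋯ x_{j-1}`. -/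
def partialProd : ℕ → FreeGroup (ZMod n)
  | 0 => 1
  | j + 1 => partialProd j * x n j

/-- The full product `x_0 ⋯ x_{n-1}`. -/
def Del : FreeGroup (ZMod n) := partialProd n n

/-- The partial products extended to `ℤ` by `G (k + 1) = G k * x k`. -/
def G (k : ℤ) : FreeGroup (ZMod n) := Del n ^ (k / n) * partialProd n (k % n).toNat

/-- The conjugate `G i * x k * (G i)⁻¹` of `x k`. -/
def D (i k : ℤ) : FreeGroup (ZMod n) := G n i * x n k * (G n i)⁻¹

/-- The conjugate `G k * x k * (G k)⁻¹` of `x k`. -/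
def Z (k : ℤ) : FreeGroup (ZMod n) := D n k k

variable {n}

theorem x_add_mul (k t : ℤ) : x n (k + n * t) = x n k := by simp [x]

variable [hn : Fact (2 ≤ n)]

theorem two_le : (2 : ℤ) ≤ n := by exact_mod_cast hn.out

instance neZero_of_two_le : NeZero n := ⟨by have := hn.out; omega⟩

instance nontrivial_of_two_le : Nontrivial (ZMod n) :=
  have : Fact (1 < n) := ⟨by have := hn.out; omega⟩
  inferInstance

omit hn in
theorem G_zero : G n 0 = 1 := by simp [G, partialProd]

omit hn in
theorem G_natCast {j : ℕ} (hj : j < n) : G n j = partialProd n j := by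
  have h1 : (j : ℤ) / n = 0 := Int.ediv_eq_zero_of_lt (by omega) (by omega)
  have h2 : (j : ℤ) % n = j := Int.emod_eq_of_lt (by omega) (by omega)
  simp [G, h1, h2]

theorem G_add_mul (k t : ℤ) : G n (k + n * t) = Del n ^ t * G n k := by
  have := two_le (n := n)
  rw [G, G, Int.add_mul_ediv_left _ _ (by omega), Int.add_mul_emod_self_left, add_comm, zpow_add,
    mul_assoc]

theorem G_add (k : ℤ) : G n (k + n) = Del n * G n k := by
  simpa using G_add_mul (n := n) k 1

theorem G_n : G n n = Del n := by
  simpa [G_zero] using G_add (n := n) 0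

theorem G_add_one (k : ℤ) : G n (k + 1) = G n k * x n k := by
  have h2 := two_le (n := n)
  have key : ∀ j : ℕ, j < n → G n ((j : ℤ) + 1) = G n j * x n j := by
    intro j hj
    rcases Nat.lt_or_ge (j + 1) n with h | h
    · have := G_natCast h
      push_cast at this
      rw [this, G_natCast hj, partialProd]
    · have e : j + 1 = n := by omega
      have e' : (j : ℤ) + 1 = n := by omega
      rw [e', G_n, Del, ← e, partialProd, e, G_natCast hj]
  have h0 := Int.emod_nonneg k (b := n) (by omega)
  have h1 := Int.emod_lt_of_pos k (b := n) (by omega)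
  have h3 := key (k % n).toNat (by omega)
  rw [Int.toNat_of_nonneg h0] at h3
  have e : k = k % n + n * (k / n) := (Int.emod_add_mul_ediv k n).symm
  rw [e, add_right_comm, G_add_mul, h3, G_add_mul, x_add_mul, mul_assoc]

theorem x_eq (k : ℤ) : x n k = (G n k)⁻¹ * G n (k + 1) := by rw [G_add_one]; group

theorem Z_eq (k : ℤ) : Z n k = G n (k + 1) * (G n k)⁻¹ := by rw [Z, D, G_add_one]

theorem G_succ_eq (k : ℤ) : G n (k + 1) = Z n k * G n k := by rw [Z_eq]; group

theorem D_succ_self (k : ℤ) : D n (k + 1) k = Z n k := by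
  rw [Z_eq, D, G_add_one]; group

omit hn in
theorem D_add_right (i k t : ℤ) : D n i (k + n * t) = D n i k := by rw [D, x_add_mul, D]

theorem D_add_left (i k t : ℤ) : D n (i + n * t) k = Del n ^ t * D n i k * (Del n ^ t)⁻¹ := by
  rw [D, D, G_add_mul]; group

theorem Z_add (k t : ℤ) : Z n (k + n * t) = Del n ^ t * Z n k * (Del n ^ t)⁻¹ := by
  rw [Z, D_add_left, D_add_right, Z]

omit hn in
theorem intCast_eq_iff {k l : ℤ} : (k : ZMod n) = l ↔ ∃ t, l = k + n * t := by
  rw [ZMod.intCast_eq_intCast_iff_dvd_sub]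
  constructor
  · rintro ⟨t, ht⟩; exact ⟨t, by linarith⟩
  · rintro ⟨t, ht⟩; exact ⟨t, by linarith⟩

theorem exists_window (k i : ℤ) : ∃ l t : ℤ, i ≤ l ∧ l < i + n ∧ k = l + n * t := by
  have h2 := two_le (n := n)
  refine ⟨i + (k - i) % n, (k - i) / n, ?_, ?_, ?_⟩
  · have := Int.emod_nonneg (k - i) (b := n) (by omega); omega
  · have := Int.emod_lt_of_pos (k - i) (b := n) (by omega); omega
  · have := Int.emod_add_mul_ediv (k - i) n; omega

theorem intCast_ne {k l : ℤ} (h1 : k < l) (h2 : l < k + n) : (k : ZMod n) ≠ l := by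
  intro h
  obtain ⟨t, ht⟩ := intCast_eq_iff.mp h
  have hn0 := two_le (n := n)
  rcases lt_trichotomy t 0 with h0 | h0 | h0
  · nlinarith
  · subst h0; omega
  · nlinarith

theorem exists_nat_rep (c : ZMod n) : ∃ k : ℕ, k < n ∧ ((k : ℤ) : ZMod n) = c :=
  ⟨c.val, ZMod.val_lt c, by simp⟩

theorem exists_int_rep (c : ZMod n) : ∃ k : ℤ, (k : ZMod n) = c :=
  let ⟨k, _, h⟩ := exists_nat_rep c
  ⟨k, h⟩

omit hn in
theorem Z_conj (k : ℤ) : IsConj (of (k : ZMod n)) (Z n k) := isConj_iff.mpr ⟨G n k, rfl⟩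

omit hn in
theorem D_conj (i k : ℤ) : IsConj (of (k : ZMod n)) (D n i k) := isConj_iff.mpr ⟨G n i, rfl⟩

omit hn in
theorem isConj_Z_iff {k l : ℤ} : IsConj (Z n k) (Z n l) ↔ (k : ZMod n) = l := by
  constructor
  · intro h
    exact isConj_of_iff.mp (((Z_conj k).trans h).trans (Z_conj l).symm)
  · intro h
    exact (Z_conj k).symm.trans (h ▸ Z_conj l)

/-- An automorphism of the free group is determined by its values on `Z 0, …, Z (n-1)`. -/
theorem aut_ext_Z {a b : MulAut (FreeGroup (ZMod n))}
    (h : ∀ k : ℕ, k < n → a (Z n k) = b (Z n k)) : a = b := by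
  have hG : ∀ k : ℕ, k ≤ n → a (G n k) = b (G n k) := by
    intro k
    induction k with
    | zero => intro _; simp [G_zero]
    | succ k ih =>
      intro hk
      push_cast
      rw [G_succ_eq, map_mul, map_mul, ih (by omega), h k (by omega)]
  apply mulAut_ext
  intro c
  obtain ⟨k, hk, rfl⟩ := exists_nat_rep c
  have e : (of ((k : ℤ) : ZMod n)) = (G n k)⁻¹ * G n (k + 1) := x_eq k
  have := hG (k + 1) (by omega)
  push_cast at this
  rw [e, map_mul, map_mul, map_inv, map_inv, hG k (by omega), this]

end Periodic

section Generators

variable (n : ℕ) [hn : Fact (2 ≤ n)]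

theorem natCast_ne_succ {i : ℕ} (h : i + 1 < n) : ((i : ℤ) : ZMod n) ≠ ((i + 1 : ℤ) : ZMod n) :=
  intCast_ne (by omega) (by have := hn.out; omega)

/-- The action of the braid generator `σ_i` (trivial if `i` is out of range). -/
def sg (i : ℕ) : MulAut (FreeGroup (ZMod n)) :=
  if h : i + 1 < n then twist _ _ (natCast_ne_succ n h) else 1

/-- The image of the braid group in the automorphism group of the free group. -/
def A : Subgroup (MulAut (FreeGroup (ZMod n))) := Subgroup.closure (Set.range (sg n))

variable {n}

theorem sg_mem (i : ℕ) : sg n i ∈ A n := Subgroup.subset_closure ⟨i, rfl⟩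

theorem sg_of_le {i : ℕ} (h : n ≤ i + 1) : sg n i = 1 := dif_neg (by omega)

theorem sg_left {i : ℕ} (h : i + 1 < n) :
    sg n i (x n i) = x n i * x n (i + 1) * (x n i)⁻¹ := by
  rw [sg, dif_pos h]; exact twist_left _

theorem sg_right {i : ℕ} (h : i + 1 < n) : sg n i (x n (i + 1)) = x n i := by
  rw [sg, dif_pos h]; exact twist_right _

theorem sg_other {i : ℕ} {k : ℤ} (h0 : 0 ≤ k) (hk : k < n) (h1 : k ≠ i) (h2 : k ≠ i + 1) :
    sg n i (x n k) = x n k := by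
  rw [sg]
  split_ifs with h
  · apply twist_other
    · rcases lt_or_gt_of_ne h1 with h3 | h3
      · exact intCast_ne h3 (by omega)
      · exact (intCast_ne h3 (by omega)).symm
    · rcases lt_or_gt_of_ne h2 with h3 | h3
      · exact intCast_ne h3 (by omega)
      · exact (intCast_ne h3 (by omega)).symm
  · rfl

theorem sg_G_window {i k : ℕ} (h : i + 1 < n) (hk : k ≤ n) :
    sg n i (G n k) = if k = i + 1 then G n (i + 2) * (x n i)⁻¹ else G n k := by
  have lo : ∀ k : ℕ, k ≤ i → sg n i (G n k) = G n k := by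
    intro k
    induction k with
    | zero => intro _; simp [G_zero]
    | succ k ih =>
      intro hk
      push_cast
      rw [G_add_one, map_mul, ih (by omega), sg_other (by omega) (by omega) (by omega) (by omega)]
  have e1 : G n (i + 2) = G n i * x n i * x n (i + 1) := by
    rw [show (i : ℤ) + 2 = i + 1 + 1 by ring, G_add_one, G_add_one]
  have mid : sg n i (G n (i + 1)) = G n (i + 2) * (x n i)⁻¹ := by
    rw [G_add_one, map_mul, lo i le_rfl, sg_left h, e1]; group
  have mid2 : sg n i (G n (i + 2)) = G n (i + 2) := by
    have e2 := G_add_one (n := n) ((i : ℤ) + 1)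
    rw [show (i : ℤ) + 1 + 1 = i + 2 by ring] at e2
    rw [e2, map_mul, mid, sg_right h, inv_mul_cancel_right, e2]
  have hi : ∀ k : ℕ, i + 2 ≤ k → k ≤ n → sg n i (G n k) = G n k := by
    intro k hk
    induction k, hk using Nat.le_induction with
    | base => intro _; push_cast; exact mid2
    | succ k hk ih =>
      intro hk'
      push_cast
      rw [G_add_one, map_mul, ih (by omega), sg_other (by omega) (by omega) (by omega) (by omega)]
  split_ifs with h'
  · subst h'; push_cast; exact mid
  · rcases Nat.lt_or_ge i k with h3 | h3
    · exact hi k (by omega) hk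
    · exact lo k h3

theorem sg_Del (i : ℕ) : sg n i (Del n) = Del n := by
  by_cases h : i + 1 < n
  · rw [← G_n, sg_G_window h le_rfl, if_neg (by omega)]
  · rw [sg_of_le (by omega)]; rfl

theorem sg_G {i : ℕ} (h : i + 1 < n) (k : ℤ) :
    sg n i (G n k) =
      if ((i + 1 : ℤ) : ZMod n) = k then G n (k + 1) * (x n (k - 1))⁻¹ else G n k := by
  obtain ⟨l, t, h0, h1, rfl⟩ := exists_window (n := n) k 0
  rw [G_add_mul, map_mul, map_zpow, sg_Del]
  lift l to ℕ using h0
  rw [sg_G_window h (by omega)]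
  have e : ((l + n * t : ℤ) : ZMod n) = (l : ℤ) := by simp
  rw [e]
  by_cases h' : l = i + 1
  · subst h'
    rw [if_pos rfl, if_pos (by push_cast; rfl), add_right_comm, G_add_mul, add_sub_right_comm,
      x_add_mul]
    push_cast
    rw [mul_assoc]
    congr 3
    ring_nf
  · rw [if_neg h', if_neg]
    intro h2
    rcases lt_or_gt_of_ne h' with h3 | h3
    · exact intCast_ne (n := n) (k := l) (l := i + 1) (by omega) (by omega) h2.symm
    · exact intCast_ne (n := n) (k := i + 1) (l := l) (by omega) (by omega) h2

theorem sg_Z_left {i : ℕ} (h : i + 1 < n) : sg n i (Z n i) = Z n (i + 1) := by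
  rw [Z_eq, map_mul, map_inv]
  have h1 := sg_G_window (k := i + 1) h (by omega)
  have h2 := sg_G_window (k := i) h (by omega)
  push_cast at h1
  rw [h1, h2, if_pos rfl, if_neg (by omega), Z_eq, G_add_one (i : ℤ)]
  rw [show (i : ℤ) + 1 + 1 = i + 2 by ring]; group

theorem sg_Z_other {i k : ℕ} (h : i + 1 < n) (hk : k < n) (h1 : k ≠ i) (h2 : k ≠ i + 1) :
    sg n i (Z n k) = Z n k := by
  rw [Z_eq, map_mul, map_inv]
  have h3 := sg_G_window (k := k + 1) h (by omega)
  have h4 := sg_G_window (k := k) h (by omega)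
  push_cast at h3
  rw [h3, h4, if_neg (by omega), if_neg (by omega)]

theorem A_Del {a : MulAut (FreeGroup (ZMod n))} (ha : a ∈ A n) : a (Del n) = Del n := by
  induction ha using Subgroup.closure_induction with
  | mem y hy => obtain ⟨i, rfl⟩ := hy; exact sg_Del i
  | one => rfl
  | mul y z _ _ hy hz => rw [MulAut.mul_apply, hz, hy]
  | inv y _ hy => rw [MulAut.inv_apply, MulEquiv.symm_apply_eq, hy]

/-- An element of the braid group permutes the conjugacy classes of the generators. -/
theorem A_perm {a : MulAut (FreeGroup (ZMod n))} (ha : a ∈ A n) :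
    ∃ π : Equiv.Perm (ZMod n), ∀ c, IsConj (of (π c)) (a (of c)) := by
  induction ha using Subgroup.closure_induction with
  | mem y hy =>
    obtain ⟨i, rfl⟩ := hy
    by_cases h : i + 1 < n
    · refine ⟨Equiv.swap ((i : ℤ) : ZMod n) ((i + 1 : ℤ) : ZMod n), fun c => ?_⟩
      rw [sg, dif_pos h]
      by_cases h1 : c = ((i : ℤ) : ZMod n)
      · subst h1
        rw [Equiv.swap_apply_left, twist_left]
        exact isConj_iff.mpr ⟨_, rfl⟩
      by_cases h2 : c = ((i + 1 : ℤ) : ZMod n)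
      · subst h2
        rw [Equiv.swap_apply_right, twist_right]
      · rw [Equiv.swap_apply_of_ne_of_ne h1 h2, twist_other _ h1 h2]
    · exact ⟨1, fun c => by rw [sg_of_le (by omega)]; exact IsConj.refl _⟩
  | one => exact ⟨1, fun c => IsConj.refl _⟩
  | mul y z _ _ hy hz =>
    obtain ⟨π, hπ⟩ := hy
    obtain ⟨τ, hτ⟩ := hz
    exact ⟨π * τ, fun c => (hπ (τ c)).trans (y.toMonoidHom.map_isConj (hτ c))⟩
  | inv y _ hy =>
    obtain ⟨π, hπ⟩ := hy
    refine ⟨π⁻¹, fun c => ?_⟩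
    have h1 := y⁻¹.toMonoidHom.map_isConj (hπ (π⁻¹ c))
    simp only [Equiv.Perm.inv_def, Equiv.apply_symm_apply, MulEquiv.coe_toMonoidHom, MulAut.inv_apply_self] at h1
    exact h1.symm

/-- `σ_0 ⋯ σ_{j-1}`. -/
theorem prod_sg_Z {j : ℕ} (hj : j < n) (k : ℕ) :
    (k < j → ((List.range j).map (sg n)).prod (Z n k) = Z n (k + 1)) ∧
      (j < k → k < n → ((List.range j).map (sg n)).prod (Z n k) = Z n k) := by
  induction j with
  | zero => exact ⟨fun h => absurd h (by omega), fun _ _ => by simp⟩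
  | succ j ih =>
    rw [List.range_succ, List.map_append, List.prod_append]
    simp only [List.map_cons, List.map_nil, List.prod_singleton, MulAut.mul_apply]
    obtain ⟨ih1, ih2⟩ := ih (by omega)
    refine ⟨fun h => ?_, fun h h' => ?_⟩
    · rcases Nat.lt_or_ge k j with h3 | h3
      · rw [sg_Z_other (by omega) (by omega) (by omega) (by omega), ih1 h3]
      · obtain rfl : k = j := by omega
        rw [sg_Z_left (by omega)]
        clear ih1 ih2
        have : ∀ i : ℕ, i ≤ k → ((List.range i).map (sg n)).prod (Z n ((k + 1 : ℕ) : ℤ)) =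
            Z n ((k + 1 : ℕ) : ℤ) := by
          intro i
          induction i with
          | zero => intro _; simp
          | succ i ih =>
            intro hi
            rw [List.range_succ, List.map_append, List.prod_append]
            simp only [List.map_cons, List.map_nil, List.prod_singleton, MulAut.mul_apply]
            rw [sg_Z_other (by omega) (by omega) (by omega) (by omega), ih (by omega)]
        have := this k le_rfl
        push_cast at this
        exact this
    · rw [sg_Z_other (by omega) (by omega) (by omega) (by omega), ih2 (by omega) h']

variable (n) in
/-- The action of `σ_0 ⋯ σ_{n-2}`. -/
def delta : MulAut (FreeGroup (ZMod n)) := ((List.range (n - 1)).map (sg n)).prod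

variable (n) in
/-- The action of `σ_0 ⋯ σ_{n-3} σ_{n-2}²`. -/
def eps : MulAut (FreeGroup (ZMod n)) := delta n * sg n (n - 2)

theorem delta_mem : delta n ∈ A n := by
  apply Subgroup.list_prod_mem
  simp only [List.mem_map]
  rintro _ ⟨i, _, rfl⟩
  exact sg_mem i

theorem eps_mem : eps n ∈ A n := mul_mem delta_mem (sg_mem _)

theorem delta_G (k : ℤ) : delta n (G n k) = G n (k + 1) * (G n 1)⁻¹ := by
  have h2 := hn.out
  have lo : ∀ k : ℕ, k < n → delta n (G n k) = G n (k + 1) * (G n 1)⁻¹ := by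
    intro k
    induction k with
    | zero => intro _; simp [G_zero]
    | succ k ih =>
      intro hk
      push_cast
      rw [G_succ_eq (k : ℤ), map_mul, ih (by omega), delta,
        (prod_sg_Z (by omega) k).1 (by omega), G_succ_eq ((k : ℤ) + 1), mul_assoc]
  obtain ⟨l, t, h0, h1, rfl⟩ := exists_window (n := n) k 0
  lift l to ℕ using h0
  rw [G_add_mul, map_mul, map_zpow, A_Del delta_mem, lo l (by omega), add_right_comm, G_add_mul,
    mul_assoc]

theorem delta_D (i k : ℤ) : delta n (D n i k) = D n (i + 1) (k + 1) := by
  rw [D, D, x_eq, x_eq]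
  simp only [map_mul, map_inv, delta_G]
  group

theorem delta_zpow_D (r i k : ℤ) : (delta n ^ r) (D n i k) = D n (i + r) (k + r) := by
  induction r with
  | zero => simp
  | succ r ih => rw [add_comm (r : ℤ) 1, zpow_one_add, MulAut.mul_apply, ih, delta_D]; ring_nf
  | pred r ih =>
    rw [sub_eq_add_neg, add_comm _ (-1 : ℤ), zpow_add, zpow_neg_one, MulAut.mul_apply, ih,
      MulAut.inv_apply, MulEquiv.symm_apply_eq, delta_D]
    ring_nf

theorem delta_zpow_Z (r k : ℤ) : (delta n ^ r) (Z n k) = Z n (k + r) := delta_zpow_D r k k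

theorem delta_pow_n : delta n ^ n = MulAut.conj (Del n) := by
  apply aut_ext_Z
  intro k _
  have := delta_zpow_Z (n := n) n k
  rw [zpow_natCast] at this
  rw [this]
  simpa using Z_add (n := n) k 1

variable (n) in
/-- The enumeration of the `Z k` with `k` not congruent to `n - 1`. -/
def Q (j : ℤ) : FreeGroup (ZMod n) := Z n (j + j / (n - 1))

theorem Q_add (j t : ℤ) : Q n (j + (n - 1) * t) = Del n ^ t * Q n j * (Del n ^ t)⁻¹ := by
  have h2 := two_le (n := n)
  rw [Q, Q, Int.add_mul_ediv_left _ _ (by omega), ← Z_add]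
  congr 1; ring

omit hn in
theorem Q_window {j : ℕ} (hj : j < n - 1) : Q n j = Z n j := by
  rw [Q, Int.ediv_eq_zero_of_lt (by omega) (by omega), add_zero]

theorem eps_Q (j : ℤ) : eps n (Q n j) = Q n (j + 1) := by
  have h2 := hn.out
  have lo : ∀ j : ℕ, j < n - 1 → eps n (Q n j) = Q n (j + 1) := by
    intro j hj
    rw [Q_window hj, eps, MulAut.mul_apply]
    by_cases h : j = n - 2
    · subst h
      rw [sg_Z_left (by omega), Z, delta_D, ← Z]
      have := Q_add (n := n) 0 1
      rw [show (0 + (n - 1) * 1 : ℤ) = ((n - 2 : ℕ) : ℤ) + 1 by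
        omega] at this
      rw [this]
      have h0 := Q_window (n := n) (j := 0) (by omega)
      rw [Nat.cast_zero] at h0
      rw [h0, ← Z_add]
      congr 1; omega
    · rw [sg_Z_other (by omega) (by omega) h (by omega), Z, delta_D, ← Z]
      have := Q_window (n := n) (j := j + 1) (by omega)
      push_cast at this
      exact this.symm
  have key : ∀ l t : ℤ, 0 ≤ l → l < n - 1 → eps n (Q n (l + (n - 1) * t)) =
      Q n (l + (n - 1) * t + 1) := by
    intro l t h0 h1
    lift l to ℕ using h0
    rw [Q_add, map_mul, map_mul, map_inv, map_zpow, A_Del eps_mem, lo l (by omega), add_right_comm,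
      Q_add]
  have h3 := key (j % (n - 1)) (j / (n - 1)) (Int.emod_nonneg _ (by omega))
    (Int.emod_lt_of_pos _ (by omega))
  rwa [Int.emod_add_mul_ediv] at h3

theorem eps_zpow_Q (r j : ℤ) : (eps n ^ r) (Q n j) = Q n (j + r) := by
  induction r with
  | zero => simp
  | succ r ih => rw [add_comm (r : ℤ) 1, zpow_one_add, MulAut.mul_apply, ih, eps_Q]; ring_nf
  | pred r ih =>
    rw [sub_eq_add_neg, add_comm _ (-1 : ℤ), zpow_add, zpow_neg_one, MulAut.mul_apply, ih,
      MulAut.inv_apply, MulEquiv.symm_apply_eq, eps_Q]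
    ring_nf

/-- Two braid automorphisms agreeing on the `Q j` are equal. -/
theorem aut_ext_Q {a b : MulAut (FreeGroup (ZMod n))} (ha : a ∈ A n) (hb : b ∈ A n)
    (h : ∀ j, a (Q n j) = b (Q n j)) : a = b := by
  have h2 := hn.out
  have hZ : ∀ k : ℕ, k < n - 1 → a (Z n k) = b (Z n k) := fun k hk => by
    rw [← Q_window hk]; exact h k
  have hG : ∀ k : ℕ, k < n → a (G n k) = b (G n k) := by
    intro k
    induction k with
    | zero => intro _; simp [G_zero]
    | succ k ih =>
      intro hk
      push_cast
      rw [G_succ_eq, map_mul, map_mul, ih (by omega), hZ k (by omega)]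
  apply aut_ext_Z
  intro k hk
  by_cases h' : k < n - 1
  · exact hZ k h'
  · have e : (k : ℤ) + 1 = n := by omega
    rw [Z_eq, e, G_n, map_mul, map_mul, map_inv, map_inv, hG k hk, A_Del ha, A_Del hb]

theorem eps_fixes_class (r : ℤ) :
    IsConj (Z n (n - 1)) ((eps n ^ r) (Z n (n - 1))) := by
  have h2 := hn.out
  have key : IsConj (Z n (n - 1)) (eps n (Z n (n - 1))) := by
    have h1 : IsConj (x n (n - 2)) (sg n (n - 2) (x n (n - 1))) := by
      have := sg_right (n := n) (i := n - 2) (by omega)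
      rw [show (((n - 2 : ℕ) : ℤ) + 1) = n - 1 by omega,
        show ((n - 2 : ℕ) : ℤ) = n - 2 by omega] at this
      rw [this]
    have h3 : IsConj (Z n (n - 2)) (sg n (n - 2) (Z n (n - 1))) := by
      refine (Z_conj _).symm.trans (h1.trans ?_)
      exact (sg n (n - 2)).toMonoidHom.map_isConj (Z_conj (n := n) (n - 1))
    have h4 := (delta n).toMonoidHom.map_isConj h3
    simp only [MulEquiv.coe_toMonoidHom] at h4
    rw [Z, delta_D, show (n - 2 + 1 : ℤ) = n - 1 by ring] at h4
    exact h4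
  induction r with
  | zero => exact IsConj.refl _
  | succ r ih =>
    rw [add_comm (r : ℤ) 1, zpow_one_add, MulAut.mul_apply]
    exact key.trans ((eps n).toMonoidHom.map_isConj ih)
  | pred r ih =>
    rw [show (-(r : ℤ) - 1) = -1 + -(r : ℤ) by ring, zpow_add, zpow_neg_one, MulAut.mul_apply]
    have h5 := (eps n)⁻¹.toMonoidHom.map_isConj (key.symm.trans ih)
    simp only [MulEquiv.coe_toMonoidHom, MulAut.inv_apply_self] at h5
    exact h5

end Generators

open scoped MatrixGroups

section Plane

/-- The area form on `ℤ²`. -/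
def area (p q : ℤ × ℤ) : ℤ := p.1 * q.2 - p.2 * q.1

/-- The linear action of `SL(2, ℤ)` on `ℤ²`. -/
def act (g : SL(2, ℤ)) (p : ℤ × ℤ) : ℤ × ℤ :=
  (g 0 0 * p.1 + g 0 1 * p.2, g 1 0 * p.1 + g 1 1 * p.2)

theorem act_one (p : ℤ × ℤ) : act 1 p = p := by simp [act]

theorem act_mul (g h : SL(2, ℤ)) (p : ℤ × ℤ) : act (g * h) p = act g (act h p) := by
  simp only [act, Matrix.SpecialLinearGroup.coe_mul, Matrix.mul_apply, Fin.sum_univ_two]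
  ext <;> simp <;> ring

theorem act_inv_act (g : SL(2, ℤ)) (p : ℤ × ℤ) : act g⁻¹ (act g p) = p := by
  rw [← act_mul, inv_mul_cancel, act_one]

theorem act_act_inv (g : SL(2, ℤ)) (p : ℤ × ℤ) : act g (act g⁻¹ p) = p := by
  rw [← act_mul, mul_inv_cancel, act_one]

theorem det_eq_one (g : SL(2, ℤ)) : g 0 0 * g 1 1 - g 0 1 * g 1 0 = 1 := by
  have := g.det_coe
  rwa [Matrix.det_fin_two] at this

theorem area_act (g : SL(2, ℤ)) (p q : ℤ × ℤ) : area (act g p) (act g q) = area p q := by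
  simp only [act, area]
  linear_combination (p.1 * q.2 - p.2 * q.1) * det_eq_one g

theorem act_neg (g : SL(2, ℤ)) (p : ℤ × ℤ) : act g (-p) = -act g p := by
  ext <;> simp [act] <;> ring

theorem area_neg_left (p q : ℤ × ℤ) : area (-p) q = -area p q := by simp [area]; ring

theorem area_neg_right (p q : ℤ × ℤ) : area p (-q) = -area p q := by simp [area]; ring

theorem area_swap (p q : ℤ × ℤ) : area p q = -area q p := by simp [area]; ring

theorem area_self (p : ℤ × ℤ) : area p p = 0 := by simp [area]; ring

theorem area_add_left (p q r : ℤ × ℤ) : area (p + q) r = area p r + area q r := by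
  simp [area]; ring

theorem area_add_right (p q r : ℤ × ℤ) : area p (q + r) = area p q + area p r := by
  simp [area]; ring

theorem area_plucker (p y a b : ℤ × ℤ) :
    area p y * area a b = area p a * area y b + area p b * area a y := by
  simp [area]; ring

/-- The trace of an element of `SL(2, ℤ)`. -/
def tr (g : SL(2, ℤ)) : ℤ := g 0 0 + g 1 1

theorem tr_conj (g h : SL(2, ℤ)) : tr (g * h * g⁻¹) = tr h := by
  have h1 : ∀ g : SL(2, ℤ), tr g = Matrix.trace (g : Matrix (Fin 2) (Fin 2) ℤ) := fun g => by
    simp [tr, Matrix.trace, Fin.sum_univ_two]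
  rw [h1, h1, Matrix.SpecialLinearGroup.coe_mul, Matrix.trace_mul_comm,
    ← Matrix.SpecialLinearGroup.coe_mul]
  group

/-- A matrix of trace `-2` taking `p` to `c` acts by an explicit transvection formula. -/
theorem area_act_parabolic {g : SL(2, ℤ)} (hg : tr g = -2) {c p : ℤ × ℤ} (h : act g p = c)
    (y z : ℤ × ℤ) :
    area c p * area (act g y) z = -(area c p * area y z) + area (c + p) y * area (c + p) z := by
  have h1 := det_eq_one g
  have h2 : g 1 1 = -2 - g 0 0 := by simp only [tr] at hg; linarith
  rw [h2] at h1
  subst h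
  simp only [act, area, Prod.fst_add, Prod.snd_add, h2]
  generalize g 0 0 = m at *
  generalize g 0 1 = b at *
  generalize g 1 0 = d at *
  obtain ⟨p, q⟩ := p
  obtain ⟨s, t⟩ := y
  obtain ⟨z1, z2⟩ := z
  simp only
  have h3 : b * d + (m + 1) ^ 2 = 0 := by linarith
  linear_combination ((s * p * q - t * p ^ 2) * z2 - (s * q ^ 2 - t * p * q) * z1) * h3

theorem act_parabolic_add {g : SL(2, ℤ)} (hg : tr g = -2) {c p : ℤ × ℤ} (h : act g p = c) :
    act g (c + p) = -(c + p) := by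
  have h1 := det_eq_one g
  have h2 : g 1 1 = -2 - g 0 0 := by simp only [tr] at hg; linarith
  rw [h2] at h1
  subst h
  simp only [act, h2]
  generalize g 0 0 = m at *
  generalize g 0 1 = b at *
  generalize g 1 0 = d at *
  obtain ⟨p, q⟩ := p
  ext <;> simp
  · linear_combination (-p) * h1
  · linear_combination (-q) * h1

end Plane

section PosSeq

/-- Antiperiodic sequences of plane vectors in convex cyclic order. -/
structure PosSeq (N : ℤ) (s : ℤ → ℤ × ℤ) : Prop where
  anti : ∀ m, s (m + N) = -s m
  pos : ∀ i j, i < j → j < i + N → 0 < area (s i) (s j)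

variable {N : ℤ} {s : ℤ → ℤ × ℤ}

theorem PosSeq.nonneg (hs : PosSeq N s) {i j : ℤ} (h : i ≤ j) (h' : j ≤ i + N) :
    0 ≤ area (s i) (s j) := by
  rcases h.lt_or_eq with h1 | rfl
  · rcases h'.lt_or_eq with h2 | rfl
    · exact (hs.pos i j h1 h2).le
    · rw [hs.anti, area_neg_right, area_self]; simp
  · rw [area_self]

theorem anti_sign (hs : ∀ m, s (m + N) = -s m) (t : ℤ) :
    ∃ e : ℤ, e * e = 1 ∧ ∀ m y, area (s (m + N * t)) y = e * area (s m) y := by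
  induction t with
  | zero => exact ⟨1, by simp, by simp⟩
  | succ t ih =>
    obtain ⟨e, he, h⟩ := ih
    refine ⟨-e, by linarith, fun m y => ?_⟩
    rw [show m + N * (t + 1) = (m + N * t) + N by ring, hs, area_neg_left, h]; ring
  | pred t ih =>
    obtain ⟨e, he, h⟩ := ih
    refine ⟨-e, by linarith, fun m y => ?_⟩
    have := hs (m + N * (-t - 1))
    rw [show m + N * (-t - 1) + N = m + N * (-t) by ring] at this
    have h2 := h m y
    rw [this, area_neg_left] at h2
    linarith

theorem anti_area (hs : ∀ m, s (m + N) = -s m) (i j t : ℤ) :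
    area (s (i + N * t)) (s (j + N * t)) = area (s i) (s j) := by
  obtain ⟨e, he, h⟩ := anti_sign hs t
  rw [h, area_swap, h, area_swap (s j)]
  linear_combination area (s i) (s j) * he

/-- `y` lies (up to sign) in the open cone between `s g` and `s (g + 1)`. -/
def InGap (s : ℤ → ℤ × ℤ) (g : ℤ) (y : ℤ × ℤ) : Prop :=
  0 < area (s g) y * area y (s (g + 1))

/-- `y` lies (up to sign) in the complementary open cone. -/
def OutGap (s : ℤ → ℤ × ℤ) (g : ℤ) (y : ℤ × ℤ) : Prop :=
  0 < area (s g) y * area (s (g + 1)) y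

theorem exists_window_int {N : ℤ} (hN : 0 < N) (k i : ℤ) :
    ∃ l t : ℤ, i ≤ l ∧ l < i + N ∧ k = l + N * t := by
  refine ⟨i + (k - i) % N, (k - i) / N, ?_, ?_, ?_⟩
  · have := Int.emod_nonneg (k - i) (b := N) (by omega); omega
  · have := Int.emod_lt_of_pos (k - i) (b := N) (by omega); omega
  · have := Int.emod_add_mul_ediv (k - i) N; omega

theorem outGap_add_mul (hs : ∀ m, s (m + N) = -s m) (g t : ℤ) (y : ℤ × ℤ) :
    OutGap s (g + N * t) y ↔ OutGap s g y := by
  obtain ⟨e, he, h⟩ := anti_sign hs t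
  rw [OutGap, OutGap, add_right_comm, h, h]
  rw [show e * area (s g) y * (e * area (s (g + 1)) y) =
    (e * e) * (area (s g) y * area (s (g + 1)) y) by ring, he, one_mul]

theorem PosSeq.outGap_of_inGap (hs : PosSeq N s) (hN : 1 < N) {g j : ℤ} {y : ℤ × ℤ}
    (hy : InGap s g y) (hj : ∀ t, j ≠ g + N * t) : OutGap s j y := by
  obtain ⟨l, t, h0, h1, rfl⟩ := exists_window_int (by omega : 0 < N) j g
  rw [outGap_add_mul hs.anti]
  have h2 : g < l := lt_of_le_of_ne h0 fun h => hj t (by rw [h])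
  have hd := hs.pos g (g + 1) (by omega) (by omega)
  have p1 := area_plucker (s l) y (s g) (s (g + 1))
  have p2 := area_plucker (s (l + 1)) y (s g) (s (g + 1))
  have a1 := hs.pos g l h2 h1
  have a2 := hs.nonneg (i := g) (j := l + 1) (by omega) (by omega)
  have a3 := hs.nonneg (i := g + 1) (j := l) (by omega) (by omega)
  have a4 := hs.pos (g + 1) (l + 1) (by omega) (by omega)
  rw [area_swap (s l) (s g), area_swap (s l) (s (g + 1))] at p1
  rw [area_swap (s (l + 1)) (s g), area_swap (s (l + 1)) (s (g + 1))] at p2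
  rw [InGap] at hy
  rw [OutGap]
  generalize area (s g) y = u at *
  generalize area y (s (g + 1)) = v at *
  generalize area (s l) y = w at *
  generalize area (s (l + 1)) y = w' at *
  generalize area (s g) (s (g + 1)) = d at *
  generalize area (s g) (s l) = c1 at *
  generalize area (s g) (s (l + 1)) = c2 at *
  generalize area (s (g + 1)) (s l) = c3 at *
  generalize area (s (g + 1)) (s (l + 1)) = c4 at *
  have e : (w * d) * (w' * d) = c1 * c2 * v ^ 2 + c3 * c4 * u ^ 2 + (c1 * c4 + c2 * c3) * (u * v) := by
    rw [p1, p2]; ring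
  have : 0 < (w * d) * (w' * d) := by
    rw [e]
    have := mul_pos (mul_pos a1 a4) hy
    have := mul_nonneg (mul_nonneg a2 a3) hy.le
    have := mul_nonneg (mul_nonneg a1.le a2) (sq_nonneg v)
    have := mul_nonneg (mul_nonneg a3 a4.le) (sq_nonneg u)
    nlinarith
  have h5 : 0 < (w * w') * d ^ 2 := by linarith [this, (by ring : w * d * (w' * d) = w * w' * d ^ 2)]
  exact (mul_pos_iff_of_pos_right (by positivity)).mp h5

theorem PosSeq.outGap_self (hs : PosSeq N s) (hN : 1 < N) {g m : ℤ}
    (h1 : ∀ t, m ≠ g + N * t) (h2 : ∀ t, m ≠ g + 1 + N * t) : OutGap s g (s m) := by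
  obtain ⟨l, t, h0, h3, rfl⟩ := exists_window_int (by omega : 0 < N) m g
  have e1 : l ≠ g := fun h => h1 t (by rw [h])
  have e2 : l ≠ g + 1 := fun h => h2 t (by rw [h])
  obtain ⟨e, he, h⟩ := anti_sign hs.anti t
  have a1 := hs.pos g l (by omega) h3
  have a2 := hs.pos (g + 1) l (by omega) (by omega)
  rw [OutGap, area_swap, h, area_swap (s (g + 1)), h, area_swap (s l), area_swap (s l)]
  have := mul_pos a1 a2
  rw [show -(e * -area (s g) (s l)) * -(e * -area (s (g + 1)) (s l)) =
    e * e * (area (s g) (s l) * area (s (g + 1)) (s l)) by ring, he]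
  linarith

theorem PosSeq.cross (hs : PosSeq N s) (hN : 1 < N) {g i : ℤ} {y : ℤ × ℤ} (hy : InGap s g y)
    (h1 : ∀ t, i ≠ g + N * t) (h2 : ∀ t, i ≠ g + 1 + N * t) :
    area (s i) (s (g + 1)) ^ 2 * area (s g) y ^ 2 <
        area (s i) y ^ 2 * area (s g) (s (g + 1)) ^ 2 ∧
      area (s i) (s g) ^ 2 * area (s (g + 1)) y ^ 2 <
        area (s i) y ^ 2 * area (s g) (s (g + 1)) ^ 2 := by
  have h3 := hs.outGap_self hN h1 h2
  rw [OutGap, area_swap, area_swap (s (g + 1))] at h3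
  rw [area_swap (s (g + 1)) y]
  rw [InGap] at hy
  have p := area_plucker (s i) y (s g) (s (g + 1))
  generalize area (s g) y = u at *
  generalize area y (s (g + 1)) = v at *
  generalize area (s i) y = w at *
  generalize area (s g) (s (g + 1)) = d at *
  generalize area (s i) (s g) = α at *
  generalize area (s i) (s (g + 1)) = β at *
  have e : w ^ 2 * d ^ 2 = (α * v) ^ 2 + (β * u) ^ 2 + 2 * ((α * β) * (u * v)) := by
    rw [← mul_pow, p]; ring
  have h4 : 0 < (α * β) * (u * v) := mul_pos (by linarith) hy
  constructor <;> nlinarith [sq_nonneg (α * v), sq_nonneg (β * u)]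

/-- Insert the sums of consecutive vectors. -/
def refine (c : ℤ → ℤ × ℤ) (m : ℤ) : ℤ × ℤ :=
  if m % 2 = 0 then c (m / 2) else c (m / 2) + c (m / 2 + 1)

theorem refine_even (c : ℤ → ℤ × ℤ) (k : ℤ) : refine c (2 * k) = c k := by
  rw [refine, if_pos (by omega)]; congr 1; omega

theorem refine_odd (c : ℤ → ℤ × ℤ) (k : ℤ) : refine c (2 * k + 1) = c k + c (k + 1) := by
  rw [refine, if_neg (by omega), show (2 * k + 1) / 2 = k by omega]

theorem PosSeq.refine {c : ℤ → ℤ × ℤ} (hc : PosSeq N c) (hN : 1 < N) :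
    PosSeq (2 * N) (refine c) where
  anti m := by
    obtain ⟨k, rfl | rfl⟩ := Int.even_or_odd' m
    · rw [← mul_add, refine_even, refine_even, hc.anti]
    · rw [add_right_comm, ← mul_add, refine_odd, refine_odd, hc.anti, add_right_comm, hc.anti]
      exact (neg_add _ _).symm
  pos i j h1 h2 := by
    obtain ⟨k, rfl | rfl⟩ := Int.even_or_odd' i <;> obtain ⟨l, rfl | rfl⟩ := Int.even_or_odd' j
    · rw [refine_even, refine_even]; exact hc.pos _ _ (by omega) (by omega)
    · rw [refine_even, refine_odd, area_add_right]
      rcases eq_or_ne k l with rfl | h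
      · have := hc.pos k (k + 1) (by omega) (by omega)
        have := hc.nonneg (i := k) (j := k) (by omega) (by omega)
        linarith
      · have := hc.pos k l (by omega) (by omega)
        have := hc.nonneg (i := k) (j := l + 1) (by omega) (by omega)
        linarith
    · rw [refine_even, refine_odd, area_add_left]
      rcases eq_or_ne l (k + 1) with rfl | h
      · have := hc.pos k (k + 1) (by omega) (by omega)
        have := hc.nonneg (i := k + 1) (j := k + 1) (by omega) (by omega)
        linarith
      · have := hc.pos (k + 1) l (by omega) (by omega)
        have := hc.nonneg (i := k) (j := l) (by omega) (by omega)
        linarith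
    · rw [refine_odd, refine_odd, area_add_left, area_add_right, area_add_right]
      have := hc.pos k l (by omega) (by omega)
      have := hc.nonneg (i := k) (j := l + 1) (by omega) (by omega)
      have := hc.nonneg (i := k + 1) (j := l) (by omega) (by omega)
      have := hc.pos (k + 1) (l + 1) (by omega) (by omega)
      linarith

/-- Replacing some vectors of a convex sequence. -/
theorem PosSeq.replace {c c' : ℤ → ℤ × ℤ} (hc : PosSeq N c) (hc' : ∀ m, c' (m + N) = -c' m)
    (S : ℤ → Prop) (hS : ∀ k j, S k → k < j → j < k + N → ¬ S j)
    (h1 : ∀ k, ¬ S k → c' k = c k)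
    (h2 : ∀ k, S k → ∀ j, k < j → j < k + N → 0 < area (c' k) (c j)) : PosSeq N c' where
  anti := hc'
  pos i j hi hj := by
    by_cases h3 : S i
    · rw [h1 j (hS i j h3 hi hj)]
      exact h2 i h3 j hi hj
    · by_cases h4 : S j
      · have h5 := h2 j h4 (i + N) hj (by omega)
        rw [hc.anti, area_neg_right, area_swap, neg_neg, ← h1 i h3] at h5
        exact h5
      · rw [h1 i h3, h1 j h4]; exact hc.pos i j hi hj

end PosSeq

section Frames

variable (n : ℕ)

/-- The weight of the `k`-th generator. -/
def weight (k : ℕ) : ℤ := if k = 0 ∨ k = n - 1 then 1 else 2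

/-- A parabolic matrix of trace `-2`. -/
def parabolic (w k : ℤ) : SL(2, ℤ) :=
  ⟨!![-1 + 2 * w * k, 4 * w * k ^ 2; -w, -1 - 2 * w * k], by
    rw [Matrix.det_fin_two_of]; ring⟩

theorem act_parabolic (w k : ℤ) (p : ℤ × ℤ) : act (parabolic w k) p =
    ((-1 + 2 * w * k) * p.1 + 4 * w * k ^ 2 * p.2, -w * p.1 + (-1 - 2 * w * k) * p.2) := rfl

theorem tr_parabolic (w k : ℤ) : tr (parabolic w k) = -2 := by
  show (-1 + 2 * w * k) + (-1 - 2 * w * k) = -2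
  ring

variable [hn : Fact (2 ≤ n)]

/-- The monodromy representation of a punctured sphere with parabolic punctures. -/
def rho : FreeGroup (ZMod n) →* SL(2, ℤ) := lift fun c => parabolic (weight n c.val) c.val

variable {n}

theorem rho_x {k : ℕ} (hk : k < n) : rho n (x n k) = parabolic (weight n k) k := by
  rw [rho, x, FreeGroup.lift_apply_of]
  simp [ZMod.val_natCast, Nat.mod_eq_of_lt hk]

theorem tr_rho_of (c : ZMod n) : tr (rho n (of c)) = -2 := by
  rw [rho, FreeGroup.lift_apply_of, tr_parabolic]

theorem tr_rho_of_isConj {c : ZMod n} {p : FreeGroup (ZMod n)} (h : IsConj (of c) p) :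
    tr (rho n p) = -2 := by
  obtain ⟨g, rfl⟩ := isConj_iff.mp h
  rw [map_mul, map_mul, map_inv, tr_conj, tr_rho_of]

theorem tr_inv (g : SL(2, ℤ)) : tr g⁻¹ = tr g := by
  rw [Matrix.SpecialLinearGroup.SL2_inv_expl]
  simp [tr, add_comm]

/-- The ideal vertices of the polygon attached to an automorphism. -/
def cv (a : MulAut (FreeGroup (ZMod n))) (k : ℤ) : ℤ × ℤ := act (rho n (a (G n k)))⁻¹ (1, 0)

/-- The parabolic fixed vectors attached to an automorphism. -/
def uv (a : MulAut (FreeGroup (ZMod n))) (k : ℤ) : ℤ × ℤ := cv a k + cv a (k + 1)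

theorem cv_of_eq {a : MulAut (FreeGroup (ZMod n))} {k : ℤ} {g h : FreeGroup (ZMod n)} {l : ℤ}
    (e : a (G n k) = h * g) (hh : h = a (G n l)) : cv a k = act (rho n g)⁻¹ (cv a l) := by
  rw [cv, cv, e, hh, map_mul, mul_inv_rev, act_mul]

theorem cv_succ (a : MulAut (FreeGroup (ZMod n))) (k : ℤ) :
    cv a (k + 1) = act (rho n (a (x n k)))⁻¹ (cv a k) :=
  cv_of_eq (by rw [G_add_one, map_mul]) rfl

theorem act_cv (a : MulAut (FreeGroup (ZMod n))) (k : ℤ) :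
    act (rho n (a (x n k))) (cv a (k + 1)) = cv a k := by
  rw [cv_succ, act_act_inv]

theorem cv_one {k : ℕ} (hk : k + 1 < n) : cv (1 : MulAut (FreeGroup (ZMod n))) (k + 1) =
    (-1 - 2 * (k : ℤ), 1) := by
  induction k with
  | zero =>
    have h1 : cv (1 : MulAut (FreeGroup (ZMod n))) (0 : ℕ) = (1, 0) := by
      simp [cv, G_zero, act_one]
    rw [cv_succ, h1, MulAut.one_apply, rho_x (by omega)]
    have : ((1, 0) : ℤ × ℤ) = act (parabolic (weight n 0) (0 : ℕ)) (-1 - 2 * ((0 : ℕ) : ℤ), 1) := by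
      rw [act_parabolic, weight, if_pos (by simp)]
      simp
    rw [this, act_inv_act]
  | succ k ih =>
    rw [cv_succ, MulAut.one_apply, rho_x (by omega)]
    have e : cv (1 : MulAut (FreeGroup (ZMod n))) ((k + 1 : ℕ) : ℤ) =
        act (parabolic (weight n (k + 1)) (k + 1 : ℕ)) (-1 - 2 * ((k + 1 : ℕ) : ℤ), 1) := by
      push_cast
      rw [ih (by omega), act_parabolic, weight, if_neg (by omega)]
      ext <;> simp <;> ring
    rw [e, act_inv_act]

theorem cv_one_n : cv (1 : MulAut (FreeGroup (ZMod n))) n = -((1, 0) : ℤ × ℤ) := by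
  have h2 := hn.out
  obtain ⟨k, rfl⟩ : ∃ k, n = k + 2 := ⟨n - 2, by omega⟩
  have e : cv (1 : MulAut (FreeGroup (ZMod (k + 2)))) ((k + 1 : ℕ) : ℤ) =
      act (parabolic (weight (k + 2) (k + 1)) (k + 1 : ℕ)) (-1, 0) := by
    have h := cv_one (n := k + 2) (k := k) (by omega)
    push_cast
    rw [h, act_parabolic, weight, if_pos (by omega)]
    ext <;> simp <;> ring
  have h := cv_succ (1 : MulAut (FreeGroup (ZMod (k + 2)))) (k + 1 : ℕ)
  rw [e, MulAut.one_apply, rho_x (by omega), act_inv_act] at h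
  push_cast at h ⊢
  rw [show (k : ℤ) + 2 = k + 1 + 1 by ring, h]
  rfl

theorem act_rho_Del : act (rho n (Del n))⁻¹ (1, 0) = -(1, 0) := by
  rw [← cv_one_n (n := n), cv, MulAut.one_apply, G_n]

theorem cv_anti {a : MulAut (FreeGroup (ZMod n))} (ha : a ∈ A n) (k : ℤ) :
    cv a (k + n) = -cv a k := by
  rw [cv, G_add, map_mul, A_Del ha, map_mul, mul_inv_rev, act_mul, act_rho_Del, act_neg]
  rfl

theorem PosSeq.of_window {s : ℤ → ℤ × ℤ} (hs : ∀ m, s (m + n) = -s m)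
    (h : ∀ i j : ℤ, 0 ≤ i → i < j → j < n → 0 < area (s i) (s j)) : PosSeq n s where
  anti := hs
  pos i j hi hj := by
    obtain ⟨l, t, h0, h1, rfl⟩ := exists_window (n := n) i 0
    obtain ⟨j, rfl⟩ : ∃ j', j = j' + n * t := ⟨j - n * t, by ring⟩
    rw [anti_area hs]
    rcases lt_or_ge j n with h2 | h2
    · exact h l j h0 (by linarith) h2
    · have h3 := h (j - n) l (by omega) (by linarith) (by linarith)
      have h4 := hs (j - n)
      rw [sub_add_cancel] at h4
      rwa [h4, area_neg_right, area_swap, neg_neg]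

theorem posSeq_cv_one : PosSeq n (cv (1 : MulAut (FreeGroup (ZMod n)))) := by
  apply PosSeq.of_window (cv_anti (one_mem _))
  intro i j h0 h1 h2
  have e : ∀ k : ℤ, 0 < k → k < n → cv (1 : MulAut (FreeGroup (ZMod n))) k = (1 - 2 * k, 1) := by
    intro k hk hk'
    lift k to ℕ using hk.le
    obtain ⟨k, rfl⟩ : ∃ m, k = m + 1 := ⟨k - 1, by omega⟩
    push_cast
    rw [cv_one (by omega)]
    ext <;> simp; ring
  rw [e j (by omega) h2]
  rcases h0.lt_or_eq with h | rfl
  · rw [e i h (by omega)]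
    simp only [area]; linarith
  · simp [cv, G_zero, act_one, area]

theorem sg_inv_G {i : ℕ} (h : i + 1 < n) (k : ℤ) : (sg n i)⁻¹ (G n k) =
    if ((i + 1 : ℤ) : ZMod n) = k then G n (k - 1) * x n k else G n k := by
  have h2 := two_le (n := n)
  rw [MulAut.inv_apply, MulEquiv.symm_apply_eq]
  split_ifs with h1
  · rw [map_mul, x_eq, map_mul, map_inv, sg_G h, sg_G h, sg_G h, if_pos h1, if_neg, if_neg]
    · rw [mul_inv_rev, inv_inv]
      have := G_add_one (n := n) (k - 1)
      rw [sub_add_cancel] at this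
      rw [this]; group
    · rw [h1]; exact intCast_ne (by omega) (by omega)
    · rw [h1]; exact (intCast_ne (by omega) (by omega)).symm
  · rw [sg_G h, if_neg h1]

theorem not_congr_of_lt {c : ZMod n} {k j : ℤ} (hk : c = k) (h1 : k < j) (h2 : j < k + n) :
    c ≠ (j : ZMod n) := hk ▸ intCast_ne h1 h2

theorem posSeq_cv_mul_sg {a : MulAut (FreeGroup (ZMod n))} (ha : a ∈ A n)
    (hc : PosSeq n (cv a)) (i : ℕ) : PosSeq n (cv (a * sg n i)) := by
  have h2 := two_le (n := n)
  by_cases h : i + 1 < n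
  swap
  · rwa [sg_of_le (by omega), mul_one]
  refine hc.replace (cv_anti (mul_mem ha (sg_mem i))) (fun k => ((i + 1 : ℤ) : ZMod n) = k)
    (fun k j hk h1 h2 => not_congr_of_lt hk h1 h2) ?_ ?_
  · intro k hk
    rw [cv, MulAut.mul_apply, sg_G h, if_neg hk, cv]
  · intro k hk j hj hj'
    have e : cv (a * sg n i) k = act (rho n (a (x n (k - 1)))) (cv a (k + 1)) := by
      rw [cv, MulAut.mul_apply, sg_G h, if_pos hk, map_mul, map_mul, mul_inv_rev, act_mul, map_inv,
        map_inv, inv_inv, cv]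
    have hu := act_cv a (k - 1)
    rw [sub_add_cancel] at hu
    have key := area_act_parabolic
      (tr_rho_of_isConj ((A_perm ha).choose_spec ((k - 1 : ℤ) : ZMod n))) hu
      (cv a (k + 1)) (cv a j)
    rw [show of ((k - 1 : ℤ) : ZMod n) = x n (k - 1) from rfl, ← e, area_add_left, area_add_left] at key
    have p := area_plucker (cv a (k - 1)) (cv a k) (cv a (k + 1)) (cv a j)
    rw [area_swap (cv a (k + 1)) (cv a k)] at p
    have a01 := hc.pos (k - 1) k (by omega) (by omega)
    have a02 := hc.nonneg (i := k - 1) (j := k + 1) (by omega) (by omega)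
    have a12 := hc.pos k (k + 1) (by omega) (by omega)
    have a0j := hc.nonneg (i := k - 1) (j := j) (by omega) (by omega)
    have a1j := hc.pos k j (by omega) (by omega)
    have := mul_pos a12 a1j
    have := mul_nonneg a12.le a0j
    have := mul_nonneg a02 a0j
    refine (mul_pos_iff_of_pos_left a01).mp ?_
    linarith

theorem posSeq_cv_mul_sg_inv {a : MulAut (FreeGroup (ZMod n))} (ha : a ∈ A n)
    (hc : PosSeq n (cv a)) (i : ℕ) : PosSeq n (cv (a * (sg n i)⁻¹)) := by
  have h2 := two_le (n := n)
  by_cases h : i + 1 < n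
  swap
  · rwa [sg_of_le (by omega), inv_one, mul_one]
  refine hc.replace (cv_anti (mul_mem ha (inv_mem (sg_mem i))))
    (fun k => ((i + 1 : ℤ) : ZMod n) = k) (fun k j hk h1 h2 => not_congr_of_lt hk h1 h2) ?_ ?_
  · intro k hk
    rw [cv, MulAut.mul_apply, sg_inv_G h, if_neg hk, cv]
  · intro k hk j hj hj'
    have e : cv (a * (sg n i)⁻¹) k = act (rho n (a (x n k)))⁻¹ (cv a (k - 1)) := by
      rw [cv, MulAut.mul_apply, sg_inv_G h, if_pos hk, map_mul, map_mul, mul_inv_rev, act_mul, cv]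
    have key := area_act_parabolic ((tr_inv _).trans
      (tr_rho_of_isConj ((A_perm ha).choose_spec (k : ZMod n)))) (cv_succ a k).symm
      (cv a (k - 1)) (cv a j)
    rw [show of (k : ZMod n) = x n k from rfl, ← e, area_add_left, area_add_left, area_swap (cv a (k + 1)) (cv a k),
      area_swap (cv a (k + 1)) (cv a (k - 1)), area_swap (cv a k) (cv a (k - 1))] at key
    have p := area_plucker (cv a (k - 1)) (cv a k) (cv a (k + 1)) (cv a j)
    rw [area_swap (cv a (k + 1)) (cv a k)] at p
    have a01 := hc.pos (k - 1) k (by omega) (by omega)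
    have a02 := hc.nonneg (i := k - 1) (j := k + 1) (by omega) (by omega)
    have a12 := hc.pos k (k + 1) (by omega) (by omega)
    have a2j := hc.nonneg (i := k + 1) (j := j) (by omega) (by omega)
    have a1j := hc.pos k j (by omega) (by omega)
    have := mul_pos a01 a1j
    have := mul_nonneg a01.le a2j
    have := mul_nonneg a02 a2j
    refine (mul_pos_iff_of_pos_left a12).mp ?_
    linarith

theorem posSeq_cv {a : MulAut (FreeGroup (ZMod n))} (ha : a ∈ A n) : PosSeq n (cv a) := by
  induction ha using Subgroup.closure_induction_right with
  | one => exact posSeq_cv_one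
  | mul_right y hy z hz ih =>
    obtain ⟨i, rfl⟩ := hz
    exact posSeq_cv_mul_sg hy ih i
  | mul_inv_cancel y hy z hz ih =>
    obtain ⟨i, rfl⟩ := hz
    exact posSeq_cv_mul_sg_inv hy ih i

theorem tr_rho_apply_x {a : MulAut (FreeGroup (ZMod n))} (ha : a ∈ A n) (k : ℤ) :
    tr (rho n (a (x n k))) = -2 :=
  tr_rho_of_isConj ((A_perm ha).choose_spec (k : ZMod n))

variable (n) in
/-- The complexity of a peripheral element. -/
def N (p : FreeGroup (ZMod n)) : ℕ := (rho n p 1 0).natAbs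

theorem N_Del_conj (t : ℤ) (p : FreeGroup (ZMod n)) :
    N n (Del n ^ t * p * (Del n ^ t)⁻¹) = N n p := by
  have h : ∀ g h : SL(2, ℤ), act h⁻¹ (1, 0) = (1, 0) ∨ act h⁻¹ (1, 0) = -(1, 0) →
      (h * g * h⁻¹) 1 0 = g 1 0 := by
    intro g h hh
    have e : ∀ g : SL(2, ℤ), g 1 0 = area (1, 0) (act g (1, 0)) := fun g => by simp [area, act]
    rw [e, e, act_mul, act_mul, ← area_act h⁻¹, act_inv_act]
    rcases hh with hh | hh
    · rw [hh]
    · rw [hh, act_neg, area_neg_left, area_neg_right, neg_neg]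
  have h2 : ∀ t : ℤ, act ((rho n (Del n)) ^ t) (1, 0) = (1, 0) ∨
      act ((rho n (Del n)) ^ t) (1, 0) = -(1, 0) := by
    have h3 : act (rho n (Del n)) (1, 0) = -(1, 0) := by
      have := congrArg (act (rho n (Del n))) (act_rho_Del (n := n))
      rw [act_act_inv, act_neg] at this
      rw [eq_comm, neg_eq_iff_eq_neg]; exact this
    intro t
    induction t with
    | zero => simp [act_one]
    | succ t ih =>
      rw [zpow_add_one, act_mul, h3, act_neg, neg_inj, neg_eq_iff_eq_neg]; exact ih.symm
    | pred t ih =>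
      rw [zpow_sub_one, act_mul, act_rho_Del, act_neg, neg_inj, neg_eq_iff_eq_neg]; exact ih.symm
  rw [N, N, map_mul, map_mul, map_inv, h]
  rw [map_zpow, ← zpow_neg]
  exact h2 (-t)

theorem mul_N {a : MulAut (FreeGroup (ZMod n))} (ha : a ∈ A n) (i k : ℤ)
    (w : FreeGroup (ZMod n)) :
    area (cv a k) (cv a (k + 1)) * (N n (a (G n i * w * x n k * w⁻¹ * (G n i)⁻¹)) : ℤ) =
      area (cv a i) (act (rho n (a w)) (uv a k)) ^ 2 := by
  have hd := (posSeq_cv ha).pos k (k + 1) (by omega) (by have := two_le (n := n); omega)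
  have e : ∀ g : SL(2, ℤ), g 1 0 = area (1, 0) (act g (1, 0)) := fun g => by simp [area, act]
  have key := area_act_parabolic (tr_rho_apply_x ha k) (act_cv a k)
    (act (rho n (a w))⁻¹ (cv a i)) (act (rho n (a w))⁻¹ (cv a i))
  rw [area_self, mul_zero, neg_zero, zero_add, ← area_act (rho n (a w)) (cv a k + _),
    act_act_inv] at key
  have e2 : rho n (a (G n i * w * x n k * w⁻¹ * (G n i)⁻¹)) 1 0 =
      -area (act (rho n (a (x n k))) (act (rho n (a w))⁻¹ (cv a i)))
        (act (rho n (a w))⁻¹ (cv a i)) := by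
    rw [e, ← area_act (rho n (a (G n i)))⁻¹, ← area_act (rho n (a w))⁻¹, area_swap, neg_inj]
    congr 1
    rw [← act_mul, ← act_mul, cv, ← act_mul, ← act_mul]
    congr 1
    simp only [map_mul, map_inv]
    group
  have h3 := abs_mul (area (cv a k) (cv a (k + 1)))
    (area (act (rho n (a (x n k))) (act (rho n (a w))⁻¹ (cv a i))) (act (rho n (a w))⁻¹ (cv a i)))
  rw [abs_of_pos hd, key, abs_mul_self] at h3
  rw [N, e2, Int.natAbs_neg, Int.natCast_natAbs, ← h3, area_swap (cv a i), neg_sq, sq]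
  rfl

theorem mul_N_D {a : MulAut (FreeGroup (ZMod n))} (ha : a ∈ A n) (i k : ℤ) :
    area (cv a k) (cv a (k + 1)) * (N n (a (D n i k)) : ℤ) = area (cv a i) (uv a k) ^ 2 := by
  have := mul_N ha i k 1
  rwa [mul_one, inv_one, mul_one, map_one, map_one, act_one] at this

/-- Words which are reduced and do not end in a letter `c` or its inverse. -/
def Good (c : ZMod n) : List (ZMod n × Bool) → Prop
  | [] => True
  | [a] => a.1 ≠ c
  | a :: b :: L => (a.1 = b.1 → a.2 = b.2) ∧ Good c (b :: L)

theorem Good.tail {c : ZMod n} {a : ZMod n × Bool} {L : List (ZMod n × Bool)}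
    (h : Good c (a :: L)) : Good c L := by
  cases L with
  | nil => trivial
  | cons b L => exact h.2

theorem mk_cons (a : ZMod n × Bool) (L : List (ZMod n × Bool)) :
    FreeGroup.mk (a :: L) = (if a.2 then of a.1 else (of a.1)⁻¹) * FreeGroup.mk L := by
  obtain ⟨c, b⟩ := a
  cases b
  · rw [if_neg (by simp), of, FreeGroup.inv_mk, FreeGroup.mul_mk]; rfl
  · rw [if_pos rfl, of, FreeGroup.mul_mk]; rfl

theorem exists_good {c : ZMod n} {q : FreeGroup (ZMod n)} (h : IsConj (of c) q) :
    ∃ L, Good c L ∧ q = FreeGroup.mk L * of c * (FreeGroup.mk L)⁻¹ := by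
  obtain ⟨g, rfl⟩ := isConj_iff.mp h
  obtain ⟨L, rfl⟩ : ∃ L, FreeGroup.mk L = g := ⟨g.toWord, FreeGroup.mk_toWord⟩
  induction L with
  | nil => exact ⟨[], trivial, rfl⟩
  | cons a L ih =>
    obtain ⟨L', h1, h2⟩ := ih (isConj_iff.mpr ⟨_, rfl⟩)
    have e : FreeGroup.mk (a :: L) * of c * (FreeGroup.mk (a :: L))⁻¹ =
        (if a.2 then of a.1 else (of a.1)⁻¹) * (FreeGroup.mk L' * of c * (FreeGroup.mk L')⁻¹) *
          (if a.2 then of a.1 else (of a.1)⁻¹)⁻¹ := by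
      rw [← h2, mk_cons]; group
    rw [e]
    cases L' with
    | nil =>
      by_cases h3 : a.1 = c
      · refine ⟨[], trivial, ?_⟩
        rw [h3, ← FreeGroup.one_eq_mk]
        split_ifs <;> group
      · refine ⟨[a], h3, ?_⟩
        rw [mk_cons]; group
    | cons b L' =>
      by_cases h3 : a.1 = b.1 → a.2 = b.2
      · refine ⟨a :: b :: L', ⟨h3, h1⟩, ?_⟩
        rw [mk_cons a]; group
      · refine ⟨L', h1.tail, ?_⟩
        rw [Classical.not_imp] at h3
        rw [mk_cons b, h3.1]
        cases ha : a.2 <;> cases hb : b.2 <;> simp_all <;> group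

theorem posSeq_refine {a : MulAut (FreeGroup (ZMod n))} (ha : a ∈ A n) :
    PosSeq (2 * n) (refine (cv a)) :=
  (posSeq_cv ha).refine (by have := two_le (n := n); omega)

theorem act_uv {a : MulAut (FreeGroup (ZMod n))} (ha : a ∈ A n) (k : ℤ) :
    act (rho n (a (x n k))) (uv a k) = -uv a k :=
  act_parabolic_add (tr_rho_apply_x ha k) (act_cv a k)

theorem inGap_act {a : MulAut (FreeGroup (ZMod n))} (ha : a ∈ A n) {j : ℤ} {y : ℤ × ℤ}
    (hy : OutGap (refine (cv a)) (2 * j + 1) y) :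
    InGap (refine (cv a)) (2 * j) (act (rho n (a (x n j))) y) := by
  rw [OutGap, refine_odd, show 2 * j + 1 + 1 = 2 * (j + 1) by ring, refine_even] at hy
  rw [InGap, refine_odd, refine_even]
  have e : area (act (rho n (a (x n j))) y) (cv a j + cv a (j + 1)) = area (uv a j) y := by
    rw [show cv a j + cv a (j + 1) = -act (rho n (a (x n j))) (uv a j) by
      rw [act_uv ha, neg_neg]; rfl, area_neg_right, area_act, ← area_swap]
  rw [e]
  conv => enter [2, 1, 1]; rw [← act_cv]
  rw [area_act, mul_comm]
  exact hy

theorem inGap_act_inv {a : MulAut (FreeGroup (ZMod n))} (ha : a ∈ A n) {j : ℤ} {y : ℤ × ℤ}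
    (hy : OutGap (refine (cv a)) (2 * j) y) :
    InGap (refine (cv a)) (2 * j + 1) (act (rho n (a (x n j)))⁻¹ y) := by
  rw [OutGap, refine_odd, refine_even] at hy
  rw [InGap, refine_odd, show 2 * j + 1 + 1 = 2 * (j + 1) by ring, refine_even]
  rw [← area_act (rho n (a (x n j))), ← area_act (rho n (a (x n j))) _ (cv a (j + 1)),
    act_act_inv, act_cv, act_parabolic_add (tr_rho_apply_x ha j) (act_cv a j), area_neg_left,
    area_swap y, neg_mul_neg, mul_comm]
  exact hy

theorem inGap_of_good {a : MulAut (FreeGroup (ZMod n))} (ha : a ∈ A n) {k : ℤ}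
    {L : List (ZMod n × Bool)} (l : ZMod n × Bool) (hL : Good (k : ZMod n) (l :: L)) (j : ℤ)
    (hj : (j : ZMod n) = l.1) :
    InGap (refine (cv a)) (if l.2 then 2 * j else 2 * j + 1)
      (act (rho n (a (FreeGroup.mk (l :: L)))) (uv a k)) := by
  have h2 := two_le (n := n)
  have hs := posSeq_refine ha
  induction L generalizing l j with
  | nil =>
    have hk : refine (cv a) (2 * k + 1) = uv a k := refine_odd _ _
    have hjk : (j : ZMod n) ≠ k := hj ▸ hL
    rw [mk_cons, ← hj, ← FreeGroup.one_eq_mk, mul_one]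
    split_ifs
    · apply inGap_act ha
      rw [← hk]
      apply hs.outGap_self (by omega)
      · intro t ht
        exact hjk (intCast_eq_iff.mpr ⟨t, by linarith⟩)
      · intro t ht
        replace ht : 2 * k + 1 = 2 * (j + 1 + n * t) := by linarith
        omega
    · rw [map_inv, map_inv]
      apply inGap_act_inv ha
      rw [← hk]
      apply hs.outGap_self (by omega)
      · intro t ht
        replace ht : 2 * k + 1 = 2 * (j + n * t) := by linarith
        omega
      · intro t ht
        exact hjk (intCast_eq_iff.mpr ⟨t, by linarith⟩)
  | cons b L ih =>
    obtain ⟨i, hi⟩ := exists_int_rep b.1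
    have h3 := ih b hL.2 i hi
    have hji : (j : ZMod n) = i → l.2 = b.2 := fun h => hL.1 (by rw [← hj, ← hi, h])
    rw [mk_cons, ← hj, map_mul, map_mul, act_mul]
    split_ifs with hl
    · apply inGap_act ha
      apply hs.outGap_of_inGap (by omega) h3
      intro t ht
      split_ifs at ht with hb
      · replace ht : 2 * j + 1 = 2 * (i + n * t) := by linarith
        omega
      · exact hb (hji (intCast_eq_iff.mpr ⟨-t, by linarith⟩) ▸ hl)
    · rw [map_inv, map_inv]
      apply inGap_act_inv ha
      apply hs.outGap_of_inGap (by omega) h3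
      intro t ht
      split_ifs at ht with hb
      · exact hl (hji (intCast_eq_iff.mpr ⟨-t, by linarith⟩) ▸ hb)
      · replace ht : 2 * j = 2 * (i + n * t) + 1 := by linarith
        omega

theorem D_or_exists_lt_of_good {k : ℤ} (L : List (ZMod n × Bool)) (hL : Good (k : ZMod n) L)
    (i : ℤ) :
    (∃ i', G n i * FreeGroup.mk L * x n k * (FreeGroup.mk L)⁻¹ * (G n i)⁻¹ = D n i' k) ∨
      ∃ i' k' q', IsConj (x n k) q' ∧ ∀ a ∈ A n,
        N n (a (D n i' k')) * N n (a q') <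
          N n (a (G n i * FreeGroup.mk L * x n k * (FreeGroup.mk L)⁻¹ * (G n i)⁻¹)) *
            N n (a (Z n k')) := by
  have h2 := two_le (n := n)
  induction L generalizing i with
  | nil => exact Or.inl ⟨i, by rw [D, ← FreeGroup.one_eq_mk]; group⟩
  | cons l L ih =>
    obtain ⟨j, hj⟩ := exists_int_rep l.1
    have conj : ∀ i, IsConj (x n k)
        (G n i * FreeGroup.mk (l :: L) * x n k * (FreeGroup.mk (l :: L))⁻¹ * (G n i)⁻¹) :=
      fun i => isConj_iff.mpr ⟨G n i * FreeGroup.mk (l :: L), by group⟩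
    have key : ∀ i : ℤ, (∀ t, 2 * i ≠ (if l.2 then 2 * j else 2 * j + 1) + (2 * n) * t) →
        (∀ t, 2 * i ≠ (if l.2 then 2 * j else 2 * j + 1) + 1 + (2 * n) * t) → 
        ∃ i' k' q', IsConj (x n k) q' ∧ ∀ a ∈ A n,
        N n (a (D n i' k')) * N n (a q') <
          N n (a (G n i * FreeGroup.mk (l :: L) * x n k * (FreeGroup.mk (l :: L))⁻¹ *
            (G n i)⁻¹)) * N n (a (Z n k')) := by
      intro i h3 h4
      have fin : ∀ {a} (_ : a ∈ A n) (j' : ℤ), D n j' j = Z n j →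
          area (cv a i) (uv a j) ^ 2 * area (cv a j') 
            (act (rho n (a (FreeGroup.mk (l :: L)))) (uv a k)) ^ 2 <
          area (cv a i) (act (rho n (a (FreeGroup.mk (l :: L)))) (uv a k)) ^ 2 *
            area (cv a j') (uv a j) ^ 2 →
          N n (a (D n i j)) * N n (a (G n j' * FreeGroup.mk (l :: L) * x n k *
            (FreeGroup.mk (l :: L))⁻¹ * (G n j')⁻¹)) < N n (a (G n i * FreeGroup.mk (l :: L) * x n k * (FreeGroup.mk (l :: L))⁻¹ *
            (G n i)⁻¹)) * N n (a (Z n j)) := by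
        intro a ha j' hj' hlt
        rw [← mul_N ha, ← mul_N ha, ← mul_N_D ha, ← mul_N_D ha, hj'] at hlt
        have d1 := (posSeq_cv ha).pos k (k + 1) (by omega) (by omega)
        have d2 := (posSeq_cv ha).pos j (j + 1) (by omega) (by omega)
        zify
        refine lt_of_mul_lt_mul_left ?_ (mul_pos d1 d2).le
        linarith
      cases hl : l.2 with
      | true =>
        simp only [hl, if_true] at h3 h4
        refine ⟨i, j, _, conj j, fun a ha => fin ha j rfl ?_⟩
        have h5 := inGap_of_good ha l hL j hj
        rw [hl, if_pos rfl] at h5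
        have := ((posSeq_refine ha).cross (by omega) h5 h3 h4).1
        rwa [refine_even, refine_even, refine_odd] at this
      | false =>
        simp only [hl] at h3 h4
        refine ⟨i, j, _, conj (j + 1), fun a ha => fin ha (j + 1) (D_succ_self j) ?_⟩
        have h5 := inGap_of_good ha l hL j hj
        rw [hl, if_neg (by simp)] at h5
        have := ((posSeq_refine ha).cross (by omega) h5 h3 h4).2
        rw [show 2 * j + 1 + 1 = 2 * (j + 1) by ring, refine_even, refine_even, refine_odd,
          area_swap (_ + _)] at this
        rwa [neg_sq] at this
    cases hl : l.2 with
    | true =>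
      by_cases h3 : (i : ZMod n) = j
      · have e : G n i * FreeGroup.mk (l :: L) = G n (i + 1) * FreeGroup.mk L := by
          rw [mk_cons, hl, if_pos rfl, ← hj, ← h3, G_add_one, mul_assoc]; rfl
        have e2 : ∀ g h k : FreeGroup (ZMod n), g * h * k * h⁻¹ * g⁻¹ = (g * h) * k * (g * h)⁻¹ :=
          fun g h k => by group
        rw [e2, e, ← e2]
        exact ih hL.tail (i + 1)
      · right
        apply key
        · intro t ht
          rw [hl, if_pos rfl] at ht
          exact h3 (intCast_eq_iff.mpr ⟨-t, by linarith⟩)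
        · intro t ht
          rw [hl, if_pos rfl] at ht
          replace ht : 2 * i = 2 * (j + n * t) + 1 := by linarith
          omega
    | false =>
      by_cases h3 : (i : ZMod n) = (j + 1 : ℤ)
      · have e : G n i * FreeGroup.mk (l :: L) = G n (i - 1) * FreeGroup.mk L := by
          have h4 : (j : ZMod n) = ((i - 1 : ℤ) : ZMod n) := by push_cast at h3 ⊢; rw [h3]; ring
          have h5 := G_add_one (n := n) (i - 1)
          rw [sub_add_cancel] at h5
          rw [mk_cons, hl, if_neg (by simp), ← hj, h4, h5, ← mul_assoc]
          congr 1
          exact mul_inv_cancel_right _ _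
        have e2 : ∀ g h k : FreeGroup (ZMod n), g * h * k * h⁻¹ * g⁻¹ = (g * h) * k * (g * h)⁻¹ :=
          fun g h k => by group
        rw [e2, e, ← e2]
        exact ih hL.tail (i - 1)
      · right
        apply key
        · intro t ht
          rw [hl, if_neg (by simp)] at ht
          replace ht : 2 * i = 2 * (j + n * t) + 1 := by linarith
          omega
        · intro t ht
          rw [hl, if_neg (by simp)] at ht
          exact h3 (intCast_eq_iff.mpr ⟨-t, by linarith⟩)

theorem D_or_exists_lt {c : ZMod n} {q : FreeGroup (ZMod n)} (h : IsConj (of c) q) :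
    (∃ i k : ℤ, (k : ZMod n) = c ∧ q = D n i k) ∨
      ∃ i k q', IsConj (of c) q' ∧ ∀ a ∈ A n,
        N n (a (D n i k)) * N n (a q') < N n (a q) * N n (a (Z n k)) := by
  obtain ⟨k, rfl⟩ := exists_int_rep c
  obtain ⟨L, hL, rfl⟩ := exists_good h
  have := D_or_exists_lt_of_good L hL 0
  rw [G_zero, one_mul, inv_one, mul_one] at this
  rcases this with ⟨i, hi⟩ | h
  · exact Or.inl ⟨i, k, rfl, hi⟩
  · exact Or.inr h

end Frames

section Replace

variable {n : ℕ} [hn : Fact (2 ≤ n)]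

theorem exists_replace_zero (k : ℕ) (hk : k < n) : ∃ s ∈ A n, s (Z n 0) = D n 0 k ∧
    (∀ l : ℕ, l < k → s (Z n (l + 1)) = Z n l) ∧
      ∀ l : ℕ, k < l → l < n → s (Z n l) = Z n l := by
  induction k with
  | zero => exact ⟨1, one_mem _, rfl, fun l hl => absurd hl (by omega), fun _ _ _ => rfl⟩
  | succ k ih =>
    obtain ⟨s, hs, h0, h1, h2⟩ := ih (by omega)
    refine ⟨(sg n k)⁻¹ * s, mul_mem (inv_mem (sg_mem k)) hs, ?_, ?_, ?_⟩
    · rw [MulAut.mul_apply, h0, MulAut.inv_apply, MulEquiv.symm_apply_eq]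
      simp only [D, G_zero, one_mul, inv_one, mul_one]
      push_cast
      rw [sg_right hk]
    · intro l hl
      rcases Nat.lt_succ_iff_lt_or_eq.mp hl with h | rfl
      · rw [MulAut.mul_apply, h1 l h, MulAut.inv_apply, MulEquiv.symm_apply_eq,
          sg_Z_other hk (by omega) (by omega) (by omega)]
      · have h3 := h2 (l + 1) (by omega) hk
        push_cast at h3
        rw [MulAut.mul_apply, h3, MulAut.inv_apply, MulEquiv.symm_apply_eq, sg_Z_left hk]
    · intro l hl hl'
      rw [MulAut.mul_apply, h2 l (by omega) hl', MulAut.inv_apply, MulEquiv.symm_apply_eq,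
        sg_Z_other hk hl' (by omega) (by omega)]

theorem apply_Z_add {s : MulAut (FreeGroup (ZMod n))} (hs : s ∈ A n) {l l' : ℤ}
    (h : s (Z n l) = Z n l') (t : ℤ) : s (Z n (l + n * t)) = Z n (l' + n * t) := by
  rw [Z_add, Z_add, map_mul, map_mul, map_inv, map_zpow, A_Del hs, h]

theorem exists_replace (i k : ℤ) : ∃ s ∈ A n, (∃ l, s (Z n l) = D n i k) ∧
    ∀ l : ℤ, (l : ZMod n) ≠ k → ∃ l', s (Z n l') = Z n l := by
  obtain ⟨k', t, h0, h1, rfl⟩ := exists_window (n := n) k i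
  rw [D_add_right]
  obtain ⟨k, rfl⟩ : ∃ k : ℕ, k' = i + k := ⟨(k' - i).toNat, by omega⟩
  obtain ⟨s, hs, h2, h3, h4⟩ := exists_replace_zero (n := n) k (by omega)
  have hd : ∀ r : ℤ, delta n ^ r ∈ A n := fun r => zpow_mem delta_mem r
  refine ⟨delta n ^ i * s * delta n ^ (-i), mul_mem (mul_mem (hd i) hs) (hd (-i)), ⟨i, ?_⟩, ?_⟩
  · rw [MulAut.mul_apply, MulAut.mul_apply, delta_zpow_Z, add_neg_cancel, h2, delta_zpow_D]
    congr 1 <;> ring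
  · intro l hl
    suffices ∃ l', s (Z n l') = Z n (l - i) by
      obtain ⟨l', h⟩ := this
      refine ⟨l' + i, ?_⟩
      rw [MulAut.mul_apply, MulAut.mul_apply, delta_zpow_Z, add_neg_cancel_right, h, delta_zpow_Z,
        sub_add_cancel]
    obtain ⟨l', u, h5, h6, h7⟩ := exists_window (n := n) (l - i) 0
    obtain ⟨r, rfl⟩ : ∃ r : ℕ, l' = r := ⟨l'.toNat, by omega⟩
    rw [h7]
    rcases lt_trichotomy r k with h | rfl | h
    · exact ⟨_, apply_Z_add hs (h3 r h) u⟩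
    · exact absurd (intCast_eq_iff.mpr ⟨t - u, by linarith⟩) hl
    · exact ⟨_, apply_Z_add hs (h4 r h (by omega)) u⟩

end Replace

section Slope

variable {n : ℕ} [hn : Fact (2 ≤ n)]

theorem apply_isConj {α β F : Type*} [Group α] [Group β] [FunLike F α β] [MonoidHomClass F α β]
    (f : F) {p q : α} (h : IsConj p q) : IsConj (f p) (f q) := by
  obtain ⟨g, rfl⟩ := isConj_iff.mp h
  exact isConj_iff.mpr ⟨f g, by simp only [map_mul, map_inv]⟩

theorem area_cv_uv_pos {a : MulAut (FreeGroup (ZMod n))} (ha : a ∈ A n) {i k : ℤ}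
    (h : i ≤ k) (h' : k < i + n) : 0 < area (cv a i) (uv a k) := by
  have := (posSeq_refine ha).pos (2 * i) (2 * k + 1) (by omega) (by omega)
  rwa [refine_even, refine_odd] at this

theorem N_D_pos {a : MulAut (FreeGroup (ZMod n))} (ha : a ∈ A n) (i k : ℤ) :
    0 < N n (a (D n i k)) := by
  obtain ⟨k, t, h0, h1, rfl⟩ := exists_window (n := n) k i
  rw [D_add_right]
  have h := mul_N_D ha i k
  have h2 := area_cv_uv_pos ha h0 h1
  have hd := (posSeq_cv ha).pos k (k + 1) (by omega) (by have := two_le (n := n); omega)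
  rw [← Int.natCast_pos]
  refine (mul_pos_iff_of_pos_left hd).mp ?_
  rw [h]; positivity

theorem N_pos {c : ZMod n} {p : FreeGroup (ZMod n)} (h : IsConj (of c) p) : 0 < N n p := by
  rcases D_or_exists_lt h with ⟨i, k, -, rfl⟩ | ⟨i, k, q', -, h2⟩
  · exact N_D_pos (one_mem (A n)) i k
  · have := h2 1 (one_mem _)
    exact Nat.pos_of_ne_zero fun h0 => by simp [h0] at this

variable (n) in
/-- The fixed point of the parabolic matrix attached to a peripheral element. -/
def sl (p : FreeGroup (ZMod n)) : ℚ := ((rho n p 0 0 : ℤ) + 1) / (rho n p 1 0 : ℤ)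

theorem sl_D {a : MulAut (FreeGroup (ZMod n))} (ha : a ∈ A n) {i k : ℤ}
    (h : i ≤ k) (h' : k < i + n) : sl n (a (D n i k)) =
      ((act (rho n (a (G n i))) (uv a k)).1 : ℚ) / (area (cv a i) (uv a k) : ℤ) := by
  have h1 := N_D_pos ha i k
  have h2 := area_cv_uv_pos ha h h'
  have e1 : area (cv a i) (uv a k) = (act (rho n (a (G n i))) (uv a k)).2 := by
    rw [← area_act (rho n (a (G n i))), cv, act_act_inv]; simp [area]
  have e2 : act (rho n (a (D n i k))) (act (rho n (a (G n i))) (uv a k)) =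
      -act (rho n (a (G n i))) (uv a k) := by
    rw [← act_neg, ← act_uv ha, ← act_mul, ← act_mul, ← map_mul, ← map_mul, ← map_mul, ← map_mul]
    congr 3
    rw [D]; group
  have e3 := tr_rho_of_isConj ((A_perm ha).choose_spec (k : ZMod n))
  have e4 : tr (rho n (a (D n i k))) = -2 := by
    rw [D]
    simp only [map_mul, map_inv, tr_conj]
    exact e3
  rw [e1] at h2 ⊢
  have e5 := congrArg Prod.snd e2
  simp only [act, tr, N, Prod.snd_neg] at e5 e4 h1 h2 ⊢
  rw [sl, div_eq_div_iff]
  · norm_cast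
    linear_combination (-1 : ℤ) * e5 + (rho n (a (G n i)) 1 0 * (uv a k).1 +
      rho n (a (G n i)) 1 1 * (uv a k).2) * e4
  · norm_cast; omega
  · norm_cast; omega

theorem sl_lt_of_lt {a : MulAut (FreeGroup (ZMod n))} (ha : a ∈ A n) {i k k' : ℤ}
    (h : i ≤ k) (h1 : k < k') (h' : k' < i + n) : sl n (a (D n i k')) < sl n (a (D n i k)) := by
  rw [sl_D ha h (by omega), sl_D ha (by omega) h', div_lt_div_iff₀
    (by exact_mod_cast area_cv_uv_pos ha (by omega) h')
    (by exact_mod_cast area_cv_uv_pos ha h (by omega))]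
  have e1 : ∀ k, area (cv a i) (uv a k) = (act (rho n (a (G n i))) (uv a k)).2 := fun k => by
    rw [← area_act (rho n (a (G n i))), cv, act_act_inv]; simp [area]
  have h2 := (posSeq_refine ha).pos (2 * k + 1) (2 * k' + 1) (by omega) (by omega)
  rw [refine_odd, refine_odd, ← area_act (rho n (a (G n i)))] at h2
  change 0 < area (act _ (uv a k)) (act _ (uv a k')) at h2
  rw [area, ← e1, ← e1] at h2
  norm_cast
  linarith

theorem Z_eq_D (k : ℤ) : Z n k = D n (k + 1) (k + n) := by
  have := D_add_right (n := n) (k + 1) k 1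
  rw [mul_one] at this
  rw [this, D_succ_self]

theorem sl_Z_strictMono {a : MulAut (FreeGroup (ZMod n))} (ha : a ∈ A n) :
    StrictMono fun k => sl n (a (Z n k)) := by
  apply strictMono_int_of_lt_succ
  intro k
  rw [Z_eq_D]
  exact sl_lt_of_lt ha (by omega) (by have := two_le (n := n); omega) (by omega)

theorem sl_D_le {a : MulAut (FreeGroup (ZMod n))} (ha : a ∈ A n) (i k : ℤ) :
    sl n (a (D n i k)) ≤ sl n (a (Z n i)) := by
  obtain ⟨k, t, h0, h1, rfl⟩ := exists_window (n := n) k i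
  rw [D_add_right]
  rcases h0.lt_or_eq with h | rfl
  · exact (sl_lt_of_lt ha le_rfl h h1).le
  · rfl

theorem lt_sl_D {a : MulAut (FreeGroup (ZMod n))} (ha : a ∈ A n) {i k : ℤ}
    (h : i ≤ k) (h' : k < i + n - 1) : sl n (a (Z n (i - 1))) < sl n (a (D n i k)) := by
  rw [Z_eq_D, sub_add_cancel]
  exact sl_lt_of_lt ha h (by omega) (by omega)

theorem exists_normal_D (i k : ℤ) : ∃ i' k' : ℤ, i' ≤ k' ∧ k' < i' + n - 1 ∧
    D n i k = D n i' k' := by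
  have h2 := two_le (n := n)
  obtain ⟨k, t, h0, h1, rfl⟩ := exists_window (n := n) k i
  rw [D_add_right]
  by_cases h : k < i + n - 1
  · exact ⟨i, k, h0, h, rfl⟩
  · refine ⟨i - 1, i - 1, le_rfl, by omega, ?_⟩
    have := Z_eq_D (n := n) (i - 1)
    rw [sub_add_cancel] at this
    rw [show k = i - 1 + n by omega, ← this, Z]

theorem le_sl_D {a : MulAut (FreeGroup (ZMod n))} (ha : a ∈ A n) (i k : ℤ) :
    sl n (a (Z n (i - 1))) ≤ sl n (a (D n i k)) := by
  obtain ⟨k, t, h0, h1, rfl⟩ := exists_window (n := n) k i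
  rw [D_add_right]
  by_cases h : k < i + n - 1
  · exact (lt_sl_D ha h0 h).le
  · have := Z_eq_D (n := n) (i - 1)
    rw [sub_add_cancel] at this
    rw [show k = i - 1 + n by omega, this]

theorem sl_D_lt_of_lex {a : MulAut (FreeGroup (ZMod n))} (ha : a ∈ A n) {i k i' k' : ℤ}
    (h1 : k < i + n - 1) (h2 : i' ≤ k') (h3 : k' < i' + n - 1)
    (h : i < i' ∨ (i = i' ∧ k' < k)) : sl n (a (D n i k)) < sl n (a (D n i' k')) := by
  rcases h with h | ⟨rfl, h⟩
  · exact ((sl_D_le ha i k).trans ((sl_Z_strictMono ha).monotone (by omega))).trans_lt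
      (lt_sl_D ha h2 h3)
  · exact sl_lt_of_lt ha h2 h (by omega)

theorem sl_D_trichotomy (i k i' k' : ℤ) : D n i k = D n i' k' ∨
    (∀ a ∈ A n, sl n (a (D n i k)) < sl n (a (D n i' k'))) ∨
      ∀ a ∈ A n, sl n (a (D n i' k')) < sl n (a (D n i k)) := by
  obtain ⟨i, k, h1, h2, e⟩ := exists_normal_D (n := n) i k
  obtain ⟨i', k', h3, h4, e'⟩ := exists_normal_D (n := n) i' k'
  rw [e, e']
  rcases lt_trichotomy i i' with h | rfl | h
  · exact Or.inr (Or.inl fun a ha => sl_D_lt_of_lex ha h2 h3 h4 (Or.inl h))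
  · rcases lt_trichotomy k k' with h | rfl | h
    · exact Or.inr (Or.inr fun a ha => sl_D_lt_of_lex ha h4 h1 h2 (Or.inr ⟨rfl, h⟩))
    · exact Or.inl rfl
    · exact Or.inr (Or.inl fun a ha => sl_D_lt_of_lex ha h2 h3 h4 (Or.inr ⟨rfl, h⟩))
  · exact Or.inr (Or.inr fun a ha => sl_D_lt_of_lex ha h4 h1 h2 (Or.inl h))

/-- Crossing arcs have larger complexity than their resolution. -/
theorem N_crossing {a : MulAut (FreeGroup (ZMod n))} (ha : a ∈ A n) {i j k l : ℤ}
    (h1 : j < i) (h2 : i < l) (h3 : l ≤ k) (h4 : k < j + n) :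
    N n (a (D n i j)) * N n (a (D n l k)) < N n (a (D n i k)) * N n (a (D n l j)) := by
  have hs := posSeq_refine ha
  have a1 := hs.pos (2 * j + 1) (2 * i) (by omega) (by omega)
  have a2 := hs.pos (2 * l) (2 * k + 1) (by omega) (by omega)
  have a3 := hs.pos (2 * j + 1) (2 * k + 1) (by omega) (by omega)
  have a4 := hs.pos (2 * i) (2 * l) (by omega) (by omega)
  simp only [refine_even, refine_odd] at a1 a2 a3 a4
  change 0 < area (uv a j) _ at a1
  change 0 < area _ (uv a k) at a2
  change 0 < area (uv a j) (uv a k) at a3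
  have p := area_plucker (uv a j) (cv a l) (cv a i) (uv a k)
  have d1 := (posSeq_cv ha).pos k (k + 1) (by omega) (by omega)
  have d2 := (posSeq_cv ha).pos j (j + 1) (by omega) (by omega)
  zify
  refine lt_of_mul_lt_mul_left ?_ (mul_pos d1 d2).le
  have e1 := mul_N_D ha i j
  have e2 := mul_N_D ha l k
  have e3 := mul_N_D ha i k
  have e4 := mul_N_D ha l j
  rw [area_swap (cv a i) (uv a j), neg_sq] at e1
  rw [area_swap (cv a l) (uv a j), neg_sq] at e4
  have h5 : 0 < area (uv a j) (cv a i) * area (cv a l) (uv a k) := mul_pos a1 a2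
  have h6 : 0 < area (uv a j) (uv a k) * area (cv a i) (cv a l) := mul_pos a3 a4
  have h7 : (area (uv a j) (cv a i) * area (cv a l) (uv a k)) ^ 2 <
      (area (uv a j) (cv a l) * area (cv a i) (uv a k)) ^ 2 := by
    rw [p]; nlinarith
  calc _ = (area (uv a j) (cv a i) * area (cv a l) (uv a k)) ^ 2 := by
        rw [mul_pow, ← e1, ← e2]; ring
    _ < _ := h7
    _ = _ := by rw [mul_pow, ← e4, ← e3]; ring

end Slope

theorem exists_mem_le {α : Type*} (f : α → ℕ) (s : Set α) (hs : s.Nonempty) :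
    ∃ x ∈ s, ∀ {y}, y ∈ s → f x ≤ f y := by
  obtain ⟨x, hx, h⟩ := (measure f).wf.has_min s hs
  exact ⟨x, hx, fun hy => not_lt.mp (h _ hy)⟩

section Minimal

variable {n : ℕ} [hn : Fact (2 ≤ n)]

/-- Peripheral elements. -/
def Per (p : FreeGroup (ZMod n)) : Prop := ∃ c : ZMod n, IsConj (of c) p

theorem Per.map {a : MulAut (FreeGroup (ZMod n))} (ha : a ∈ A n) {p : FreeGroup (ZMod n)}
    (hp : Per p) : Per (a p) := by
  obtain ⟨c, hc⟩ := hp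
  exact ⟨_, ((A_perm ha).choose_spec c).trans (apply_isConj a hc)⟩

theorem per_D (i k : ℤ) : Per (D n i k) := ⟨_, D_conj i k⟩

theorem per_Z (k : ℤ) : Per (Z n k) := per_D k k

theorem A_isConj_iff (a : MulAut (FreeGroup (ZMod n))) {p q : FreeGroup (ZMod n)} :
    IsConj (a p) (a q) ↔ IsConj p q :=
  ⟨fun h => by simpa using apply_isConj a⁻¹ h, apply_isConj a⟩

variable (n) in
/-- Conjugation by the boundary element. -/
def cD : MulAut (FreeGroup (ZMod n)) := MulAut.conj (Del n)

theorem cD_zpow_apply (t : ℤ) (p : FreeGroup (ZMod n)) :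
    (cD n ^ t) p = Del n ^ t * p * (Del n ^ t)⁻¹ := by
  rw [cD, ← map_zpow, MulAut.conj_apply]

theorem cD_mem : cD n ∈ A n := by
  rw [cD, ← delta_pow_n]; exact pow_mem delta_mem n

theorem cD_zpow_D (t i k : ℤ) : (cD n ^ t) (D n i k) = D n (i + n * t) k := by
  rw [cD_zpow_apply, D_add_left]

theorem cD_zpow_Z (t k : ℤ) : (cD n ^ t) (Z n k) = Z n (k + n * t) := by
  rw [cD_zpow_apply, Z_add]

theorem isConj_cD (t : ℤ) (p : FreeGroup (ZMod n)) : IsConj p ((cD n ^ t) p) := by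
  rw [cD_zpow_apply]; exact isConj_iff.mpr ⟨_, rfl⟩

theorem commute_cD {a : MulAut (FreeGroup (ZMod n))} (ha : a ∈ A n) : Commute a (cD n) := by
  ext p
  simp [cD, A_Del ha]

theorem apply_cD {a : MulAut (FreeGroup (ZMod n))} (ha : a ∈ A n) (t : ℤ)
    (p : FreeGroup (ZMod n)) : a ((cD n ^ t) p) = (cD n ^ t) (a p) := by
  rw [← MulAut.mul_apply, ((commute_cD ha).zpow_right t).eq, MulAut.mul_apply]

/-- The total complexity along an orbit. -/
def Lam (β : MulAut (FreeGroup (ZMod n))) (m : ℕ) (p : FreeGroup (ZMod n)) : ℕ :=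
  ∏ j ∈ Finset.range m, N n ((β ^ j) p)

/-- The elements of minimal complexity in their conjugacy class. -/
def CM (β : MulAut (FreeGroup (ZMod n))) (m : ℕ) (p : FreeGroup (ZMod n)) : Prop :=
  ∀ q, IsConj p q → Lam β m p ≤ Lam β m q

variable {β : MulAut (FreeGroup (ZMod n))} {m : ℕ} {K : ℤ}

theorem Lam_pos (hβ : β ∈ A n) {p : FreeGroup (ZMod n)} (hp : Per p) : 0 < Lam β m p :=
  Finset.prod_pos fun j _ => N_pos (hp.map (pow_mem hβ j)).choose_spec

theorem Lam_cD (hβ : β ∈ A n) (t : ℤ) (p : FreeGroup (ZMod n)) :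
    Lam β m ((cD n ^ t) p) = Lam β m p :=
  Finset.prod_congr rfl fun j _ => by
    rw [apply_cD (pow_mem hβ j), cD_zpow_apply, N_Del_conj]

theorem Lam_apply (hK : β ^ m = cD n ^ K) (p : FreeGroup (ZMod n)) :
    Lam β m (β p) = Lam β m p := by
  cases m with
  | zero => rfl
  | succ m =>
    rw [Lam, Lam, Finset.prod_range_succ, Finset.prod_range_succ' _ m]
    congr 1
    · rw [← MulAut.mul_apply, ← pow_succ, hK, cD_zpow_apply, N_Del_conj]; simp

theorem CM.of_isConj {p q : FreeGroup (ZMod n)} (hp : CM β m p) (h : IsConj p q)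
    (e : Lam β m q = Lam β m p) : CM β m q := fun r hr => e ▸ hp r (h.trans hr)

theorem Lam_lt (hβ : β ∈ A n) (hm : 0 < m) {a : MulAut (FreeGroup (ZMod n))} (ha : a ∈ A n)
    {p q r s : FreeGroup (ZMod n)} (hp : Per p) (hq : Per q)
    (h : ∀ a ∈ A n, N n (a p) * N n (a q) < N n (a r) * N n (a s)) :
    Lam β m (a p) * Lam β m (a q) < Lam β m (a r) * Lam β m (a s) := by
  simp only [Lam, ← Finset.prod_mul_distrib]
  refine Finset.prod_lt_prod_of_nonempty (fun j _ => ?_) (fun j _ => ?_)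
    (Finset.nonempty_range_iff.mpr hm.ne')
  · exact Nat.mul_pos (N_pos ((hp.map ha).map (pow_mem hβ j)).choose_spec)
      (N_pos ((hq.map ha).map (pow_mem hβ j)).choose_spec)
  · exact h (β ^ j * a) (mul_mem (pow_mem hβ j) ha)

/-- A frame together with a choice of representatives of the peripheral classes in it. -/
structure Sel (b : MulAut (FreeGroup (ZMod n))) (R : ZMod n → FreeGroup (ZMod n)) : Prop where
  mem : b ∈ A n
  conj : ∀ c, IsConj (of c) (R c)
  eq : ∀ c, ∃ k, R c = b (Z n k)

theorem exists_sel : ∃ (b : MulAut (FreeGroup (ZMod n))) (R : ZMod n → FreeGroup (ZMod n)),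
    Sel b R := by
  refine ⟨1, fun c => Z n c.val, one_mem _, fun c => ?_, fun c => ⟨_, rfl⟩⟩
  have := Z_conj (n := n) c.val
  simpa using this

theorem Sel.update {b : MulAut (FreeGroup (ZMod n))} {R : ZMod n → FreeGroup (ZMod n)}
    (h : Sel b R) {c : ZMod n} {i k : ℤ} (hc : IsConj (of c) (b (D n i k))) :
    ∃ b', Sel b' (Function.update R c (b (D n i k))) := by
  obtain ⟨s, hs, ⟨l, hl⟩, h2⟩ := exists_replace (n := n) i k
  refine ⟨b * s, mul_mem h.mem hs, fun d => ?_, fun d => ?_⟩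
  · rcases eq_or_ne d c with rfl | hd
    · rwa [Function.update_self]
    · rw [Function.update_of_ne hd]; exact h.conj d
  · rcases eq_or_ne d c with rfl | hd
    · exact ⟨l, by rw [Function.update_self, MulAut.mul_apply, hl]⟩
    · rw [Function.update_of_ne hd]
      obtain ⟨k', hk'⟩ := h.eq d
      obtain ⟨l', hl'⟩ := h2 k' fun hkk => hd (by
        refine isConj_of_iff.mp ((h.conj d).trans ?_)
        rw [hk']
        refine (IsConj.trans ?_ hc.symm)
        rw [A_isConj_iff]
        exact ((Z_conj k').symm.trans (hkk ▸ D_conj i k)))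
      exact ⟨l', by rw [MulAut.mul_apply, hl', hk']⟩

theorem Sel.cm_Z (hβ : β ∈ A n) {b : MulAut (FreeGroup (ZMod n))}
    {R : ZMod n → FreeGroup (ZMod n)} (h : Sel b R) (hR : ∀ c, CM β m (R c)) (k : ℤ) :
    CM β m (b (Z n k)) := by
  obtain ⟨c, hc⟩ := (per_Z (n := n) k).map h.mem
  obtain ⟨l, hl⟩ := h.eq c
  have h1 : IsConj (Z n l) (Z n k) := by
    rw [← A_isConj_iff b, ← hl]; exact (h.conj c).symm.trans hc
  obtain ⟨t, rfl⟩ := intCast_eq_iff.mp (isConj_Z_iff.mp h1)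
  refine (hR c).of_isConj ((h.conj c).symm.trans hc) ?_
  rw [← cD_zpow_Z, apply_cD h.mem, Lam_cD hβ, hl]

theorem exists_cm_frame (hβ : β ∈ A n) (hm : 0 < m) :
    ∃ (b : MulAut (FreeGroup (ZMod n))) (R : ZMod n → FreeGroup (ZMod n)),
      Sel b R ∧ ∀ c, CM β m (R c) := by
  classical
  let W : (MulAut (FreeGroup (ZMod n)) × (ZMod n → FreeGroup (ZMod n))) → ℕ :=
    fun x => ∏ c, Lam β m (x.2 c)
  let S : Set (MulAut (FreeGroup (ZMod n)) × (ZMod n → FreeGroup (ZMod n))) :=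
    {x | Sel x.1 x.2}
  have hS : S.Nonempty := let ⟨b, R, h⟩ := exists_sel (n := n); ⟨(b, R), h⟩
  obtain ⟨⟨b, R⟩, h, hmin⟩ := exists_mem_le W S hS
  replace h : Sel b R := h
  have key : ∀ i k, Lam β m (b (Z n k)) ≤ Lam β m (b (D n i k)) := by
    intro i k
    by_contra! hlt
    obtain ⟨c, hc⟩ := (per_D (n := n) i k).map h.mem
    obtain ⟨b', hb'⟩ := Sel.update h hc
    refine absurd (hmin (y := (b', Function.update R c (b (D n i k)))) hb') (not_le.mpr ?_)
    have e : Lam β m (R c) = Lam β m (b (Z n k)) := by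
      obtain ⟨l, hl⟩ := h.eq c
      have h1 : IsConj (Z n l) (Z n k) := by
        rw [← A_isConj_iff b, ← hl]
        refine ((h.conj c).symm.trans hc).trans ?_
        rw [A_isConj_iff]
        exact (D_conj i k).symm.trans (Z_conj k)
      obtain ⟨t, rfl⟩ := intCast_eq_iff.mp (isConj_Z_iff.mp h1)
      rw [← cD_zpow_Z, apply_cD h.mem, Lam_cD hβ, hl]
    change ∏ d, Lam β m (Function.update R c (b (D n i k)) d) < ∏ d, Lam β m (R d)
    refine Finset.prod_lt_prod (fun d _ => Lam_pos hβ ⟨d, hb'.conj d⟩) (fun d _ => ?_)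
      ⟨c, Finset.mem_univ _, ?_⟩
    · rcases eq_or_ne d c with rfl | hd
      · rw [Function.update_self, e]; exact hlt.le
      · rw [Function.update_of_ne hd]
    · rw [Function.update_self, e]; exact hlt
  refine ⟨b, R, h, fun c q hq => ?_⟩
  obtain ⟨q0, h0, h1⟩ : ∃ q0, IsConj (R c) q0 ∧ ∀ q, IsConj (R c) q → Lam β m q0 ≤ Lam β m q := by
    obtain ⟨q0, h0, h1⟩ := exists_mem_le (Lam β m)
      {q | IsConj (R c) q} ⟨R c, IsConj.refl _⟩
    exact ⟨q0, h0, fun q hq => h1 hq⟩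
  refine le_trans ?_ (h1 q hq)
  obtain ⟨k0, hk0⟩ := h.eq c
  rw [hk0] at h0 ⊢
  have h2 : IsConj (Z n k0) (b⁻¹ q0) := by
    rw [← A_isConj_iff b]; simpa using h0
  rcases D_or_exists_lt ((Z_conj k0).trans h2) with ⟨i, k, hk, e⟩ | ⟨i, k, q', hq', hlt⟩
  · have e' : q0 = b (D n i k) := by rw [← e]; simp
    obtain ⟨t, rfl⟩ := intCast_eq_iff.mp hk
    have := key i k
    rwa [← cD_zpow_Z, apply_cD h.mem, Lam_cD hβ, e']
  · exfalso
    have h3 := Lam_lt (β := β) hβ hm h.mem (per_D i k) ⟨_, hq'⟩ hlt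
    have h4 : b (b⁻¹ q0) = q0 := by simp
    rw [h4] at h3
    have h5 := h1 (b q') (by
      rw [hk0, A_isConj_iff]; exact (Z_conj k0).symm.trans hq')
    have := Nat.mul_le_mul (key i k) h5
    rw [mul_comm (Lam β m q0)] at h3
    omega

theorem cm_eq_D (hβ : β ∈ A n) (hm : 0 < m) {b : MulAut (FreeGroup (ZMod n))}
    (hb : b ∈ A n) (hZ : ∀ k, CM β m (b (Z n k))) {p : FreeGroup (ZMod n)} (hp : Per p)
    (hcm : CM β m p) : ∃ i k, p = b (D n i k) := by
  obtain ⟨c, hc⟩ := hp.map (inv_mem hb)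
  have h4 : b (b⁻¹ p) = p := by simp
  rcases D_or_exists_lt hc with ⟨i, k, hk, e⟩ | ⟨i, k, q', hq', hlt⟩
  · exact ⟨i, k, by rw [← e, h4]⟩
  · exfalso
    have h3 := Lam_lt (β := β) hβ hm hb (per_D i k) ⟨_, hq'⟩ hlt
    rw [h4] at h3
    have h5 := hcm (b q') (by
      rw [← h4, A_isConj_iff]; exact hc.symm.trans hq')
    have h6 := hZ k (b (D n i k)) (by
      rw [A_isConj_iff]; exact (Z_conj k).symm.trans (D_conj i k))
    have := Nat.mul_le_mul h6 h5
    rw [mul_comm (Lam β m p)] at h3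
    omega

theorem exists_sel_eq (hβ : β ∈ A n) (hm : 0 < m) {P : ZMod n → FreeGroup (ZMod n)}
    (hP : ∀ c, IsConj (of c) (P c)) (hcm : ∀ c, CM β m (P c)) : ∃ b, Sel b P := by
  classical
  suffices ∀ T : Finset (ZMod n), ∃ b R, Sel b R ∧ (∀ c, CM β m (R c)) ∧ ∀ c ∈ T, R c = P c by
    obtain ⟨b, R, h, -, h2⟩ := this Finset.univ
    exact ⟨b, by rwa [show P = R from funext fun c => (h2 c (Finset.mem_univ c)).symm]⟩
  intro T
  induction T using Finset.induction_on with
  | empty =>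
    obtain ⟨b, R, h, h2⟩ := exists_cm_frame hβ hm
    exact ⟨b, R, h, h2, by simp⟩
  | insert c T hc ih =>
    obtain ⟨b, R, h, h2, h3⟩ := ih
    obtain ⟨i, k, e⟩ := cm_eq_D hβ hm h.mem (h.cm_Z hβ h2) ⟨c, hP c⟩ (hcm c)
    obtain ⟨b', hb'⟩ := h.update (e ▸ hP c)
    rw [← e] at hb'
    refine ⟨b', _, hb', fun d => ?_, fun d hd => ?_⟩
    · rcases eq_or_ne d c with rfl | hd
      · rw [Function.update_self]; exact hcm d
      · rw [Function.update_of_ne hd]; exact h2 d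
    · rcases eq_or_ne d c with rfl | hd'
      · rw [Function.update_self]
      · rw [Function.update_of_ne hd']; exact h3 d (Finset.mem_of_mem_insert_of_ne hd hd')

end Minimal

section Order

variable {n : ℕ} [hn : Fact (2 ≤ n)] {β : MulAut (FreeGroup (ZMod n))} {m : ℕ} {K : ℤ}

/-- Minimal peripheral elements. -/
def PC (β : MulAut (FreeGroup (ZMod n))) (m : ℕ) (p : FreeGroup (ZMod n)) : Prop :=
  Per p ∧ CM β m p

theorem exists_frame (hβ : β ∈ A n) (hm : 0 < m) :
    ∃ b ∈ A n, (∀ k, PC β m (b (Z n k))) ∧ ∀ p, PC β m p → ∃ i k, p = b (D n i k) := by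
  obtain ⟨b, R, h, h2⟩ := exists_cm_frame hβ hm
  exact ⟨b, h.mem, fun k => ⟨(per_Z k).map h.mem, h.cm_Z hβ h2 k⟩,
    fun p hp => cm_eq_D hβ hm h.mem (h.cm_Z hβ h2) hp.1 hp.2⟩

theorem PC.trichotomy (hβ : β ∈ A n) (hm : 0 < m) {p q : FreeGroup (ZMod n)} (hp : PC β m p)
    (hq : PC β m q) : p = q ∨ (∀ a ∈ A n, sl n (a p) < sl n (a q)) ∨
      ∀ a ∈ A n, sl n (a q) < sl n (a p) := by
  obtain ⟨b, hb, -, h⟩ := exists_frame hβ hm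
  obtain ⟨i, k, rfl⟩ := h p hp
  obtain ⟨i', k', rfl⟩ := h q hq
  rcases sl_D_trichotomy (n := n) i k i' k' with h1 | h1 | h1
  · exact Or.inl (by rw [h1])
  · exact Or.inr (Or.inl fun a ha => h1 (a * b) (mul_mem ha hb))
  · exact Or.inr (Or.inr fun a ha => h1 (a * b) (mul_mem ha hb))

theorem PC.lt_of_lt (hβ : β ∈ A n) (hm : 0 < m) {p q : FreeGroup (ZMod n)} (hp : PC β m p)
    (hq : PC β m q) (h : sl n p < sl n q) {a : MulAut (FreeGroup (ZMod n))} (ha : a ∈ A n) :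
    sl n (a p) < sl n (a q) := by
  rcases hp.trichotomy hβ hm hq with rfl | h1 | h1
  · exact absurd h (lt_irrefl _)
  · exact h1 a ha
  · exact absurd (h1 1 (one_mem _)) (not_lt.mpr h.le)

theorem PC.eq_of_eq (hβ : β ∈ A n) (hm : 0 < m) {p q : FreeGroup (ZMod n)} (hp : PC β m p)
    (hq : PC β m q) (h : sl n p = sl n q) : p = q := by
  rcases hp.trichotomy hβ hm hq with h1 | h1 | h1
  · exact h1
  · exact absurd (h1 1 (one_mem _)) (by simp [h])
  · exact absurd (h1 1 (one_mem _)) (by simp [h])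

theorem PC.cD_lt (hβ : β ∈ A n) (hm : 0 < m) {p q : FreeGroup (ZMod n)} (hp : PC β m p)
    (hq : PC β m q) : ∃ t0 : ℤ, (∀ t, t0 ≤ t → sl n q < sl n ((cD n ^ t) p)) := by
  obtain ⟨b, hb, -, h⟩ := exists_frame hβ hm
  obtain ⟨i, k, rfl⟩ := h p hp
  obtain ⟨l, j, rfl⟩ := h q hq
  have h2 := two_le (n := n)
  refine ⟨max 0 (l - i + 2), fun t ht => ?_⟩
  have h3 : 0 ≤ t := (le_max_left _ _).trans ht
  have h4 : l - i + 2 ≤ t := (le_max_right _ _).trans ht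
  rw [← apply_cD hb, cD_zpow_D]
  exact ((sl_D_le hb l j).trans_lt ((sl_Z_strictMono hb) (by nlinarith))).trans_le
    (le_sl_D hb (i + n * t) k)

theorem PC.lt_cD (hβ : β ∈ A n) (hm : 0 < m) {p : FreeGroup (ZMod n)} (hp : PC β m p) {t : ℤ}
    (ht : 0 < t) : sl n p < sl n ((cD n ^ t) p) := by
  obtain ⟨b, hb, -, h⟩ := exists_frame hβ hm
  obtain ⟨i, k, rfl⟩ := h p hp
  have h2 := two_le (n := n)
  rw [← apply_cD hb, cD_zpow_D]
  exact ((sl_D_le hb i k).trans_lt ((sl_Z_strictMono hb) (by nlinarith))).trans_le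
    (le_sl_D hb (i + n * t) k)

end Order

/-- A strictly monotone unbounded sequence brackets every value. -/
theorem exists_floor {f : ℤ → ℚ} (hf : StrictMono f) {y : ℚ} (h1 : ∃ a, f a < y)
    (h2 : ∃ b, y < f b) : ∃ j, f j ≤ y ∧ y < f (j + 1) := by
  obtain ⟨a, ha⟩ := h1
  obtain ⟨b, hb⟩ := h2
  obtain ⟨j, hj, hmax⟩ := Int.exists_greatest_of_bdd (P := fun j => f j ≤ y)
    ⟨b, fun z hz => (hf.lt_iff_lt.mp (hz.trans_lt hb)).le⟩ ⟨a, ha.le⟩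
  exact ⟨j, hj, not_le.mp fun h => by have := hmax _ h; omega⟩

theorem pow_apply_of_fixed {F : Type*} [Group F] {g : MulAut F} {p : F} (h : g p = p) (k : ℕ) :
    (g ^ k) p = p := by
  induction k with
  | zero => simp
  | succ k ih => rw [pow_succ, MulAut.mul_apply, h, ih]

section Symmetry

variable {n : ℕ} [hn : Fact (2 ≤ n)] {β : MulAut (FreeGroup (ZMod n))} {m : ℕ} {K : ℤ}

/-- The group generated by `β` and conjugation by the boundary element. -/
def Sym (β g : MulAut (FreeGroup (ZMod n))) : Prop := ∃ a b : ℤ, g = β ^ a * cD n ^ b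

theorem Sym.mem (hβ : β ∈ A n) {g : MulAut (FreeGroup (ZMod n))} (h : Sym β g) : g ∈ A n := by
  obtain ⟨a, b, rfl⟩ := h
  exact mul_mem (zpow_mem hβ a) (zpow_mem cD_mem b)

theorem Sym.mul (hβ : β ∈ A n) {g h : MulAut (FreeGroup (ZMod n))} (hg : Sym β g)
    (hh : Sym β h) : Sym β (g * h) := by
  obtain ⟨a, b, rfl⟩ := hg
  obtain ⟨a', b', rfl⟩ := hh
  refine ⟨a + a', b + b', ?_⟩
  rw [zpow_add, zpow_add, mul_assoc, mul_assoc,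
    ← mul_assoc (cD n ^ b), ← ((commute_cD hβ).zpow_zpow a' b).eq, mul_assoc]

theorem Sym.inv (hβ : β ∈ A n) {g : MulAut (FreeGroup (ZMod n))} (hg : Sym β g) :
    Sym β g⁻¹ := by
  obtain ⟨a, b, rfl⟩ := hg
  refine ⟨-a, -b, ?_⟩
  rw [mul_inv_rev, zpow_neg, zpow_neg, ((commute_cD hβ).zpow_zpow a b).inv_inv.eq]

theorem sym_cD (t : ℤ) : Sym β (cD n ^ t) := ⟨0, t, by simp⟩

theorem sym_zpow (a : ℤ) : Sym β (β ^ a) := ⟨a, 0, by simp⟩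

theorem Sym.pow (hβ : β ∈ A n) (hK : β ^ m = cD n ^ K) {g : MulAut (FreeGroup (ZMod n))}
    (hg : Sym β g) : ∃ L : ℤ, g ^ m = cD n ^ L := by
  obtain ⟨a, b, rfl⟩ := hg
  refine ⟨K * a + b * m, ?_⟩
  rw [((commute_cD hβ).zpow_zpow a b).mul_pow, zpow_add, zpow_mul, zpow_mul, ← hK,
    ← zpow_natCast, ← zpow_natCast, ← zpow_natCast, ← zpow_mul, ← zpow_mul, ← zpow_mul,
    mul_comm a]

theorem Lam_zpow (hK : β ^ m = cD n ^ K) (a : ℤ) (p : FreeGroup (ZMod n)) :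
    Lam β m ((β ^ a) p) = Lam β m p := by
  induction a with
  | zero => simp
  | succ a ih => rw [add_comm, zpow_one_add, MulAut.mul_apply, Lam_apply hK, ih]
  | pred a ih =>
    rw [← ih, ← Lam_apply hK, ← MulAut.mul_apply, ← zpow_one_add]; congr 3; ring

theorem Sym.Lam_eq (hβ : β ∈ A n) (hK : β ^ m = cD n ^ K) {g : MulAut (FreeGroup (ZMod n))}
    (hg : Sym β g) (p : FreeGroup (ZMod n)) : Lam β m (g p) = Lam β m p := by
  obtain ⟨a, b, rfl⟩ := hg
  rw [MulAut.mul_apply, Lam_zpow hK, Lam_cD hβ]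

theorem Sym.map_pc (hβ : β ∈ A n) (hK : β ^ m = cD n ^ K) {g : MulAut (FreeGroup (ZMod n))}
    (hg : Sym β g) {p : FreeGroup (ZMod n)} (hp : PC β m p) : PC β m (g p) := by
  refine ⟨hp.1.map (hg.mem hβ), fun q hq => ?_⟩
  rw [hg.Lam_eq hβ hK, ← (hg.inv hβ).Lam_eq hβ hK q]
  refine hp.2 _ ?_
  rw [← A_isConj_iff g]; simpa using hq

theorem PC.zpow_strictMono (hβ : β ∈ A n) (hm : 0 < m) (hK : β ^ m = cD n ^ K)
    {g : MulAut (FreeGroup (ZMod n))} (hg : Sym β g) {p : FreeGroup (ZMod n)} (hp : PC β m p)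
    (h : sl n p < sl n (g p)) : StrictMono fun j : ℤ => sl n ((g ^ j) p) := by
  apply strictMono_int_of_lt_succ
  intro j
  rw [zpow_add_one, MulAut.mul_apply]
  exact hp.lt_of_lt hβ hm (hg.map_pc hβ hK hp) h (zpow_mem (hg.mem hβ) j)

theorem PC.lt_pow (hβ : β ∈ A n) (hm : 0 < m) (hK : β ^ m = cD n ^ K)
    {g : MulAut (FreeGroup (ZMod n))} (hg : Sym β g) {p : FreeGroup (ZMod n)} (hp : PC β m p)
    (h : sl n p < sl n (g p)) : sl n p < sl n ((g ^ m) p) := by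
  have := hp.zpow_strictMono hβ hm hK hg h (show (0 : ℤ) < m by exact_mod_cast hm)
  simpa using this

theorem PC.exponent_pos (hβ : β ∈ A n) (hm : 0 < m) {L : ℤ} {p : FreeGroup (ZMod n)}
    (hp : PC β m p) (h : sl n p < sl n ((cD n ^ L) p)) : 0 < L := by
  by_contra! h0
  rcases h0.lt_or_eq with h0 | rfl
  · have h1 := hp.lt_cD hβ hm (t := -L) (by omega)
    have h2 : PC β m ((cD n ^ (-L)) p) := by
      refine ⟨hp.1.map (zpow_mem cD_mem _), hp.2.of_isConj (isConj_cD _ _) (Lam_cD hβ _ _)⟩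
    have h3 := hp.lt_of_lt hβ hm h2 h1 (zpow_mem cD_mem L)
    rw [← MulAut.mul_apply, ← zpow_add, add_neg_cancel, zpow_zero, MulAut.one_apply] at h3
    exact lt_asymm h h3
  · simp at h

theorem Sym.eq_one (hβ : β ∈ A n) (hm : 0 < m) (hK : β ^ m = cD n ^ K)
    {g : MulAut (FreeGroup (ZMod n))} (hg : Sym β g) {p : FreeGroup (ZMod n)} (hp : PC β m p)
    (h : g p = p) : g = 1 := by
  obtain ⟨L, hL⟩ := hg.pow hβ hK
  have hLp : (cD n ^ L) p = p := by
    rw [← hL]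
    exact pow_apply_of_fixed h m
  have hL0 : L = 0 := by
    rcases lt_trichotomy L 0 with h0 | h0 | h0
    · have h1 := hp.lt_cD hβ hm (t := -L) (by omega)
      rw [zpow_neg, ← hLp, ← MulAut.mul_apply] at h1
      simp [hLp] at h1
    · exact h0
    · have h1 := hp.lt_cD hβ hm h0
      rw [hLp] at h1
      exact absurd h1 (lt_irrefl _)
  rw [hL0, zpow_zero] at hL
  have fix : ∀ g, Sym β g → g ^ m = 1 → ∀ q, PC β m q → ¬ sl n q < sl n (g q) := by
    intro g hg hL q hq h1
    have := hq.lt_pow hβ hm hK hg h1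
    rw [hL] at this
    exact absurd this (lt_irrefl _)
  obtain ⟨b, hb, hZ, -⟩ := exists_frame hβ hm
  have : g * b = b := by
    apply aut_ext_Z
    intro k _
    rcases (hZ k).trichotomy hβ hm (hg.map_pc hβ hK (hZ k)) with h1 | h1 | h1
    · exact h1.symm
    · exact absurd (h1 1 (one_mem _)) (fix g hg hL _ (hZ k))
    · refine absurd (h1 g⁻¹ (inv_mem (hg.mem hβ))) ?_
      have := fix g⁻¹ (hg.inv hβ) (by rw [inv_pow, hL, inv_one]) _ (hZ k)
      simpa using this
  simpa using this

theorem not_crossing (hβ : β ∈ A n) (hm : 0 < m) (hK : β ^ m = cD n ^ K)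
    {g : MulAut (FreeGroup (ZMod n))} (hg : Sym β g) {p q : FreeGroup (ZMod n)} (hp : PC β m p)
    (hq : PC β m q) (hpq : ¬ IsConj p q) (hgp : IsConj p (g p)) (hgq : IsConj q (g q))
    (h1 : sl n p < sl n q) (h2 : sl n q < sl n (g p)) (h3 : sl n (g q) < sl n ((cD n ^ (1 : ℤ)) p)) :
    False := by
  classical
  obtain ⟨c, hc⟩ := hp.1
  obtain ⟨c', hc'⟩ := hq.1
  have hcc : c' ≠ c := by
    rintro rfl; exact hpq (hc.symm.trans hc')
  obtain ⟨b0, R, hR, hRcm⟩ := exists_cm_frame hβ hm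
  let P := Function.update (Function.update R c p) c' q
  have hPc' : P c' = q := Function.update_self ..
  have hPc : P c = p := by
    rw [show P c = Function.update R c p c from Function.update_of_ne hcc.symm ..,
      Function.update_self]
  have hPd : ∀ d, d ≠ c → d ≠ c' → P d = R d := fun d h1 h2 => by
    rw [show P d = Function.update R c p d from Function.update_of_ne h2 ..,
      Function.update_of_ne h1]
  have hP : ∀ d, IsConj (of d) (P d) ∧ CM β m (P d) := by
    intro d
    by_cases e1 : d = c'
    · subst e1; rw [hPc']; exact ⟨hc', hq.2⟩
    · by_cases e2 : d = c
      · subst e2; rw [hPc]; exact ⟨hc, hp.2⟩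
      · rw [hPd d e2 e1]; exact ⟨hR.conj d, hRcm d⟩
  obtain ⟨a, ha⟩ := exists_sel_eq hβ hm (fun d => (hP d).1) (fun d => (hP d).2)
  have hZ := ha.cm_Z hβ fun d => (hP d).2
  have h4 : sl n (g p) < sl n (g q) := hp.lt_of_lt hβ hm hq h1 (hg.mem hβ)
  have hgp' := hg.map_pc hβ hK hp
  have hgq' := hg.map_pc hβ hK hq
  obtain ⟨i, k', ep⟩ := cm_eq_D hβ hm ha.mem hZ hgp'.1 hgp'.2
  obtain ⟨l, j', eq⟩ := cm_eq_D hβ hm ha.mem hZ hgq'.1 hgq'.2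
  obtain ⟨k, hk⟩ := ha.eq c
  obtain ⟨j, hj⟩ := ha.eq c'
  rw [hPc] at hk
  rw [hPc'] at hj
  have conj_eq : ∀ {i k k' : ℤ}, IsConj (a (Z n k)) (a (D n i k')) → D n i k' = D n i k := by
    intro i k k' h
    rw [A_isConj_iff] at h
    have h5 := isConj_of_iff.mp (((Z_conj k).trans h).trans (D_conj i k').symm)
    obtain ⟨t, rfl⟩ := intCast_eq_iff.mp h5
    rw [D_add_right]
  rw [ep, hk] at hgp
  rw [eq, hj] at hgq
  rw [conj_eq hgp] at ep
  rw [conj_eq hgq] at eq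
  have mono := sl_Z_strictMono ha.mem
  rw [hk, ← apply_cD ha.mem, cD_zpow_Z, mul_one, eq] at h3
  rw [ep, eq] at h4
  rw [ep, hj] at h2
  rw [hj, hk] at h1
  have jk : k < j := mono.lt_iff_lt.mp h1
  have ji : j < i := mono.lt_iff_lt.mp (h2.trans_le (sl_D_le ha.mem i k))
  have lk : l - 1 < k + n := mono.lt_iff_lt.mp ((le_sl_D ha.mem l j).trans_lt h3)
  have il : i - 1 < l := mono.lt_iff_lt.mp
    (((le_sl_D ha.mem i k).trans_lt h4).trans_le (sl_D_le ha.mem l j))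
  have eD : ∀ i k : ℤ, D n i (k + n) = D n i k := fun i k => by
    have := D_add_right (n := n) i k 1
    rwa [mul_one] at this
  have il' : i < l := by
    rcases (show i ≤ l by omega).lt_or_eq with h | h
    · exact h
    · subst h
      have := sl_lt_of_lt ha.mem (i := i) (k := k + n) (k' := j + n) (by omega) (by omega) (by omega)
      rw [eD, eD] at this
      exact absurd h4 (lt_asymm this)
  have hX := Lam_lt hβ hm ha.mem (per_D i j) (per_D l (k + n)) (r := D n i (k + n)) (s := D n l j)
    fun a ha => N_crossing ha ji il' (by omega) (by omega)
  rw [eD, eD, ← ep, ← eq] at hX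
  have c1 := hgp'.2 (a (D n l k)) (by
    rw [ep, A_isConj_iff]; exact (D_conj i k).symm.trans (D_conj l k))
  have c2 := hgq'.2 (a (D n i j)) (by
    rw [eq, A_isConj_iff]; exact (D_conj l j).symm.trans (D_conj i j))
  have := Nat.mul_le_mul c1 c2
  rw [mul_comm (Lam β m (a (D n l k)))] at this
  omega

theorem exists_bracket (hβ : β ∈ A n) (hm : 0 < m) (hK : β ^ m = cD n ^ K)
    {g : MulAut (FreeGroup (ZMod n))} (hg : Sym β g) {p q : FreeGroup (ZMod n)} (hp : PC β m p)
    (hq : PC β m q) (h : sl n p < sl n (g p)) :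
    ∃ j : ℤ, sl n ((g ^ j) p) ≤ sl n q ∧ sl n q < sl n ((g ^ (j + 1)) p) := by
  obtain ⟨L, hL⟩ := hg.pow hβ hK
  have hL0 : 0 < L := hp.exponent_pos hβ hm (hL ▸ hp.lt_pow hβ hm hK hg h)
  have hpow : ∀ t : ℤ, g ^ (m * t) = cD n ^ (L * t) := fun t => by
    rw [zpow_mul, zpow_natCast, hL, zpow_mul]
  apply exists_floor (hp.zpow_strictMono hβ hm hK hg h)
  · obtain ⟨t0, ht0⟩ := hq.cD_lt hβ hm hp
    refine ⟨m * (-max 0 t0), ?_⟩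
    have h1 := ht0 (L * max 0 t0) (by nlinarith [le_max_left 0 t0, le_max_right 0 t0])
    have h2 := hp.lt_of_lt hβ hm ((sym_cD _).map_pc hβ hK hq) h1
      (zpow_mem cD_mem (L * (-max 0 t0)))
    rw [← MulAut.mul_apply, ← zpow_add, mul_neg, neg_add_cancel, zpow_zero, MulAut.one_apply] at h2
    rwa [hpow, mul_neg]
  · obtain ⟨t0, ht0⟩ := hp.cD_lt hβ hm hq
    refine ⟨m * max 0 t0, ?_⟩
    rw [hpow]
    exact ht0 _ (by nlinarith [le_max_left 0 t0, le_max_right 0 t0])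

/-- A symmetry preserving two peripheral classes is a boundary twist. -/
theorem Sym.eq_cD (hβ : β ∈ A n) (hm : 0 < m) (hK : β ^ m = cD n ^ K)
    {γ : MulAut (FreeGroup (ZMod n))} (hγ : Sym β γ) {p q : FreeGroup (ZMod n)} (hp : PC β m p)
    (hq : PC β m q) (hpq : ¬ IsConj p q) (hγp : IsConj p (γ p)) (hγq : IsConj q (γ q)) :
    ∃ t : ℤ, γ = cD n ^ t := by
  have hD1 : sl n p < sl n (cD n p) := by simpa using hp.lt_cD hβ hm one_pos
  have hc1 : Sym β (cD n) := by simpa using sym_cD (β := β) 1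
  obtain ⟨t, ht1, ht2⟩ := exists_bracket hβ hm hK hc1 hp (hγ.map_pc hβ hK hp) hD1
  obtain ⟨γ', hγ'⟩ : ∃ γ', γ' = cD n ^ (-t) * γ := ⟨_, rfl⟩
  have hs' : Sym β γ' := hγ' ▸ (sym_cD _).mul hβ hγ
  have conj' : ∀ r, IsConj r (γ r) → IsConj r (γ' r) := fun r hr => by
    rw [hγ', MulAut.mul_apply]; exact hr.trans (isConj_cD _ _)
  have lo : ¬ sl n (γ' p) < sl n p := fun h => by
    have := (hs'.map_pc hβ hK hp).lt_of_lt hβ hm hp h (zpow_mem cD_mem t)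
    rw [hγ', ← MulAut.mul_apply, zpow_neg, mul_inv_cancel_left] at this
    exact absurd this (not_lt.mpr ht1)
  have hi : sl n (γ' p) < sl n (cD n p) := by
    have := (hγ.map_pc hβ hK hp).lt_of_lt hβ hm ((sym_cD _).map_pc hβ hK hp) ht2 (zpow_mem cD_mem (-t))
    rwa [← MulAut.mul_apply, ← MulAut.mul_apply, ← zpow_add, neg_add_cancel_left, zpow_one,
      ← hγ'] at this
  have done : γ' = 1 → ∃ t : ℤ, γ = cD n ^ t := fun h => ⟨t, by
    rw [h] at hγ'; rw [eq_comm, zpow_neg, inv_mul_eq_one] at hγ'; exact hγ'.symm⟩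
  rcases hp.trichotomy hβ hm (hs'.map_pc hβ hK hp) with h | h | h
  · exact done (hs'.eq_one hβ hm hK hp h.symm)
  · replace h := h 1 (one_mem _)
    simp only [MulAut.one_apply] at h
    exfalso
    obtain ⟨g, hg, hgp, hgq, hlt, hle⟩ : ∃ g, Sym β g ∧ IsConj p (g p) ∧ IsConj q (g q) ∧
        sl n p < sl n (g p) ∧ sl n ((g * g) p) ≤ sl n (cD n p) := by
      by_cases hcase : sl n ((γ' * γ') p) ≤ sl n (cD n p)
      · exact ⟨γ', hs', conj' p hγp, conj' q hγq, h, hcase⟩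
      · push Not at hcase
        have conjinv : ∀ r, IsConj r (γ' r) → IsConj r ((cD n * γ'⁻¹) r) := fun r hr => by
          rw [MulAut.mul_apply]
          refine IsConj.trans ?_ (by simpa using isConj_cD (n := n) 1 (γ'⁻¹ r))
          rw [← A_isConj_iff γ']; simpa using hr.symm
        have comm : Commute (cD n) γ' := (commute_cD (hs'.mem hβ)).symm
        refine ⟨cD n * γ'⁻¹, hc1.mul hβ (hs'.inv hβ), conjinv p (conj' p hγp),
          conjinv q (conj' q hγq), ?_, ?_⟩
        · have := (hs'.map_pc hβ hK hp).lt_of_lt hβ hm (hc1.map_pc hβ hK hp) hi (inv_mem (hs'.mem hβ))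
          rw [comm.inv_right.eq]
          simpa using this
        · have := (hc1.map_pc hβ hK hp).lt_of_lt hβ hm ((hs'.mul hβ hs').map_pc hβ hK hp) hcase
            (mul_mem cD_mem (inv_mem ((hs'.mul hβ hs').mem hβ)))
          rw [← MulAut.mul_apply, ← MulAut.mul_apply, inv_mul_cancel_right] at this
          refine le_of_eq_of_le ?_ this.le
          congr 2
          simp only [mul_inv_rev, mul_assoc]
          rw [comm.inv_right.eq]
    obtain ⟨j, hj1, hj2⟩ := exists_bracket hβ hm hK hg hp hq hlt
    have hgA := hg.mem hβ
    have conjpow : ∀ {r}, IsConj r (g r) → ∀ j : ℤ, IsConj r ((g ^ j) r) := by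
      intro r hr j
      induction j with
      | zero => exact IsConj.refl _
      | succ j ih =>
        rw [zpow_add_one, MulAut.mul_apply]
        exact ih.trans ((A_isConj_iff _).mpr hr)
      | pred j ih =>
        rw [← A_isConj_iff g, ← MulAut.mul_apply, ← zpow_one_add, add_sub_cancel]
        exact hr.symm.trans ih
    have symj : ∀ j : ℤ, Sym β (g ^ j) := by
      intro j
      obtain ⟨a, b, rfl⟩ := hg
      exact ⟨a * j, b * j, by rw [((commute_cD hβ).zpow_zpow a b).mul_zpow, zpow_mul, zpow_mul]⟩
    have hq' := (symj (-j)).map_pc hβ hK hq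
    have hqq' : IsConj q ((g ^ (-j)) q) := conjpow hgq (-j)
    have hpq' : ¬ IsConj p ((g ^ (-j)) q) := fun h => hpq (h.trans hqq'.symm)
    have l1 : sl n p < sl n ((g ^ (-j)) q) := by
      rcases hj1.lt_or_eq with h | h
      · have := ((symj j).map_pc hβ hK hp).lt_of_lt hβ hm hq h (zpow_mem hgA (-j))
        simpa using this
      · exact absurd ((conjpow hgp j).trans
          (((symj j).map_pc hβ hK hp).eq_of_eq hβ hm hq h ▸ IsConj.refl _)) hpq
    have l2 : sl n ((g ^ (-j)) q) < sl n (g p) := by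
      have := hq.lt_of_lt hβ hm ((symj (j + 1)).map_pc hβ hK hp) hj2 (zpow_mem hgA (-j))
      rwa [← MulAut.mul_apply, ← zpow_add, neg_add_cancel_left, zpow_one] at this
    have l3 : sl n (g ((g ^ (-j)) q)) < sl n ((cD n ^ (1 : ℤ)) p) := by
      rw [zpow_one]
      exact (hq'.lt_of_lt hβ hm (hg.map_pc hβ hK hp) l2 hgA).trans_le hle
    exact not_crossing hβ hm hK hg hp hq' hpq' hgp (by
      rw [← MulAut.mul_apply, (Commute.refl g).zpow_right (-j) |>.eq, MulAut.mul_apply,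
        A_isConj_iff]
      exact hgq) l1 l2 l3
  · exact absurd (h 1 (one_mem _)) lo

end Symmetry

/-- A strictly monotone map of `ℤ` commuting with a translation is a translation. -/
theorem exists_shift {θ : ℤ → ℤ} (hθ : StrictMono θ) {N : ℤ} (hN : 0 < N)
    (h : ∀ k, θ (k + N) = θ k + N) : ∃ r, ∀ k, θ k = k + r := by
  have h1 : Monotone fun k => θ k - k := monotone_int_of_le_succ fun k => by
    have := hθ (show k < k + 1 by omega); omega
  have h2 : ∀ (t : ℕ) k, θ (k + N * t) = θ k + N * t := by
    intro t
    induction t with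
    | zero => simp
    | succ t ih => intro k; push_cast; rw [mul_add, mul_one, ← add_assoc, h, ih]; ring
  have h3 : ∀ k l, θ k - k ≤ θ l - l := by
    intro k l
    obtain ⟨t, ht⟩ : ∃ t : ℕ, k ≤ l + N * t := ⟨(k - l).toNat, by
      have := Int.self_le_toNat (k - l); nlinarith⟩
    have := h1 ht
    simp only at this
    rw [h2] at this
    omega
  exact ⟨θ 0, fun k => by have := h3 k 0; have := h3 0 k; omega⟩

section Final

variable {n : ℕ} [hn : Fact (2 ≤ n)] {β : MulAut (FreeGroup (ZMod n))} {m : ℕ} {K : ℤ}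

theorem exists_shift_frame (hβ : β ∈ A n) (hm : 0 < m)
    {a : MulAut (FreeGroup (ZMod n))} (ha : a ∈ A n) {f : ℤ → FreeGroup (ZMod n)} {N : ℤ}
    (hN : 0 < N) (hf : ∀ k, f (k + N) = cD n (f k))
    (mono : StrictMono fun k => sl n (a (f k))) (hpc : ∀ k, PC β m (a (f k)))
    (hex : ∀ k, ∃ k', β (a (f k)) = a (f k')) : ∃ r, ∀ k, β (a (f k)) = a (f (k + r)) := by
  choose θ hθ using hex
  have cDa : ∀ p, a (cD n p) = cD n (a p) := fun p => by
    simpa using apply_cD ha 1 p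
  have cDβ : ∀ p, β (cD n p) = cD n (β p) := fun p => by
    simpa using apply_cD hβ 1 p
  obtain ⟨r, hr⟩ := exists_shift (θ := θ) (fun k l hkl => by
      have := (hpc k).lt_of_lt hβ hm (hpc l) (mono hkl) hβ
      rw [hθ, hθ] at this
      exact mono.lt_iff_lt.mp this) hN (fun k => by
      refine mono.injective (congrArg (sl n) ?_)
      rw [← hθ, hf, hf, cDa, cDβ, hθ, cDa])
  exact ⟨r, fun k => by rw [hθ, hr]⟩

theorem exists_Q_eq {k : ℤ} (hk : (k : ZMod n) ≠ ((n - 1 : ℤ) : ZMod n)) : ∃ j, Z n k = Q n j := by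
  have h2 := two_le (n := n)
  obtain ⟨l, t, h0, h1, rfl⟩ := exists_window (n := n) k 0
  have hl : l ≠ n - 1 := by rintro rfl; exact hk (by push_cast; simp)
  refine ⟨l + (n - 1) * t, ?_⟩
  lift l to ℕ using h0
  rw [Q_add, Q_window (by omega), Z_add]

theorem exists_window_Q (j : ℤ) : ((j + j / (n - 1) : ℤ) : ZMod n) ≠ ((n - 1 : ℤ) : ZMod n) := by
  have h2 := two_le (n := n)
  intro h
  obtain ⟨t, ht⟩ := intCast_eq_iff.mp h
  have e := Int.emod_add_mul_ediv j (n - 1)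
  have h0 := Int.emod_nonneg j (b := n - 1) (by omega)
  have h1 := Int.emod_lt_of_pos j (b := n - 1) (by omega)
  generalize j % (n - 1 : ℤ) = u at *
  generalize j / (n - 1 : ℤ) = v at *
  subst e
  have : u - (n - 1 : ℤ) = -(n : ℤ) * (v + t) := by linarith
  have h3 : v + t = 0 ∨ 1 ≤ v + t ∨ v + t ≤ -1 := by omega
  rcases h3 with h3 | h3 | h3
  · rw [h3] at this; omega
  · nlinarith
  · nlinarith

theorem perm_zpow {π : Equiv.Perm (ZMod n)} (hπ : ∀ c, IsConj (of (π c)) (β (of c))) (j : ℤ) :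
    ∀ c, IsConj (of ((π ^ j) c)) ((β ^ j) (of c)) := by
  induction j with
  | zero => intro c; exact IsConj.refl _
  | succ j ih =>
    intro c
    rw [zpow_add_one, zpow_add_one, Equiv.Perm.mul_apply, MulAut.mul_apply]
    exact (ih _).trans ((A_isConj_iff _).mpr (hπ c))
  | pred j ih =>
    intro c
    rw [zpow_sub_one, zpow_sub_one, Equiv.Perm.mul_apply, MulAut.mul_apply]
    refine (ih _).trans ((A_isConj_iff _).mpr ?_)
    rw [← A_isConj_iff β]
    have := hπ (π⁻¹ c)
    simpa using this.symm

theorem exists_equivariant (hβ : β ∈ A n) (hm : 0 < m) (hK : β ^ m = cD n ^ K)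
    {π : Equiv.Perm (ZMod n)} (hπ : ∀ c, IsConj (of (π c)) (β (of c)))
    (hper : ∀ c, π c ≠ c → ∀ s : ℤ, (π ^ s) c = c → (m : ℤ) ∣ s) :
    ∃ (a : MulAut (FreeGroup (ZMod n))) (P : ZMod n → FreeGroup (ZMod n)), Sel a P ∧
      (∀ c, CM β m (P c)) ∧ ∀ c, π c ≠ c → ∃ t : ℤ, β (P c) = (cD n ^ t) (P (π c)) := by
  obtain ⟨b, R, hR, hcm⟩ := exists_cm_frame hβ hm
  let rep : ZMod n → ZMod n := fun c =>
    (Quotient.mk (Equiv.Perm.SameCycle.setoid π) c).out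
  have hrep : ∀ c, ∃ j : ℤ, (π ^ j) (rep c) = c := fun c =>
    Quotient.mk_out (s := Equiv.Perm.SameCycle.setoid π) c
  have hrepπ : ∀ c, rep (π c) = rep c := fun c => by
    have : (Quotient.mk (Equiv.Perm.SameCycle.setoid π) (π c)) =
        Quotient.mk (Equiv.Perm.SameCycle.setoid π) c :=
      Quotient.sound (s := Equiv.Perm.SameCycle.setoid π) ⟨-1, by simp⟩
    simp only [rep, this]
  choose j hj using hrep
  let P : ZMod n → FreeGroup (ZMod n) := fun c => (β ^ j c) (R (rep c))
  have hPc : ∀ c, IsConj (of c) (P c) := fun c => by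
    have := perm_zpow hπ (j c) (rep c)
    rw [hj] at this
    exact this.trans ((A_isConj_iff _).mpr (hR.conj _))
  have hPcm : ∀ c, CM β m (P c) := fun c =>
    ((sym_zpow (j c)).map_pc hβ hK (p := R (rep c)) ⟨⟨_, hR.conj _⟩, hcm _⟩).2
  obtain ⟨a, ha⟩ := exists_sel_eq hβ hm hPc hPcm
  refine ⟨a, P, ha, hPcm, fun c hc => ?_⟩
  have hr : π (rep c) ≠ rep c := fun h => hc (by
    have h' : (π ^ j c) (rep c) = rep c :=
      Function.IsFixedPt.perm_zpow h (j c)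
    rw [hj] at h'
    rw [← h'] at h
    exact h)
  have h1 := hj (π c)
  rw [hrepπ] at h1
  obtain ⟨u, hu⟩ := hper _ hr (-j (π c) + (1 + j c)) (by
    rw [zpow_add, zpow_one_add, Equiv.Perm.mul_apply, Equiv.Perm.mul_apply, hj]
    nth_rewrite 2 [← h1]
    rw [← Equiv.Perm.mul_apply, ← zpow_add, neg_add_cancel, zpow_zero, Equiv.Perm.one_apply])
  refine ⟨K * u, ?_⟩
  have h2 : 1 + j c = j (π c) + m * u := by omega
  simp only [P]
  rw [hrepπ, ← MulAut.mul_apply, ← zpow_one_add, h2, ← MulAut.mul_apply, zpow_add, zpow_mul,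
    zpow_natCast, hK, ← zpow_mul, ((commute_cD hβ).zpow_zpow _ _).eq]

/-- A periodic braid automorphism is conjugate to a power of one of the two rotations. -/
theorem exists_conj_rotation (hβ : β ∈ A n) (hm : 0 < m) (hK : β ^ m = cD n ^ K) :
    ∃ a ∈ A n, ∃ r : ℤ, β * a = a * delta n ^ r ∨ β * a = a * eps n ^ r := by
  classical
  have h2n := two_le (n := n)
  have hex : ∃ m : ℕ, 0 < m ∧ ∃ K : ℤ, β ^ m = cD n ^ K := ⟨m, hm, K, hK⟩
  obtain ⟨m, ⟨hm, K, hK⟩, hmin⟩ : ∃ m : ℕ, (0 < m ∧ ∃ K : ℤ, β ^ m = cD n ^ K) ∧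
      ∀ l : ℕ, 0 < l → l < m → ∀ t : ℤ, β ^ l ≠ cD n ^ t :=
    ⟨Nat.find hex, Nat.find_spec hex, fun l h0 h1 t e => Nat.find_min hex h1 ⟨h0, t, e⟩⟩
  rcases (show m = 1 ∨ 1 < m by omega) with rfl | hm1
  · refine ⟨1, one_mem _, n * K, Or.inl ?_⟩
    rw [mul_one, one_mul, zpow_mul, zpow_natCast, delta_pow_n, ← cD, ← hK, pow_one]
  obtain ⟨π, hπ⟩ := A_perm hβ
  obtain ⟨b, R, hR, hcm⟩ := exists_cm_frame hβ hm
  have huniq : ∀ l : ℕ, 0 < l → l < m → ∀ c c', (π ^ l) c = c → (π ^ l) c' = c' → c = c' := by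
    intro l h0 h1 c c' hc hc'
    by_contra hne
    have fixR : ∀ c, (π ^ l) c = c → IsConj (R c) ((β ^ (l : ℤ)) (R c)) := fun c hc => by
      have := perm_zpow hπ l c
      rw [zpow_natCast, hc] at this
      exact ((hR.conj c).symm.trans this).trans ((A_isConj_iff _).mpr (hR.conj c))
    obtain ⟨t, ht⟩ := (sym_zpow (β := β) l).eq_cD hβ hm hK ⟨⟨_, hR.conj c⟩, hcm c⟩
      ⟨⟨_, hR.conj c'⟩, hcm c'⟩
      (fun h => hne (isConj_of_iff.mp (((hR.conj c).trans h).trans (hR.conj c').symm)))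
      (fixR c hc) (fixR c' hc')
    exact hmin l h0 h1 t (by rw [← ht, zpow_natCast])
  have hπm : ∀ c, (π ^ (m : ℤ)) c = c := fun c => by
    have := perm_zpow hπ m c
    rw [zpow_natCast β, hK] at this
    exact isConj_of_iff.mp (this.trans (isConj_cD K (of c)).symm)
  have hper : ∀ c, π c ≠ c → ∀ s : ℤ, (π ^ s) c = c → (m : ℤ) ∣ s := by
    intro c hc s hs
    have hm0 : (0 : ℤ) < m := by exact_mod_cast hm
    have h0 := Int.emod_nonneg s hm0.ne'
    have h1 := Int.emod_lt_of_pos s hm0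
    have hl : (π ^ (s % m)) c = c := by
      rw [Int.emod_def, zpow_sub, Equiv.Perm.mul_apply, zpow_mul, Equiv.Perm.inv_eq_iff_eq.mpr, hs]
      exact (Function.IsFixedPt.perm_zpow (hπm c) _).symm
    by_contra hnd
    have h3 : s % m ≠ 0 := fun h => hnd (Int.dvd_of_emod_eq_zero h)
    lift s % (m : ℤ) to ℕ using h0 with l
    refine hc ((huniq l (by omega) (by omega) c (π c) (by simpa using hl) ?_).symm)
    rw [← Equiv.Perm.mul_apply, ← pow_succ, pow_succ', Equiv.Perm.mul_apply]
    congr 1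
  obtain ⟨a, P, ha, hPcm, hP⟩ := exists_equivariant hβ hm hK hπ hper
  have hpc : ∀ k, PC β m (a (Z n k)) := fun k => ⟨(per_Z k).map ha.mem, ha.cm_Z hβ hPcm k⟩
  have hZP : ∀ {c k}, IsConj (of c) (a (Z n k)) → ∃ t : ℤ, a (Z n k) = (cD n ^ t) (P c) := by
    intro c k h
    obtain ⟨l, hl⟩ := ha.eq c
    have h1 : IsConj (Z n l) (Z n k) := by
      rw [← A_isConj_iff a, ← hl]; exact (ha.conj c).symm.trans h
    obtain ⟨t, rfl⟩ := intCast_eq_iff.mp (isConj_Z_iff.mp h1)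
    exact ⟨t, by rw [hl, ← apply_cD ha.mem, cD_zpow_Z]⟩
  have hstep : ∀ {c k}, π c ≠ c → IsConj (of c) (a (Z n k)) →
      ∃ k', β (a (Z n k)) = a (Z n k') ∧ IsConj (of (π c)) (a (Z n k')) := by
    intro c k hc h
    obtain ⟨t, ht⟩ := hZP h
    obtain ⟨t', ht'⟩ := hP c hc
    obtain ⟨l, hl⟩ := ha.eq (π c)
    refine ⟨l + n * t' + n * t, ?_, ?_⟩
    · rw [ht, apply_cD hβ, ht', hl, ← apply_cD ha.mem, ← apply_cD ha.mem, cD_zpow_Z, cD_zpow_Z]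
    · rw [add_assoc, ← mul_add, ← cD_zpow_Z, apply_cD ha.mem, ← hl]
      exact (ha.conj _).trans (isConj_cD _ _)
  have hcD1 : ∀ k, Z n (k + n) = cD n (Z n k) := fun k => by
    have := cD_zpow_Z (n := n) 1 k; simpa using this.symm
  by_cases hfix : ∃ c, π c = c
  · obtain ⟨c₀, hc₀⟩ := hfix
    obtain ⟨k₀, hk₀⟩ := ha.eq c₀
    have hnf : ∀ c, c ≠ c₀ → π c ≠ c := fun c hc h =>
      hc (huniq 1 one_pos hm1 c c₀ (by simpa using h) (by simpa using hc₀))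
    let a' := a * delta n ^ (k₀ - (n - 1))
    have ha' : a' ∈ A n := mul_mem ha.mem (zpow_mem delta_mem _)
    have ea' : ∀ k, a' (Z n k) = a (Z n (k + (k₀ - (n - 1)))) := fun k => by
      rw [MulAut.mul_apply, delta_zpow_Z]
    obtain ⟨r, hr⟩ := exists_shift_frame hβ hm ha' (f := Q n) (N := n - 1) (by omega)
      (fun k => by
        have := Q_add (n := n) k 1
        rw [mul_one, zpow_one] at this
        rw [this]; rfl)
      (fun j j' hjj => sl_Z_strictMono ha' (by
        have := Int.ediv_le_ediv (c := (n : ℤ) - 1) (by omega) hjj.le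
        omega))
      (fun k => by rw [Q, ea']; exact hpc _)
      (fun j => by
        obtain ⟨c, hc⟩ := (per_Z (n := n) (j + j / (n - 1))).map ha'
        have key : ∀ {c k}, IsConj (of c) (a' (Z n k)) →
            ((k : ZMod n) = ((n - 1 : ℤ) : ZMod n) ↔ c = c₀) := by
          intro c k h
          have h1 : IsConj (of c₀) (a' (Z n (n - 1))) := by
            rw [ea', add_sub_cancel, ← hk₀]; exact ha.conj _
          rw [← isConj_Z_iff, ← A_isConj_iff a', ← isConj_of_iff]
          exact ⟨fun h2 => (h.trans h2).trans h1.symm, fun h2 => (h.symm.trans h2).trans h1⟩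
        have hcc : c ≠ c₀ := fun h => exists_window_Q (n := n) j ((key hc).mpr h)
        have hc' := hc
        rw [ea'] at hc'
        obtain ⟨k', e1, e2⟩ := hstep (hnf c hcc) hc'
        have e3 : a (Z n k') = a' (Z n (k' - (k₀ - (n - 1)))) := by rw [ea', sub_add_cancel]
        rw [e3] at e1 e2
        obtain ⟨j', hj'⟩ := exists_Q_eq (n := n) (fun h => hcc (π.injective
          (((key e2).mp h).trans hc₀.symm)))
        exact ⟨j', by rw [Q, ea', e1, hj']⟩)
    refine ⟨a', ha', r, Or.inr (aut_ext_Q (mul_mem hβ ha')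
      (mul_mem ha' (zpow_mem eps_mem _)) fun j => ?_)⟩
    exact (hr j).trans (congrArg a' (eps_zpow_Q r j).symm)
  · push Not at hfix
    obtain ⟨r, hr⟩ := exists_shift_frame hβ hm ha.mem (f := Z n) (N := n) (by omega)
      hcD1 (sl_Z_strictMono ha.mem) hpc (fun k => by
        obtain ⟨c, hc⟩ := (per_Z (n := n) k).map ha.mem
        obtain ⟨k', h, -⟩ := hstep (hfix c) hc
        exact ⟨k', h⟩)
    refine ⟨a, ha.mem, r, Or.inl (aut_ext_Z fun k _ => ?_)⟩
    rw [MulAut.mul_apply, hr, MulAut.mul_apply, delta_zpow_Z]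

end Final

section TraceLemma

variable {R : Type*} [Ring R] {V : Type*} [AddCommGroup V] {S : Type*} [Fintype S]

theorem sum_pow_eq_sum_ofFn (x : S → R) (k : ℕ) :
    (∑ s, x s) ^ k = ∑ w : Fin k → S, (List.ofFn fun i => x (w i)).prod := by
  induction k with
  | zero => simp
  | succ k ih =>
    rw [pow_succ', ih, Finset.sum_mul_sum, ← (Fin.consEquiv fun _ => S).sum_comp,
      Fintype.sum_prod_type]
    simp [Fin.consEquiv, List.ofFn_succ]

theorem trace_prod_rotate (τ : R →+ V) (hτ : ∀ a b, τ (a * b) = τ (b * a)) {k : ℕ}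
    (y : Fin (k + 1) → R) :
    τ (List.ofFn fun i => y (i + 1)).prod = τ (List.ofFn y).prod := by
  rw [List.ofFn_succ', List.ofFn_succ (f := y), List.concat_eq_append, List.prod_append,
    List.prod_cons, hτ]
  simp [Fin.coeSucc_eq_succ, Fin.last_add_one]

/-- In characteristic `p`, a trace sees the `p`-th power as additive. -/
theorem trace_sum_pow (τ : R →+ V) (hτ : ∀ a b, τ (a * b) = τ (b * a)) {p : ℕ} [hp : Fact p.Prime]
    (hV : ∀ v : V, p • v = 0) (x : S → R) : τ ((∑ s, x s) ^ p) = ∑ s, τ (x s ^ p) := by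
  classical
  obtain ⟨k, rfl⟩ : ∃ k, p = k + 1 := ⟨p - 1, by have := hp.out.pos; omega⟩
  set P : (Fin (k + 1) → S) → V := fun w => τ (List.ofFn fun i => x (w i)).prod with hP
  let rot : (Fin (k + 1) → S) → Fin (k + 1) → S := fun w i => w (i + 1)
  have hProt : ∀ w, P (rot w) = P w := fun w => trace_prod_rotate τ hτ fun i => x (w i)
  have hiter : ∀ (j : ℕ) w i, (rot^[j]) w i = w (i + Fin.ofNat (k + 1) j) := by
    intro j
    induction j with
    | zero => intro w i; simp
    | succ j ih =>
      intro w i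
      rw [Function.iterate_succ_apply, ih]
      change w _ = w _
      congr 1
      rw [add_assoc]
      congr 1
      ext
      simp [Fin.val_add]
  have hpow : rot^[k + 1] = id := by
    ext w i
    rw [hiter]
    simp
  have hfix : ∀ w, rot w = w ↔ ∃ s, (fun _ => s) = w := by
    intro w
    constructor
    · intro h
      refine ⟨w 0, funext fun i => ?_⟩
      induction i using Fin.induction with
      | zero => rfl
      | succ i ih =>
        rw [ih, ← Fin.coeSucc_eq_succ]
        exact (congrFun h _).symm
    · rintro ⟨s, rfl⟩
      rfl
  have hs : τ ((∑ s, x s) ^ (k + 1)) = ∑ w, P w := by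
    rw [sum_pow_eq_sum_ofFn, map_sum]
  have hzero : ∑ w with rot w ≠ w, P w = 0 := by
    rw [← Finset.sum_fiberwise_of_maps_to (g := P) (t := Finset.univ.image P)
      (fun w _ => Finset.mem_image_of_mem _ (Finset.mem_univ w))]
    refine Finset.sum_eq_zero fun v _ => ?_
    rw [Finset.sum_congr rfl (g := fun _ => v) (fun w hw => (Finset.mem_filter.mp hw).2),
      Finset.sum_const]
    set T := (Finset.univ.filter (fun w => rot w ≠ w)).filter (fun w => P w = v) with hT
    have hinj : Function.Injective rot := by
      refine Function.Injective.of_comp (f := rot^[k]) ?_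
      rw [← Function.iterate_succ, hpow]
      exact Function.injective_id
    have hmaps : ∀ w ∈ T, rot w ∈ T := by
      intro w hw
      simp only [hT, Finset.mem_filter, Finset.mem_univ, true_and] at hw ⊢
      exact ⟨fun h => hw.1 (hinj h), by rw [hProt, hw.2]⟩
    let f : Function.End T := fun w => ⟨rot w, hmaps _ w.2⟩
    have hfj : ∀ (j : ℕ) (w : T), ((f ^ j) w : Fin (k + 1) → S) = rot^[j] w := by
      intro j
      induction j with
      | zero => intro w; rfl
      | succ j ih =>
        intro w
        rw [pow_succ', Function.iterate_succ_apply', ← ih]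
        rfl
    have hf : f ^ (k + 1) ^ 1 = 1 := by
      rw [pow_one]
      funext w
      refine Subtype.ext ?_
      rw [hfj, hpow]
      rfl
    have hcard := Equiv.Perm.card_fixedPoints_modEq hf
    have hempty : IsEmpty f.fixedPoints := by
      refine ⟨fun w => ?_⟩
      have h1 : f w.1 = w.1 := w.2
      exact (Finset.mem_filter.mp (Finset.mem_filter.mp w.1.2).1).2 (congrArg Subtype.val h1)
    rw [Fintype.card_coe, Fintype.card_eq_zero (α := f.fixedPoints)] at hcard
    obtain ⟨c, hc⟩ := (Nat.modEq_zero_iff_dvd).mp hcard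
    rw [hc, mul_nsmul, hV, nsmul_zero]
  rw [hs, ← Finset.sum_filter_add_sum_filter_not _ (fun w => rot w = w), hzero, add_zero]
  have himg : Finset.univ.filter (fun w => rot w = w)
      = Finset.univ.image fun (s : S) (_ : Fin (k + 1)) => s := by
    ext w
    simp [hfix]
  rw [himg, Finset.sum_image fun s _ t _ h => congrFun h 0]
  simp [hP, pow_succ']

end TraceLemma

section ClassTrace

variable {G : Type*} [Group G] (p : ℕ) [hp : Fact p.Prime]

/-- The `q`-th power map on conjugacy classes. -/
def powClass (q : ℕ) : ConjClasses G → ConjClasses G :=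
  Quotient.map (fun g => g ^ q) fun _ _ h => h.pow q

theorem powClass_mk (q : ℕ) (g : G) : powClass q (ConjClasses.mk g) = ConjClasses.mk (g ^ q) := rfl

theorem powClass_powClass (q r : ℕ) (C : ConjClasses G) :
    powClass q (powClass r C) = powClass (r * q) C := by
  obtain ⟨g, rfl⟩ := ConjClasses.mk_surjective C
  simp [powClass_mk, pow_mul]

/-- The universal trace of the group algebra, with values in the space on conjugacy classes. -/
noncomputable def cls : MonoidAlgebra (ZMod p) G →+ (ConjClasses G →₀ ZMod p) :=
  (Finsupp.mapDomain.addMonoidHom ConjClasses.mk).comp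
    (MonoidAlgebra.coeffAddEquiv : MonoidAlgebra (ZMod p) G ≃+ _).toAddMonoidHom

theorem cls_single (g : G) (r : ZMod p) :
    cls p (MonoidAlgebra.single g r) = Finsupp.single (ConjClasses.mk g) r := by
  change Finsupp.mapDomain ConjClasses.mk (MonoidAlgebra.single g r).coeff = _
  rw [MonoidAlgebra.coeff_single, Finsupp.mapDomain_single]

theorem cls_mul_comm (a b : MonoidAlgebra (ZMod p) G) : cls p (a * b) = cls p (b * a) := by
  induction a using MonoidAlgebra.induction_linear with
  | zero => simp
  | add x y hx hy => rw [add_mul, mul_add, map_add, map_add, hx, hy]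
  | single g r =>
    induction b using MonoidAlgebra.induction_linear with
    | zero => simp
    | add x y hx hy => rw [add_mul, mul_add, map_add, map_add, hx, hy]
    | single h s =>
      rw [MonoidAlgebra.single_mul_single, MonoidAlgebra.single_mul_single, cls_single, cls_single,
        mul_comm r s]
      congr 1
      rw [ConjClasses.mk_eq_mk_iff_isConj, isConj_iff]
      exact ⟨h, by group⟩

theorem nsmul_prime_eq_zero (v : ConjClasses G →₀ ZMod p) : p • v = 0 := by
  ext C
  simp

theorem cls_pow (a : MonoidAlgebra (ZMod p) G) :
    cls p (a ^ p) = (cls p a).mapDomain (powClass p) := by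
  have ha : a = ∑ g : a.coeff.support, MonoidAlgebra.single (g : G) (a.coeff g) := by
    conv_lhs => rw [← MonoidAlgebra.sum_coeff_single a]
    rw [Finsupp.sum, ← Finset.sum_coe_sort]
  have h1 := trace_sum_pow (cls p) (cls_mul_comm p) (nsmul_prime_eq_zero p)
    fun g : a.coeff.support => MonoidAlgebra.single (g : G) (a.coeff g)
  have h2 := congrArg (fun b => (cls p b).mapDomain (powClass p)) ha
  rw [← ha] at h1
  rw [h1]
  refine Eq.trans ?_ h2.symm
  rw [map_sum, ← Finsupp.mapDomain.addMonoidHom_apply, map_sum]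
  refine Finset.sum_congr rfl fun g _ => ?_
  rw [MonoidAlgebra.single_pow, cls_single, cls_single, ZMod.pow_card,
    Finsupp.mapDomain.addMonoidHom_apply, Finsupp.mapDomain_single, powClass_mk]

variable {ι : Type*} [Fintype ι] [DecidableEq ι]

/-- The universal trace on matrices over the group algebra. -/
noncomputable def matCls :
    Matrix ι ι (MonoidAlgebra (ZMod p) G) →+ (ConjClasses G →₀ ZMod p) :=
  (cls p).comp (Matrix.traceAddMonoidHom ι _)

theorem matCls_apply (Y : Matrix ι ι (MonoidAlgebra (ZMod p) G)) :
    matCls p Y = ∑ i, cls p (Y i i) := by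
  simp [matCls, Matrix.trace]

theorem matCls_mul_comm (Y X : Matrix ι ι (MonoidAlgebra (ZMod p) G)) :
    matCls p (Y * X) = matCls p (X * Y) := by
  simp only [matCls_apply, Matrix.mul_apply, map_sum]
  rw [Finset.sum_comm]
  exact Finset.sum_congr rfl fun i _ => Finset.sum_congr rfl fun j _ => cls_mul_comm p _ _

theorem single_diag_pow {R : Type*} [Ring R] (i : ι) (a : R) {k : ℕ} (hk : k ≠ 0) :
    (Matrix.single i i a) ^ k = Matrix.single i i (a ^ k) := by
  obtain ⟨k, rfl⟩ := Nat.exists_eq_succ_of_ne_zero hk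
  induction k with
  | zero => simp
  | succ k ih => rw [pow_succ, ih (by simp), Matrix.single_mul_single_same, ← pow_succ]

theorem single_off_diag_pow {R : Type*} [Ring R] {i j : ι} (hij : j ≠ i) (a : R) {k : ℕ}
    (hk : 2 ≤ k) : (Matrix.single i j a) ^ k = 0 := by
  obtain ⟨k, rfl⟩ := Nat.exists_eq_add_of_le' hk
  rw [pow_add, sq, Matrix.single_mul_single_of_ne _ _ _ _ hij, mul_zero]

theorem matCls_pow_prime (Y : Matrix ι ι (MonoidAlgebra (ZMod p) G)) :
    matCls p (Y ^ p) = (matCls p Y).mapDomain (powClass p) := by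
  have hY : Y = ∑ s : ι × ι, Matrix.single s.1 s.2 (Y s.1 s.2) := by
    rw [Fintype.sum_prod_type]
    exact Matrix.matrix_eq_sum_single Y
  have h1 := trace_sum_pow (matCls p) (matCls_mul_comm p) (nsmul_prime_eq_zero p)
    fun s : ι × ι => Matrix.single s.1 s.2 (Y s.1 s.2)
  rw [← hY, Fintype.sum_prod_type] at h1
  rw [h1, matCls_apply, ← Finsupp.mapDomain.addMonoidHom_apply, map_sum]
  refine Finset.sum_congr rfl fun i _ => ?_
  rw [Finset.sum_eq_single i]
  · rw [Finsupp.mapDomain.addMonoidHom_apply, ← cls_pow, single_diag_pow _ _ hp.out.ne_zero,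
      matCls_apply,      Finset.sum_eq_single i]
    · simp
    · intro j _ hj
      simp [hj.symm]
    · simp
  · intro j _ hj
    rw [single_off_diag_pow hj _ hp.out.two_le, map_zero]
  · simp

theorem matCls_pow (Y : Matrix ι ι (MonoidAlgebra (ZMod p) G)) (a : ℕ) :
    matCls p (Y ^ p ^ a) = (matCls p Y).mapDomain (powClass (p ^ a)) := by
  induction a with
  | zero =>
    have : (powClass 1 : ConjClasses G → ConjClasses G) = id := by
      ext C
      obtain ⟨g, rfl⟩ := ConjClasses.mk_surjective C
      simp [powClass_mk]
    simp [this]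
  | succ a ih =>
    rw [pow_succ, pow_mul, matCls_pow_prime, ih, ← Finsupp.mapDomain_comp]
    congr 1
    ext C
    exact powClass_powClass p (p ^ a) C

end ClassTrace

section Norm

theorem le_norm_pow {ι : Type*} [DecidableEq ι] {g : FreeGroup ι} (hg : g ≠ 1) (k : ℕ) :
    k ≤ (g ^ k).norm := by
  cases k with
  | zero => simp
  | succ k =>
    have h1 : (g ^ (k + 1)).toWord = FreeGroup.reduce (List.replicate (k + 1) g.toWord).flatten := by
      have : g ^ (k + 1) = FreeGroup.mk (List.replicate (k + 1) g.toWord).flatten := by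
        conv_lhs => rw [← FreeGroup.mk_toWord (x := g)]
        rw [FreeGroup.pow_mk]
      rw [this, FreeGroup.toWord_mk]
    rw [FreeGroup.norm, h1,
      FreeGroup.reduceCyclically.reduce_flatten_replicate_succ FreeGroup.isReduced_toWord]
    have h2 : FreeGroup.reduceCyclically g.toWord ≠ [] := by
      intro h
      have h3 := FreeGroup.reduceCyclically.conj_conjugator_reduceCyclically g.toWord
      rw [h] at h3
      apply hg
      rw [← FreeGroup.mk_toWord (x := g), ← h3]
      simp [← FreeGroup.mul_mk, ← FreeGroup.inv_mk]
    have h3 := List.length_pos_iff.mpr h2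
    simp only [List.length_append, List.length_flatten, List.map_replicate, List.sum_replicate,
      smul_eq_mul]
    nlinarith

end Norm

section Fox

variable {ι : Type*} [Fintype ι] [DecidableEq ι] (k : Type*) [CommRing k]

/-- The exponent sum of the generator `j`. -/
def expSum (j : ι) : FreeGroup ι →* Multiplicative ℤ :=
  lift fun i => Multiplicative.ofAdd (if i = j then 1 else 0)

theorem expSum_of (i j : ι) : (expSum j (of i)).toAdd = if i = j then 1 else 0 := by
  simp [expSum]

/-- The augmentation of a group algebra. -/
noncomputable def aug (H : Type*) [Group H] : MonoidAlgebra k H →+* k :=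
  (MonoidAlgebra.lift k k H (1 : H →* k)).toRingHom

theorem aug_single (H : Type*) [Group H] (h : H) (r : k) :
    aug k H (MonoidAlgebra.single h r) = r := by
  simp [aug]

/-- Fox derivatives. -/
theorem exists_fox (f : FreeGroup ι) : ∃ d : ι → MonoidAlgebra k (FreeGroup ι),
    MonoidAlgebra.of k _ f - 1 = ∑ j, d j * (MonoidAlgebra.of k _ (of j) - 1) ∧
    ∀ j, aug k _ (d j) = ((expSum j f).toAdd : k) := by
  have hof : ∀ f, aug k (FreeGroup ι) (MonoidAlgebra.of k _ f) = 1 := fun f => aug_single k _ _ _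
  induction f using FreeGroup.induction_on with
  | C1 => exact ⟨0, by simp [← MonoidAlgebra.one_def], by simp⟩
  | of i =>
    refine ⟨Pi.single i 1, ?_, fun j => ?_⟩
    · rw [Finset.sum_eq_single i]
      · simp
      · intro j _ hj
        simp [hj]
      · simp
    · rw [expSum_of]
      by_cases h : i = j
      · subst h
        simp
      · simp [h]
  | inv_of i _ =>
    refine ⟨Pi.single i (-MonoidAlgebra.of k _ (of i)⁻¹), ?_, fun j => ?_⟩
    · rw [Finset.sum_eq_single i]
      · rw [Pi.single_eq_same, neg_mul, mul_sub, ← map_mul, inv_mul_cancel, map_one, mul_one,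
          neg_sub]
      · intro j _ hj
        simp [hj]
      · simp
    · rw [map_inv (expSum j), toAdd_inv, expSum_of]
      by_cases h : i = j
      · subst h
        rw [Pi.single_eq_same, map_neg, hof]
        simp
      · simp [h]
  | mul f g hf hg =>
    obtain ⟨d, hd, hd'⟩ := hf
    obtain ⟨d₂, hd₂, hd₂'⟩ := hg
    refine ⟨fun j => d j + MonoidAlgebra.of k _ f * d₂ j, ?_, fun j => ?_⟩
    · simp only [add_mul, Finset.sum_add_distrib, mul_assoc]
      rw [← Finset.mul_sum, ← hd, ← hd₂, map_mul, mul_sub, mul_one]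
      abel
    · rw [map_add, map_mul, hof, hd', hd₂', map_mul, toAdd_mul]
      push_cast
      ring

variable {G : Type*} [Group G] (c : FreeGroup ι →* G)

/-- The element `xⱼ - 1` of the group algebra. -/
noncomputable def foxGen (j : ι) : MonoidAlgebra k G := MonoidAlgebra.of k G (c (of j)) - 1

/-- The affine map `a ↦ xⱼ a + δᵢⱼ` of the group algebra. -/
noncomputable def foxAffine (i j : ι) : Equiv.Perm (MonoidAlgebra k G) where
  toFun a := MonoidAlgebra.of k G (c (of j)) * a + if i = j then 1 else 0
  invFun a := MonoidAlgebra.of k G (c (of j))⁻¹ * (a - if i = j then 1 else 0)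
  left_inv a := by
    dsimp only
    rw [add_sub_cancel_right, ← mul_assoc, ← map_mul, inv_mul_cancel, map_one, one_mul]
  right_inv a := by
    dsimp only
    rw [← mul_assoc, ← map_mul, mul_inv_cancel, map_one, one_mul, sub_add_cancel]

/-- The crossed homomorphism with `xⱼ ↦ δᵢⱼ`. -/
noncomputable def foxD (i : ι) (f : FreeGroup ι) : MonoidAlgebra k G :=
  lift (foxAffine k c i) f 0

theorem lift_foxAffine (i : ι) (f : FreeGroup ι) (a : MonoidAlgebra k G) :
    lift (foxAffine k c i) f a = MonoidAlgebra.of k G (c f) * a + foxD k c i f := by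
  induction f using FreeGroup.induction_on generalizing a with
  | C1 => simp [foxD, ← MonoidAlgebra.one_def]
  | of j => simp [foxD, foxAffine]
  | inv_of j _ =>
    simp only [foxD, map_inv, FreeGroup.lift_apply_of, Equiv.Perm.inv_def]
    simp [foxAffine, sub_eq_add_neg, mul_add]
  | mul f g hf hg =>
    rw [foxD, map_mul, Equiv.Perm.mul_apply, Equiv.Perm.mul_apply, hg a, hf, hg 0, hf (_ + _),
      map_mul, map_mul]
    noncomm_ring

theorem foxD_mul_of (i j : ι) (f : FreeGroup ι) :
    foxD k c i (f * of j) = foxD k c i f + MonoidAlgebra.of k G (c f) * if i = j then 1 else 0 := by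
  rw [foxD, map_mul, Equiv.Perm.mul_apply, lift_foxAffine, add_comm]
  simp [foxAffine]

theorem exists_derivation (hc : Function.Injective c) (i : ι) :
    ∃ D : MonoidAlgebra k G →+ MonoidAlgebra k G,
      ∀ y j, D (y * foxGen k c j) = if i = j then y else 0 := by
  have hdec : ∀ g : G, ∃ f : FreeGroup ι, g = ((g : G ⧸ c.range).out) * c f := by
    intro g
    obtain ⟨⟨_, f, rfl⟩, hf⟩ := QuotientGroup.mk_out_eq_mul c.range g
    exact ⟨f⁻¹, by rw [hf, map_inv]; simp⟩
  choose w hw using hdec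
  have hwx : ∀ g j, w (g * c (of j)) = w g * of j := by
    intro g j
    have h1 : ((g * c (of j) : G) : G ⧸ c.range) = (g : G ⧸ c.range) := by
      rw [QuotientGroup.eq]
      exact ⟨(of j)⁻¹, by simp⟩
    have h2 := hw (g * c (of j))
    rw [h1] at h2
    nth_rewrite 1 [hw g] at h2
    rw [mul_assoc, mul_left_cancel_iff, ← map_mul] at h2
    exact (hc h2).symm
  let D₀ : G → MonoidAlgebra k G := fun g =>
    MonoidAlgebra.of k G ((g : G ⧸ c.range).out) * foxD k c i (w g)
  have hD₀ : ∀ g j, D₀ (g * c (of j)) = D₀ g + MonoidAlgebra.of k G g * if i = j then 1 else 0 := by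
    intro g j
    have h1 : ((g * c (of j) : G) : G ⧸ c.range) = (g : G ⧸ c.range) := by
      rw [QuotientGroup.eq]
      exact ⟨(of j)⁻¹, by simp⟩
    simp only [D₀]
    rw [h1, hwx, foxD_mul_of, mul_add, ← mul_assoc, ← map_mul, ← hw]
  let D : MonoidAlgebra k G →+ MonoidAlgebra k G :=
    (Finsupp.liftAddHom fun g => (AddMonoidHom.mulRight (D₀ g)).comp
      (algebraMap k (MonoidAlgebra k G)).toAddMonoidHom).comp
      (MonoidAlgebra.coeffAddEquiv : MonoidAlgebra k G ≃+ _).toAddMonoidHom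
  have hD : ∀ g r, D (MonoidAlgebra.single g r) = r • D₀ g := by
    intro g r
    change Finsupp.liftAddHom _ (MonoidAlgebra.single g r).coeff = _
    rw [MonoidAlgebra.coeff_single, Finsupp.liftAddHom_apply_single]
    exact (Algebra.smul_def r (D₀ g)).symm
  refine ⟨D, fun y j => ?_⟩
  induction y using MonoidAlgebra.induction_linear with
  | zero => simp
  | add x y hx hy =>
    rw [add_mul, map_add, hx, hy]
    split_ifs <;> simp
  | single g r =>
    rw [foxGen, mul_sub, mul_one, map_sub, MonoidAlgebra.of_apply, MonoidAlgebra.single_mul_single,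
      mul_one, hD, hD, hD₀, smul_add, add_sub_cancel_left]
    split_ifs
    · simp [MonoidAlgebra.of_apply]
    · simp

theorem fox_ext (hc : Function.Injective c) {y z : ι → MonoidAlgebra k G}
    (h : ∑ j, y j * foxGen k c j = ∑ j, z j * foxGen k c j) : y = z := by
  ext1 i
  obtain ⟨D, hD⟩ := exists_derivation k c hc i
  have := congrArg D h
  simpa [map_sum, hD] using this

end Fox

section FiniteOrderLift

variable {ι : Type*} [Fintype ι] [DecidableEq ι] {G : Type*} [Group G] (c : FreeGroup ι →* G)
  (p : ℕ) [hp : Fact p.Prime] (u : G) (y : ι → FreeGroup ι)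

/-- The total mass of a function on conjugacy classes. -/
noncomputable def mass : (ConjClasses G →₀ ZMod p) →+ ZMod p :=
  Finsupp.liftAddHom fun _ => AddMonoidHom.id _

theorem mapDomainRingHom_single (f : FreeGroup ι) (r : ZMod p) :
    MonoidAlgebra.mapDomainRingHom (ZMod p) c (MonoidAlgebra.single f r) =
      MonoidAlgebra.single (c f) r := by
  simp

theorem mass_cls_mul_map (d : MonoidAlgebra (ZMod p) (FreeGroup ι)) :
    mass p (cls p (MonoidAlgebra.of _ G u * MonoidAlgebra.mapDomainRingHom _ c d)) =
      aug (ZMod p) _ d := by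
  induction d using MonoidAlgebra.induction_linear with
  | zero => simp
  | add x y hx hy => rw [map_add, mul_add, map_add, map_add, hx, hy, map_add]
  | single f r =>
    rw [aug_single, mapDomainRingHom_single, MonoidAlgebra.of_apply,
      MonoidAlgebra.single_mul_single, cls_single]
    simp [mass]

theorem exists_of_cls_mul_map_ne_zero (d : MonoidAlgebra (ZMod p) (FreeGroup ι)) (C : ConjClasses G)
    (hC : cls p (MonoidAlgebra.of _ G u * MonoidAlgebra.mapDomainRingHom _ c d) C ≠ 0) :
    ∃ f, C = ConjClasses.mk (u * c f) := by
  induction d using MonoidAlgebra.induction_linear with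
  | zero => simp at hC
  | add x y hx hy =>
    rw [map_add, mul_add, map_add, Finsupp.add_apply] at hC
    by_cases h : cls p (MonoidAlgebra.of _ G u * MonoidAlgebra.mapDomainRingHom _ c x) C = 0
    · rw [h, zero_add] at hC
      exact hy hC
    · exact hx h
  | single f r =>
    rw [mapDomainRingHom_single, MonoidAlgebra.of_apply,
      MonoidAlgebra.single_mul_single, cls_single] at hC
    refine ⟨f, ?_⟩
    by_contra h
    exact hC (Finsupp.single_eq_of_ne h)

variable {c u y}

/-- The Lefschetz class of a twisted automorphism is invariant under `q`-th powers. -/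
theorem exists_lefschetz (hc : Function.Injective c) (hy : ∀ i, c (of i) * u = u * c (y i)) :
    ∃ L : ConjClasses G →₀ ZMod p, mass p L = 1 - ∑ i, ((expSum i (y i)).toAdd : ZMod p) ∧
      (∀ C ∈ L.support, ∃ f, C = ConjClasses.mk (u * c f)) ∧
      ∀ a g, u ^ p ^ a = u * c g → L.mapDomain (powClass (p ^ a)) = L := by
  choose d hd hd' using fun f => exists_fox (ι := ι) (ZMod p) f
  let R := MonoidAlgebra.mapDomainRingHom (ZMod p) c
  have hR : ∀ f, R (MonoidAlgebra.of _ _ f) = MonoidAlgebra.of _ G (c f) := fun f => by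
    simp [R]
  have hfox : ∀ f, MonoidAlgebra.of _ G (c f) - 1 = ∑ j, R (d f j) * foxGen (ZMod p) c j := by
    intro f
    have := congrArg R (hd f)
    simp only [map_sub, map_one, map_sum, map_mul, hR] at this
    exact this
  let U := MonoidAlgebra.of (ZMod p) G u
  let Y : Matrix ι ι (MonoidAlgebra (ZMod p) G) := Matrix.of fun i j => U * R (d (y i) j)
  have hY : ∀ i, foxGen (ZMod p) c i * U = ∑ j, Y i j * foxGen (ZMod p) c j := by
    intro i
    have h1 : foxGen (ZMod p) c i * U = U * (MonoidAlgebra.of _ G (c (y i)) - 1) := by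
      rw [foxGen, sub_mul, one_mul, mul_sub, mul_one, ← map_mul, hy, map_mul]
    rw [h1, hfox, Finset.mul_sum]
    exact Finset.sum_congr rfl fun j _ => (mul_assoc _ _ _).symm
  have hYk : ∀ (k : ℕ) i, foxGen (ZMod p) c i * U ^ k = ∑ j, (Y ^ k) i j * foxGen (ZMod p) c j := by
    intro k
    induction k with
    | zero =>
      intro i
      rw [Finset.sum_eq_single i]
      · simp
      · intro j _ hj
        simp [Matrix.one_apply_ne hj.symm]
      · simp
    | succ k ih =>
      intro i
      rw [pow_succ, ← mul_assoc, ih, Finset.sum_mul]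
      simp only [mul_assoc, hY, Finset.mul_sum]
      rw [Finset.sum_comm]
      refine Finset.sum_congr rfl fun j _ => ?_
      rw [pow_succ, Matrix.mul_apply, Finset.sum_mul]
      simp only [mul_assoc]
  refine ⟨cls p U - matCls p Y, ?_, ?_, ?_⟩
  · have h1 : ∀ i, mass p (cls p (Y i i)) = ((expSum i (y i)).toAdd : ZMod p) := by
      intro i
      rw [← hd']
      exact mass_cls_mul_map c p u _
    have h2 : mass p (cls p U) = 1 := by
      have := mass_cls_mul_map c p u 1
      rwa [map_one, mul_one, map_one] at this
    rw [map_sub, h2, matCls_apply, map_sum]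
    simp only [h1]
  · intro C hC
    rw [Finsupp.mem_support_iff, Finsupp.sub_apply, matCls_apply, Finsupp.finsetSum_apply] at hC
    by_cases h : cls p U C = 0
    · rw [h, zero_sub, neg_ne_zero] at hC
      obtain ⟨i, -, hi⟩ := Finset.exists_ne_zero_of_sum_ne_zero hC
      exact exists_of_cls_mul_map_ne_zero c p u _ C hi
    · refine exists_of_cls_mul_map_ne_zero c p u 1 C ?_
      rwa [map_one, mul_one]
  · intro a g hg
    have hUq : U ^ p ^ a = U * MonoidAlgebra.of _ G (c g) := by
      rw [← map_pow, hg, map_mul]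
    have hdiff : ∀ i j, (Y ^ p ^ a) i j = Y i j + foxGen (ZMod p) c i * U * R (d g j) := by
      intro i
      refine congrFun (fox_ext (ZMod p) c hc ?_)
      rw [← hYk, hUq]
      simp only [add_mul, Finset.sum_add_distrib, mul_assoc]
      rw [← Finset.mul_sum, ← Finset.mul_sum, ← hfox, ← hY]
      noncomm_ring
    have h1 : matCls p (Y ^ p ^ a) = matCls p Y + (cls p (U ^ p ^ a) - cls p U) := by
      rw [matCls_apply, matCls_apply]
      simp only [hdiff, map_add, Finset.sum_add_distrib]
      congr 1
      have h2 : ∀ i, cls p (foxGen (ZMod p) c i * U * R (d g i))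
          = cls p (U * (R (d g i) * foxGen (ZMod p) c i)) := by
        intro i
        rw [mul_assoc, cls_mul_comm, mul_assoc]
      simp only [h2]
      rw [← map_sum, ← Finset.mul_sum, ← hfox, hUq, mul_sub, mul_one, map_sub]
    rw [← Finsupp.mapDomain.addMonoidHom_apply, map_sub, Finsupp.mapDomain.addMonoidHom_apply,
      Finsupp.mapDomain.addMonoidHom_apply, ← matCls_pow, h1]
    have h3 : (cls p U).mapDomain (powClass (p ^ a)) = cls p (U ^ p ^ a) := by
      simp only [U]
      rw [← map_pow, MonoidAlgebra.of_apply, MonoidAlgebra.of_apply, cls_single, cls_single,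
        Finsupp.mapDomain_single, powClass_mk]
    rw [h3]
    abel

theorem exists_finite_order_lift (hc : Function.Injective c) (hn : c.range.Normal)
    (hy : ∀ i, c (of i) * u = u * c (y i)) {m : ℕ} (hm : 0 < m) {h : FreeGroup ι}
    (hu : u ^ m = c h) (htr : ∑ i, (expSum i (y i)).toAdd ≠ 1) : ∃ f, (u * c f) ^ m = 1 := by
  classical
  set t : ℤ := 1 - ∑ i, (expSum i (y i)).toAdd with ht
  have ht0 : t ≠ 0 := fun h => htr (by omega)
  obtain ⟨p, hpm, hp⟩ := Nat.exists_infinite_primes (m + t.natAbs + 1)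
  have : Fact p.Prime := ⟨hp⟩
  have hcop : Nat.Coprime p m := by
    rw [hp.coprime_iff_not_dvd]
    intro hd
    have := Nat.le_of_dvd hm hd
    omega
  obtain ⟨L, hL, hLs, hLp⟩ := exists_lefschetz p hc hy
  have hLne : L ≠ 0 := by
    rintro rfl
    have h1 : ((t : ℤ) : ZMod p) = 0 := by
      rw [ht]
      push_cast
      rw [← hL, map_zero]
    rw [ZMod.intCast_zmod_eq_zero_iff_dvd] at h1
    have := Nat.le_of_dvd (by omega) (Int.natCast_dvd.mp h1)
    omega
  obtain ⟨C, hC⟩ := Finsupp.support_nonempty_iff.mpr hLne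
  obtain ⟨f, hf⟩ := hLs C hC
  have hpowm : ∀ f, ∃ w, (u * c f) ^ m = c w := by
    intro f
    have : (u * c f) ^ m ∈ c.range := by
      rw [← QuotientGroup.eq_one_iff, QuotientGroup.mk_pow, QuotientGroup.mk_mul,
        (QuotientGroup.eq_one_iff (c f)).mpr (MonoidHom.mem_range.mpr ⟨f, rfl⟩), mul_one, ← QuotientGroup.mk_pow,
        QuotientGroup.eq_one_iff, hu]
      exact ⟨h, rfl⟩
    obtain ⟨w, hw⟩ := this
    exact ⟨w, hw.symm⟩
  obtain ⟨w, hw⟩ := hpowm f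
  refine ⟨f, ?_⟩
  rw [hw]
  by_contra hne
  have hw1 : w ≠ 1 := by
    rintro rfl
    exact hne (map_one c)
  have hroot : ∀ a : ℕ, ∃ v, w = v ^ p ^ (m.totient * a) := by
    intro a
    set q := p ^ (m.totient * a) with hq
    have hq1 : q ≡ 1 [MOD m] := by
      rw [hq, pow_mul]
      simpa using (Nat.ModEq.pow_totient hcop).pow a
    have hqpos : 1 ≤ q := Nat.one_le_pow _ _ hp.pos
    obtain ⟨e, he⟩ := (Nat.modEq_iff_dvd' hqpos).mp hq1.symm
    have huq : u ^ q = u * c (h ^ e) := by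
      rw [map_pow, ← hu, ← pow_mul, ← he, ← pow_succ']
      congr 1
      omega
    have hmap := hLp _ _ huq
    have hC' := hC
    rw [← hmap] at hC'
    obtain ⟨C', hC's, hC'C⟩ := Finset.mem_image.mp (Finsupp.mapDomain_support hC')
    obtain ⟨f', rfl⟩ := hLs C' hC's
    rw [powClass_mk, hf, ConjClasses.mk_eq_mk_iff_isConj, isConj_iff] at hC'C
    obtain ⟨b, hb⟩ := hC'C
    obtain ⟨w', hw'⟩ := hpowm f'
    obtain ⟨v, hv⟩ := hn.conj_mem _ ⟨w', rfl⟩ b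
    refine ⟨v, hc ?_⟩
    rw [map_pow, hv, ← hw, ← hb, conj_pow, conj_pow, ← pow_mul, mul_comm, pow_mul, hw']
  obtain ⟨v, hv⟩ := hroot (w.norm + 1)
  have hv1 : v ≠ 1 := by
    rintro rfl
    exact hw1 (by rw [hv, one_pow])
  have h1 := le_norm_pow hv1 (p ^ (m.totient * (w.norm + 1)))
  rw [← hv] at h1
  have h2 : w.norm + 1 ≤ m.totient * (w.norm + 1) :=
    Nat.le_mul_of_pos_left _ (Nat.totient_pos.mpr hm)
  have h3 := Nat.lt_pow_self (n := m.totient * (w.norm + 1)) hp.one_lt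
  omega

/-- An automorphism of a free group of finite rank at least two which has finite order modulo inner
automorphisms and whose trace is not `1` has finite order after an inner twist. -/
theorem exists_conj_mul_pow_eq_one [Nontrivial ι] {φ : MulAut (FreeGroup ι)} {m : ℕ} (hm : 0 < m)
    {w : FreeGroup ι} (hφ : φ ^ m = MulAut.conj w)
    (htr : ∑ i, (expSum i (φ (of i))).toAdd ≠ 1) :
    ∃ g, (MulAut.conj g * φ) ^ m = 1 := by
  have hc : Function.Injective (MulAut.conj : FreeGroup ι →* MulAut (FreeGroup ι)) := by
    rw [injective_iff_map_eq_one]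
    intro g hg
    refine eq_one_of_forall_commute fun i => ?_
    have := DFunLike.congr_fun hg (of i)
    rw [MulAut.conj_apply, MulAut.one_apply, mul_inv_eq_iff_eq_mul] at this
    exact this
  have hconj : ∀ (ψ : MulAut (FreeGroup ι)) g, ψ * MulAut.conj g * ψ⁻¹ = MulAut.conj (ψ g) := by
    intro ψ g
    ext x
    simp
  have hn : (MulAut.conj : FreeGroup ι →* MulAut (FreeGroup ι)).range.Normal := by
    refine ⟨?_⟩
    rintro _ ⟨g, rfl⟩ ψ
    exact ⟨ψ g, (hconj ψ g).symm⟩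
  obtain ⟨f, hf⟩ := exists_finite_order_lift (u := φ⁻¹) (y := fun i => φ (of i)) hc hn
    (fun i => by rw [← hconj]; group) hm (h := w⁻¹) (by rw [inv_pow, hφ, map_inv]) htr
  refine ⟨f⁻¹, ?_⟩
  rw [map_inv, ← inv_inj, ← inv_pow, mul_inv_rev, inv_inv, hf, inv_one]

end FiniteOrderLift

section Cosets

variable {Γ : Type*} [Group Γ]

/-- The elements `s 0, …, s (L - 1)` satisfy the braid relations. -/
structure BraidRel (s : ℕ → Γ) (L : ℕ) : Prop where
  comm : ∀ i j, i + 2 ≤ j → j < L → Commute (s i) (s j)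
  braid : ∀ i, i + 1 < L → s i * s (i + 1) * s i = s (i + 1) * s i * s (i + 1)

variable (s : ℕ → Γ) (N : ℕ)

/-- The product `s k ⋯ s (N - 1)`. -/
def descent (k : ℕ) : Γ := ((List.range' k (N - k)).map s).prod

/-- The `k`-th generator of the group of pure braids in which only the last strand moves. -/
def pureGen (k : ℕ) : Γ := (descent s N (k + 1))⁻¹ * s k ^ 2 * descent s N (k + 1)

/-- The pure last-strand braids together with the braids on the other strands. -/
def lastStab : Subgroup Γ := Subgroup.closure ({a | ∃ k < N, a = pureGen s N k} ∪ {a | ∃ i, i + 1 < N ∧ a = s i})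

variable {s N}

theorem descent_self : descent s N N = 1 := by simp [descent]

theorem descent_eq {k : ℕ} (hk : k < N) : descent s N k = s k * descent s N (k + 1) := by
  have h : N - k = (N - (k + 1)) + 1 := by omega
  rw [descent, descent, h, List.range'_succ]
  simp

theorem pureGen_mem {k : ℕ} (hk : k < N) : pureGen s N k ∈ lastStab s N :=
  Subgroup.subset_closure (Or.inl ⟨k, hk, rfl⟩)

theorem gen_mem_lastStab {i : ℕ} (hi : i + 1 < N) : s i ∈ lastStab s N :=
  Subgroup.subset_closure (Or.inr ⟨i, hi, rfl⟩)

variable {L : ℕ} (hs : BraidRel s L) (hN : N ≤ L)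
include hs hN

theorem commute_descent {j k : ℕ} (hk : k ≤ N) (hj : j + 2 ≤ k) :
    Commute (s j) (descent s N k) := by
  induction hk using Nat.decreasingInduction with
  | self => rw [descent_self]; exact Commute.one_right _
  | of_succ k hk ih =>
    rw [descent_eq hk]
    exact (hs.comm j k hj (by omega)).mul_right (ih (by omega))

theorem gen_mul_descent {j k : ℕ} (hkj : k ≤ j) (hj : j + 1 < N) :
    s (j + 1) * descent s N k = descent s N k * s j := by
  induction hkj using Nat.decreasingInduction with
  | self =>
    rw [descent_eq (by omega : j < N), descent_eq hj]
    have h1 := (commute_descent hs hN (by omega : j + 2 ≤ N) le_rfl).eq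
    have h2 := hs.braid j (by omega)
    calc s (j + 1) * (s j * (s (j + 1) * descent s N (j + 1 + 1)))
        = s (j + 1) * s j * s (j + 1) * descent s N (j + 2) := by simp only [mul_assoc]
      _ = s j * s (j + 1) * (s j * descent s N (j + 2)) := by rw [← h2]; simp only [mul_assoc]
      _ = _ := by rw [h1]; simp only [mul_assoc]
  | of_succ k hk ih =>
    rw [descent_eq (by omega : k < N), ← mul_assoc,
      ← (hs.comm k (j + 1) (by omega) (by omega)).eq, mul_assoc, ih, mul_assoc]

theorem inv_mul_sq_mul {k : ℕ} (hk : k + 1 < N) :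
    (s (k + 1))⁻¹ * s k ^ 2 * s (k + 1) = s k * s (k + 1) ^ 2 * (s k)⁻¹ := by
  have h := hs.braid k (by omega)
  rw [eq_mul_inv_iff_mul_eq, mul_assoc, mul_assoc, inv_mul_eq_iff_eq_mul, sq, sq]
  calc s k * s k * (s (k + 1) * s k) = s k * (s k * s (k + 1) * s k) := by simp only [mul_assoc]
    _ = (s k * s (k + 1) * s k) * s (k + 1) := by rw [h]; simp only [mul_assoc]; rw [← mul_assoc, ← mul_assoc, h]; simp only [mul_assoc]
    _ = _ := by rw [h]; simp only [mul_assoc]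

theorem pureGen_eq {k : ℕ} (hk : k + 1 < N) :
    pureGen s N k = s k * pureGen s N (k + 1) * (s k)⁻¹ := by
  have h1 := (commute_descent hs hN (by omega : k + 2 ≤ N) le_rfl)
  have h2 := inv_mul_sq_mul hs hN hk
  rw [pureGen, pureGen, descent_eq hk]
  set c := descent s N (k + 1 + 1)
  calc (s (k + 1) * c)⁻¹ * s k ^ 2 * (s (k + 1) * c)
      = c⁻¹ * ((s (k + 1))⁻¹ * s k ^ 2 * s (k + 1)) * c := by group
    _ = (c⁻¹ * s k) * s (k + 1) ^ 2 * ((s k)⁻¹ * c) := by rw [h2]; group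
    _ = (s k * c⁻¹) * s (k + 1) ^ 2 * (c * (s k)⁻¹) := by
      rw [h1.symm.inv_left.eq, (h1.inv_left).eq]
    _ = _ := by group

theorem exists_coset {b : Γ} (hb : b ∈ Subgroup.closure {a | ∃ i < N, a = s i}) :
    ∃ k ≤ N, ∃ p ∈ lastStab s N, b = descent s N k * p := by
  induction hb using Subgroup.closure_induction_left with
  | one => exact ⟨N, le_rfl, 1, one_mem _, by rw [descent_self, one_mul]⟩
  | mul_left x hx y _ ih =>
    obtain ⟨j, hj, rfl⟩ := hx
    obtain ⟨k, hk, p, hp, rfl⟩ := ih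
    rcases lt_trichotomy j k with h | rfl | h
    · by_cases h' : j + 1 = k
      · subst h'
        exact ⟨j, hj.le, p, hp, by rw [descent_eq hj, mul_assoc]⟩
      · exact ⟨k, hk, s j * p, mul_mem (gen_mem_lastStab (by omega)) hp, by
          rw [← mul_assoc, (commute_descent hs hN hk (by omega)).eq, mul_assoc]⟩
    · refine ⟨j + 1, hj, pureGen s N j * p, mul_mem (pureGen_mem hj) hp, ?_⟩
      rw [descent_eq hj, pureGen, sq]
      group
    · obtain ⟨j, rfl⟩ : ∃ i, j = i + 1 := ⟨j - 1, by omega⟩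
      exact ⟨k, hk, s j * p, mul_mem (gen_mem_lastStab hj) hp, by
        rw [← mul_assoc, gen_mul_descent hs hN (by omega) hj, mul_assoc]⟩
  | inv_mul_cancel x hx y _ ih =>
    obtain ⟨j, hj, rfl⟩ := hx
    obtain ⟨k, hk, p, hp, rfl⟩ := ih
    rcases lt_trichotomy j k with h | rfl | h
    · by_cases h' : j + 1 = k
      · subst h'
        refine ⟨j, hj.le, (pureGen s N j)⁻¹ * p, mul_mem (inv_mem (pureGen_mem hj)) hp, ?_⟩
        rw [descent_eq hj, pureGen]
        group
      · exact ⟨k, hk, (s j)⁻¹ * p, mul_mem (inv_mem (gen_mem_lastStab (by omega))) hp, by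
          rw [← mul_assoc, (commute_descent hs hN hk (by omega)).inv_left.eq, mul_assoc]⟩
    · exact ⟨j + 1, hj, p, hp, by rw [descent_eq hj]; group⟩
    · obtain ⟨j, rfl⟩ : ∃ i, j = i + 1 := ⟨j - 1, by omega⟩
      refine ⟨k, hk, (s j)⁻¹ * p, mul_mem (inv_mem (gen_mem_lastStab hj)) hp, ?_⟩
      rw [← mul_assoc, ← mul_assoc, mul_left_inj, inv_mul_eq_iff_eq_mul, ← mul_assoc,
        gen_mul_descent hs hN (by omega) hj, mul_inv_cancel_right]

theorem commute_gen_pureGen {j k : ℕ} (hj : j + 1 < N) (hk : k < N) (hjk : j ≠ k)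
    (hjk' : j + 1 ≠ k) : Commute (s j) (pureGen s N k) := by
  rcases lt_or_gt_of_ne hjk with h | h
  · have h1 := commute_descent hs hN (by omega : k + 1 ≤ N) (by omega : j + 2 ≤ k + 1)
    exact (h1.inv_right.mul_right ((hs.comm j k (by omega) (by omega)).pow_right 2)).mul_right h1
  · have h1 := gen_mul_descent hs hN (by omega : k + 1 ≤ j) hj
    have h2 := ((hs.comm k (j + 1) (by omega) (by omega)).pow_left 2).eq
    have h3 : s j = (descent s N (k + 1))⁻¹ * s (j + 1) * descent s N (k + 1) := by
      rw [mul_assoc, h1, inv_mul_cancel_left]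
    rw [pureGen, h3]
    set c := descent s N (k + 1)
    change c⁻¹ * s (j + 1) * c * (c⁻¹ * s k ^ 2 * c) = c⁻¹ * s k ^ 2 * c * (c⁻¹ * s (j + 1) * c)
    calc _ = c⁻¹ * (s (j + 1) * s k ^ 2) * c := by group
      _ = _ := by rw [← h2]; group

theorem gen_conj_pureGen {k : ℕ} (hk : k + 1 < N) : s k * pureGen s N k * (s k)⁻¹ =
    (pureGen s N k)⁻¹ * pureGen s N (k + 1) * pureGen s N k := by
  have h1 := (commute_descent hs hN (by omega : k + 2 ≤ N) le_rfl)
  have h : s k * (pureGen s N (k + 1) * pureGen s N k) =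
      pureGen s N (k + 1) * pureGen s N k * s k := by
    rw [pureGen, pureGen, descent_eq hk]
    set c := descent s N (k + 1 + 1)
    have hb := hs.braid k (by omega)
    have h3 : s k * (s (k + 1) * s k ^ 2 * s (k + 1)) = s (k + 1) * s k ^ 2 * s (k + 1) * s k := by
      rw [sq]
      calc s k * (s (k + 1) * (s k * s k) * s (k + 1))
          = (s k * s (k + 1) * s k) * (s k * s (k + 1)) := by simp only [mul_assoc]
        _ = s (k + 1) * s k * (s (k + 1) * s k * s (k + 1)) := by rw [hb]; simp only [mul_assoc]
        _ = _ := by rw [← hb]; simp only [mul_assoc]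
    calc s k * (c⁻¹ * s (k + 1) ^ 2 * c * ((s (k + 1) * c)⁻¹ * s k ^ 2 * (s (k + 1) * c)))
        = (s k * c⁻¹) * (s (k + 1) * s k ^ 2 * s (k + 1)) * c := by group
      _ = c⁻¹ * (s k * (s (k + 1) * s k ^ 2 * s (k + 1))) * c := by
        rw [h1.inv_right.eq]; group
      _ = c⁻¹ * (s (k + 1) * s k ^ 2 * s (k + 1)) * (s k * c) := by rw [h3]; group
      _ = _ := by rw [h1.eq]; group
  have h2 := pureGen_eq hs hN hk
  have h3 : pureGen s N k * (s k * pureGen s N k * (s k)⁻¹) =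
      pureGen s N (k + 1) * pureGen s N k := by
    nth_rewrite 1 [h2]
    calc _ = s k * (pureGen s N (k + 1) * pureGen s N k) * (s k)⁻¹ := by group
      _ = _ := by rw [h]; group
  rw [mul_assoc (pureGen s N k)⁻¹, ← h3]
  group

theorem exists_factor {p : Γ} (hp : p ∈ lastStab s N) :
    ∃ h ∈ Subgroup.closure {a | ∃ i, i + 1 < N ∧ a = s i},
    ∃ u ∈ Subgroup.closure {a | ∃ k < N, a = pureGen s N k}, p = h * u := by
  set H := Subgroup.closure {a | ∃ i, i + 1 < N ∧ a = s i} with hH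
  set U := Subgroup.closure {a | ∃ k < N, a = pureGen s N k} with hU
  have hpU : ∀ k < N, pureGen s N k ∈ U := fun k hk => Subgroup.subset_closure ⟨k, hk, rfl⟩
  have hconj : ∀ j, j + 1 < N → ∀ k < N, s j * pureGen s N k * (s j)⁻¹ ∈ U ∧
      (s j)⁻¹ * pureGen s N k * s j ∈ U := by
    intro j hj k hk
    by_cases h1 : j = k
    · subst h1
      refine ⟨?_, ?_⟩
      · rw [gen_conj_pureGen hs hN hj]
        exact mul_mem (mul_mem (inv_mem (hpU _ hk)) (hpU _ hj)) (hpU _ hk)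
      · rw [pureGen_eq hs hN hj]
        convert hpU _ hj using 1
        group
    · by_cases h2 : j + 1 = k
      · subst h2
        refine ⟨?_, ?_⟩
        · rw [← pureGen_eq hs hN hj]
          exact hpU _ (by omega)
        · have h3 := gen_conj_pureGen hs hN hj
          have h4 := pureGen_eq hs hN hj
          have h5 : (s j)⁻¹ * pureGen s N (j + 1) * s j =
              pureGen s N (j + 1) * pureGen s N j * (pureGen s N (j + 1))⁻¹ := by
            have h6 : pureGen s N (j + 1) = pureGen s N j * (s j * pureGen s N j * (s j)⁻¹) *
                (pureGen s N j)⁻¹ := by rw [h3]; group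
            have h7 : pureGen s N j * s j = s j * pureGen s N (j + 1) := by
              nth_rewrite 1 [h4]
              group
            nth_rewrite 1 [h6]
            calc _ = (s j)⁻¹ * (pureGen s N j * s j) * pureGen s N j *
                  ((pureGen s N j * s j)⁻¹ * s j) := by group
              _ = _ := by rw [h7]; group
          rw [h5]
          exact mul_mem (mul_mem (hpU _ hk) (hpU _ (by omega))) (inv_mem (hpU _ hk))
      · have h3 := commute_gen_pureGen hs hN hj hk h1 h2
        refine ⟨?_, ?_⟩
        · rw [h3.eq, mul_inv_cancel_right]
          exact hpU _ hk
        · rw [h3.inv_left.eq, inv_mul_cancel_right]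
          exact hpU _ hk
  have hle : H ≤ Subgroup.normalizer (U : Set Γ) := by
    rw [hH, Subgroup.closure_le]
    rintro _ ⟨j, hj, rfl⟩
    have key : ∀ t : Γ, (∀ k < N, t * pureGen s N k * t⁻¹ ∈ U) → ∀ u ∈ U, t * u * t⁻¹ ∈ U := by
      intro t ht
      have : U ≤ U.comap (MulAut.conj t).toMonoidHom := by
        conv_lhs => rw [hU]
        rw [Subgroup.closure_le]
        rintro _ ⟨k, hk, rfl⟩
        exact ht k hk
      exact fun u hu => this hu
    rw [SetLike.mem_coe, Subgroup.mem_normalizer_iff]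
    intro u
    refine ⟨key _ (fun k hk => (hconj j hj k hk).1) u, fun h => ?_⟩
    have := key (s j)⁻¹ (fun k hk => by simpa using (hconj j hj k hk).2) _ h
    convert this using 1
    group
  have hsup : lastStab s N = H ⊔ U := by
    rw [lastStab, Subgroup.closure_union, sup_comm]
  rw [hsup, ← SetLike.mem_coe, Subgroup.coe_mul_of_left_le_normalizer_right H U hle] at hp
  obtain ⟨h, hh, u, hu, rfl⟩ := hp
  exact ⟨h, hh, u, hu, rfl⟩

end Cosets

section Faithful

variable {Γ κ : Type*} [Group Γ] [DecidableEq κ]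

/-- The homomorphism killing the generator `of c`. -/
def kill (c : κ) : FreeGroup κ →* FreeGroup κ := lift fun d => if d = c then 1 else of d

theorem kill_self (c : κ) : kill c (of c) = 1 := by simp [kill]

theorem kill_of {c d : κ} (h : d ≠ c) : kill c (of d) = of d := by simp [kill, h]

/-- `Φ` realizes the elements `s i` as half-twists of consecutive generators `of (e i)`. -/
structure IsTwistAction (s : ℕ → Γ) (L : ℕ) (e : ℕ → κ) (Φ : Γ →* MulAut (FreeGroup κ)) :
    Prop where
  inj : ∀ i ≤ L, ∀ j ≤ L, e i = e j → i = j
  eq_twist : ∀ i < L, ∃ h : e i ≠ e (i + 1), Φ (s i) = twist _ _ h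

variable {s : ℕ → Γ} {L N : ℕ} {e : ℕ → κ} {Φ : Γ →* MulAut (FreeGroup κ)}

section Act

variable (hΦ : IsTwistAction s L e Φ)
include hΦ

theorem act_left {i : ℕ} (hi : i < L) : Φ (s i) (of (e i)) =
    of (e i) * of (e (i + 1)) * (of (e i))⁻¹ := by
  obtain ⟨h, h'⟩ := hΦ.eq_twist i hi
  rw [h', twist_left]

theorem act_right {i : ℕ} (hi : i < L) : Φ (s i) (of (e (i + 1))) = of (e i) := by
  obtain ⟨h, h'⟩ := hΦ.eq_twist i hi
  rw [h', twist_right]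

theorem act_other {i j : ℕ} (hi : i < L) (hj : j ≤ L) (h1 : j ≠ i) (h2 : j ≠ i + 1) :
    Φ (s i) (of (e j)) = of (e j) := by
  obtain ⟨h, h'⟩ := hΦ.eq_twist i hi
  rw [h', twist_other]
  · exact fun h => h1 (hΦ.inj _ hj _ hi.le h)
  · exact fun h => h2 (hΦ.inj _ hj _ hi h)

theorem act_descent (hN : N ≤ L) {k : ℕ} (hk : k ≤ N) :
    Φ (descent s N k) (of (e N)) = of (e k) := by
  induction hk using Nat.decreasingInduction with
  | self => rw [descent_self, map_one]; rfl
  | of_succ k hk ih => rw [descent_eq hk, map_mul, MulAut.mul_apply, ih, act_right hΦ (by omega)]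

theorem inv_act_other {i j : ℕ} (hi : i < L) (hj : j ≤ L) (h1 : j ≠ i) (h2 : j ≠ i + 1) :
    (Φ (s i))⁻¹ (of (e j)) = of (e j) := by
  nth_rewrite 1 [← act_other hΦ hi hj h1 h2]
  rw [MulAut.inv_apply_self]

theorem kill_act {i : ℕ} (hi : i + 1 < N) (hN : N ≤ L) (y : FreeGroup κ) :
    kill (e N) (Φ (s i) y) = Φ (s i) (kill (e N) y) := by
  obtain ⟨h, h'⟩ := hΦ.eq_twist i (by omega)
  have h1 : e i ≠ e N := fun h => by have := hΦ.inj _ (by omega) _ hN h; omega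
  have h2 : e (i + 1) ≠ e N := fun h => by have := hΦ.inj _ (by omega) _ hN h; omega
  have : (kill (e N)).comp (Φ (s i)).toMonoidHom = (Φ (s i)).toMonoidHom.comp (kill (e N)) := by
    refine FreeGroup.ext_hom _ _ fun c => ?_
    change kill (e N) (Φ (s i) (of c)) = Φ (s i) (kill (e N) (of c))
    rw [h']
    by_cases c1 : c = e i
    · subst c1; simp [kill_of h1, kill_of h2, twist_left]
    by_cases c2 : c = e (i + 1)
    · subst c2; simp [kill_of h1, kill_of h2, twist_right]
    rw [twist_other h c1 c2]
    by_cases c3 : c = e N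
    · subst c3; simp [kill_self]
    · rw [kill_of c3, twist_other h c1 c2]
  exact DFunLike.congr_fun this y

variable (hs : BraidRel s L)
include hs

theorem act_pureGen (hN : N ≤ L) {k : ℕ} (hk : k + 1 ≤ N) :
    Φ (pureGen s N k) (of (e N)) = of (e k) * of (e N) * (of (e k))⁻¹ := by
  obtain ⟨N, rfl⟩ : ∃ i, N = i + 1 := ⟨N - 1, by omega⟩
  induction (Nat.le_of_succ_le_succ hk) using Nat.decreasingInduction with
  | self =>
    rw [pureGen, descent_self, inv_one, one_mul, mul_one, sq, map_mul, MulAut.mul_apply,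
      act_right hΦ (by omega), act_left hΦ (by omega)]
  | of_succ k hk ih =>
    rw [pureGen_eq hs hN (by omega), map_mul, map_mul, map_inv, MulAut.mul_apply, MulAut.mul_apply,
      inv_act_other hΦ (by omega) hN (by omega) (by omega), ih (by omega), map_mul, map_mul,
      map_inv, act_right hΦ (by omega), act_other hΦ (by omega) hN (by omega) (by omega)]

theorem kill_pureGen (hN : N ≤ L) {k : ℕ} (hk : k + 1 ≤ N) (y : FreeGroup κ) :
    kill (e N) (Φ (pureGen s N k) y) = kill (e N) y := by
  obtain ⟨N, rfl⟩ : ∃ i, N = i + 1 := ⟨N - 1, by omega⟩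
  induction (Nat.le_of_succ_le_succ hk) using Nat.decreasingInduction generalizing y with
  | self =>
    rw [pureGen, descent_self, inv_one, one_mul, mul_one, sq, map_mul, MulAut.mul_apply]
    obtain ⟨h, h'⟩ := hΦ.eq_twist N (by omega)
    have : (kill (e (N + 1))).comp ((Φ (s N)).toMonoidHom.comp (Φ (s N)).toMonoidHom) =
        kill (e (N + 1)) := by
      refine FreeGroup.ext_hom _ _ fun c => ?_
      change kill (e (N + 1)) (Φ (s N) (Φ (s N) (of c))) = kill (e (N + 1)) (of c)
      rw [h']
      by_cases c1 : c = e N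
      · subst c1; simp [kill_of h, kill_self, twist_left, twist_right]
      by_cases c2 : c = e (N + 1)
      · subst c2; simp [kill_self, twist_left, twist_right]
      rw [twist_other h c1 c2, twist_other h c1 c2]
    exact DFunLike.congr_fun this y
  | of_succ k hk ih =>
    rw [pureGen_eq hs hN (by omega), map_mul, map_mul, map_inv, MulAut.mul_apply, MulAut.mul_apply,
      kill_act hΦ (by omega) hN, ih _ (by omega), ← kill_act hΦ (by omega) hN,
      MulAut.apply_inv_self]

theorem lastStab_fixes (hN : N ≤ L) {p : Γ} (hp : p ∈ lastStab s N) :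
    IsConj (of (e N)) (Φ p (of (e N))) := by
  induction hp using Subgroup.closure_induction with
  | mem p hp =>
    rcases hp with ⟨k, hk, rfl⟩ | ⟨i, hi, rfl⟩
    · rw [act_pureGen hΦ hs hN hk]; exact isConj_iff.mpr ⟨_, rfl⟩
    · rw [act_other hΦ (by omega) hN (by omega) (by omega)]
  | one => rw [map_one]; exact IsConj.refl _
  | mul p q _ _ hp hq =>
    rw [map_mul, MulAut.mul_apply]
    exact hp.trans ((Φ p).toMonoidHom.map_isConj hq)
  | inv p _ hp =>
    have := (Φ p)⁻¹.toMonoidHom.map_isConj hp.symm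
    rw [map_inv]
    simpa using this

theorem exists_conj_pure (hN : N ≤ L) (w : FreeGroup (Fin N)) :
    (∀ y, kill (e N) ((Φ (lift (fun k : Fin N => (pureGen s N k)⁻¹) w))⁻¹ y) = kill (e N) y) ∧
    ∃ g, (Φ (lift (fun k : Fin N => (pureGen s N k)⁻¹) w))⁻¹ (of (e N)) = g * of (e N) * g⁻¹ ∧
      kill (e N) g = FreeGroup.map (fun k : Fin N => e k) w := by
  have hne : ∀ k : Fin N, e k ≠ e N := fun k h => by
    have := hΦ.inj _ (by omega) _ hN h; omega
  have kinv : ∀ (k : Fin N) y, kill (e N) ((Φ (pureGen s N k))⁻¹ y) = kill (e N) y := fun k y => by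
    rw [← kill_pureGen hΦ hs hN k.2, MulAut.apply_inv_self]
  induction w using FreeGroup.induction_on with
  | C1 => exact ⟨by simp, 1, by simp, by simp⟩
  | of k =>
    refine ⟨fun y => ?_, of (e k), ?_, ?_⟩
    · simp [kill_pureGen hΦ hs hN k.2]
    · simp [act_pureGen hΦ hs hN k.2]
    · simp [kill_of (hne k)]
  | inv_of k _ =>
    refine ⟨fun y => ?_, ((Φ (pureGen s N k))⁻¹ (of (e k)))⁻¹, ?_, ?_⟩
    · simpa using kinv k y
    · have h := act_pureGen hΦ hs hN k.2
      have h2 : of (e N) = (of (e k))⁻¹ * Φ (pureGen s N k) (of (e N)) * of (e k) := by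
        rw [h]; group
      simp only [map_inv, FreeGroup.lift_apply_of, inv_inv]
      nth_rewrite 1 [h2]
      simp
    · rw [map_inv, kinv, kill_of (hne k)]; simp
  | mul a b ha hb =>
    obtain ⟨ha1, g, hg, hg'⟩ := ha
    obtain ⟨hb1, h, hh, hh'⟩ := hb
    refine ⟨fun y => ?_, (Φ (lift (fun k : Fin N => (pureGen s N k)⁻¹) b))⁻¹ g * h, ?_, ?_⟩
    · rw [map_mul, map_mul, mul_inv_rev, MulAut.mul_apply, hb1, ha1]
    · rw [map_mul, map_mul, mul_inv_rev, MulAut.mul_apply, hg, map_mul, map_mul, hh, map_inv]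
      group
    · rw [map_mul, hb1, hg', hh', map_mul]

theorem eq_one_of_act_eq_one (hN : N ≤ L) {b : Γ}
    (hb : b ∈ Subgroup.closure {a | ∃ i < N, a = s i}) (h1 : Φ b = 1) : b = 1 := by
  induction N generalizing b with
  | zero => simpa using hb
  | succ N ih =>
    obtain ⟨k, hk, p, hp, rfl⟩ := exists_coset hs hN hb
    have hfix := lastStab_fixes hΦ hs hN hp
    have hk' : k = N + 1 := by
      have h2 := (Φ (descent s (N + 1) k)).toMonoidHom.map_isConj hfix
      change IsConj (Φ (descent s (N + 1) k) _) (Φ (descent s (N + 1) k) _) at h2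
      rw [act_descent hΦ hN hk, ← MulAut.mul_apply, ← map_mul, h1, MulAut.one_apply,
        isConj_of_iff] at h2
      exact hΦ.inj _ (by omega) _ hN h2
    subst hk'
    rw [descent_self, one_mul] at h1 ⊢
    obtain ⟨h, hh, u, hu, rfl⟩ := exists_factor hs hN hp
    have hh' : h ∈ Subgroup.closure {a | ∃ i < N, a = s i} := by
      simpa only [Nat.add_lt_add_iff_right] using hh
    have hhfix : Φ h (of (e (N + 1))) = of (e (N + 1)) := by
      clear h1 hp hfix hh hb
      induction hh' using Subgroup.closure_induction with
      | mem x hx =>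
        obtain ⟨i, hi, rfl⟩ := hx
        exact act_other hΦ (by omega) hN (by omega) (by omega)
      | one => rw [map_one]; rfl
      | mul x y _ _ hx hy => rw [map_mul, MulAut.mul_apply, hy, hx]
      | inv x _ hx =>
        rw [map_inv]; nth_rewrite 1 [← hx]; rw [MulAut.inv_apply_self]
    obtain ⟨w, rfl⟩ : ∃ w : FreeGroup (Fin (N + 1)),
        lift (fun k : Fin (N + 1) => (pureGen s (N + 1) k)⁻¹) w = u := by
      have hle : Subgroup.closure {a | ∃ k < N + 1, a = pureGen s (N + 1) k} ≤
          (lift (fun k : Fin (N + 1) => (pureGen s (N + 1) k)⁻¹)).range := by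
        rw [Subgroup.closure_le]
        rintro _ ⟨k, hk, rfl⟩
        exact ⟨(of ⟨k, hk⟩)⁻¹, by simp⟩
      exact hle hu
    obtain ⟨-, g, hg, hg'⟩ := exists_conj_pure hΦ hs hN w
    set u := lift (fun k : Fin (N + 1) => (pureGen s (N + 1) k)⁻¹) w with hu_def
    have e1 : (Φ u)⁻¹ = Φ h := (eq_inv_of_mul_eq_one_left (by rw [← map_mul, h1])).symm
    rw [e1, hhfix] at hg
    have hcomm : Commute g (of (e (N + 1))) := by
      rw [commute_iff_eq]; nth_rewrite 2 [hg]; group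
    obtain ⟨l, hl⟩ := Subgroup.mem_zpowers_iff.mp (mem_zpowers_of_commute
      (lift fun _ => Multiplicative.ofAdd 1) (by simp) hcomm)
    have hw : w = 1 := by
      have hinj : Function.Injective (fun k : Fin (N + 1) => e k) := fun a b hab =>
        Fin.ext (hΦ.inj _ (by omega) _ (by omega) hab)
      refine FreeGroup.map_injective hinj ?_
      rw [← hg', ← hl, map_zpow, kill_self, one_zpow, map_one]
    have hu1 : u = 1 := by rw [hu_def, hw, map_one]
    rw [hu1, mul_one] at h1 ⊢
    exact ih (by omega) hh' h1

end Act

end Faithful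

section BraidGroup

/-- The relations of the braid group on `n` strands, with generators indexed by `ℕ`; those out of
range are trivial. -/
def braidRels (n : ℕ) : Set (FreeGroup ℕ) :=
  {r | (∃ i, n ≤ i + 1 ∧ r = of i) ∨
    (∃ i j, i + 2 ≤ j ∧ j < n - 1 ∧ r = of i * of j * (of j * of i)⁻¹) ∨
    (∃ i, i + 1 < n - 1 ∧
      r = of i * of (i + 1) * of i * (of (i + 1) * of i * of (i + 1))⁻¹)}

/-- The braid group on `n` strands. -/
abbrev Braid (n : ℕ) := PresentedGroup (braidRels n)

/-- The generators of the braid group. -/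
def bs (n i : ℕ) : Braid n := PresentedGroup.of i

variable {n : ℕ}

theorem bs_of_le {i : ℕ} (h : n ≤ i + 1) : bs n i = 1 :=
  PresentedGroup.one_of_mem (Or.inl ⟨i, h, rfl⟩)

theorem braidRel_bs : BraidRel (bs n) (n - 1) where
  comm i j hij hj := PresentedGroup.mk_eq_mk_of_mul_inv_mem (Or.inr (Or.inl ⟨i, j, hij, hj, rfl⟩))
  braid i hi := PresentedGroup.mk_eq_mk_of_mul_inv_mem (Or.inr (Or.inr ⟨i, hi, rfl⟩))

/-- The universal property of the braid group. -/
def braidLift {H : Type*} [Group H] (f : ℕ → H) (h : ∀ i, n ≤ i + 1 → f i = 1)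
    (hf : BraidRel f (n - 1)) : Braid n →* H :=
  PresentedGroup.toGroup (f := f) (by
    rintro r (⟨i, hi, rfl⟩ | ⟨i, j, hij, hj, rfl⟩ | ⟨i, hi, rfl⟩)
    · simpa using h i hi
    · simpa only [map_mul, map_inv, FreeGroup.lift_apply_of, mul_inv_eq_one] using (hf.comm i j hij hj).eq
    · simpa only [map_mul, map_inv, FreeGroup.lift_apply_of, mul_inv_eq_one] using hf.braid i hi)

theorem braidLift_bs {H : Type*} [Group H] (f : ℕ → H) (h : ∀ i, n ≤ i + 1 → f i = 1)
    (hf : BraidRel f (n - 1)) (i : ℕ) : braidLift f h hf (bs n i) = f i :=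
  PresentedGroup.toGroup.of _

theorem mem_closure_bs (b : Braid n) : b ∈ Subgroup.closure {a | ∃ i < n - 1, a = bs n i} := by
  refine PresentedGroup.generated_by _ _ (fun i => ?_) b
  by_cases h : i < n - 1
  · exact Subgroup.subset_closure ⟨i, h, rfl⟩
  · have : bs n i = 1 := bs_of_le (by omega)
    change bs n i ∈ _
    rw [this]
    exact one_mem _

theorem braid_induction {p : Braid n → Prop} (b : Braid n) (h1 : p 1)
    (hmul : ∀ a b, p a → p b → p (a * b)) (hinv : ∀ a, p a → p a⁻¹)
    (hs : ∀ i < n - 1, p (bs n i)) : p b := by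
  induction mem_closure_bs b using Subgroup.closure_induction with
  | mem x hx => obtain ⟨i, hi, rfl⟩ := hx; exact hs i hi
  | one => exact h1
  | mul x y _ _ hx hy => exact hmul x y hx hy
  | inv x _ hx => exact hinv x hx

end BraidGroup

section Artin

variable {n : ℕ} [hn : Fact (2 ≤ n)]

theorem braidRel_sg : BraidRel (sg n) (n - 1) where
  comm i j hij hj := by
    rw [commute_iff_eq, sg, sg, dif_pos (by omega), dif_pos (by omega)]
    exact twist_commute _ _ (intCast_ne (by omega) (by omega)) (intCast_ne (by omega) (by omega))
      (intCast_ne (by omega) (by omega)) (intCast_ne (by omega) (by omega))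
  braid i hi := by
    rw [sg, sg, dif_pos (by omega), dif_pos (by omega)]
    exact twist_braid _ (intCast_ne (by push_cast; omega) (by push_cast; omega))
      (intCast_ne (by push_cast; omega) (by push_cast; omega))

variable (n) in
/-- The Artin action of the braid group on the free group. -/
def artin : Braid n →* MulAut (FreeGroup (ZMod n)) :=
  braidLift (sg n) (fun _ h => sg_of_le h) braidRel_sg

theorem artin_bs (i : ℕ) : artin n (bs n i) = sg n i := braidLift_bs _ _ _ i

theorem artin_mem (b : Braid n) : artin n b ∈ A n :=
  braid_induction (p := fun b => artin n b ∈ A n) b (by rw [map_one]; exact one_mem _)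
    (fun a b ha hb => by rw [map_mul]; exact mul_mem ha hb)
    (fun a ha => by rw [map_inv]; exact inv_mem ha) (fun i _ => by rw [artin_bs]; exact sg_mem i)

theorem exists_artin_eq {a : MulAut (FreeGroup (ZMod n))} (ha : a ∈ A n) :
    ∃ b, artin n b = a := by
  have : A n ≤ (artin n).range := by
    rw [A, Subgroup.closure_le]
    rintro _ ⟨i, rfl⟩
    exact ⟨bs n i, artin_bs i⟩
  exact this ha

theorem isTwistAction_artin :
    IsTwistAction (bs n) (n - 1) (fun i => ((i : ℤ) : ZMod n)) (artin n) where
  inj i hi j hj h := by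
    have := hn.out
    by_contra hij
    rcases lt_or_gt_of_ne hij with h' | h'
    · exact intCast_ne (n := n) (by omega : (i : ℤ) < j) (by omega) h
    · exact intCast_ne (n := n) (by omega : (j : ℤ) < i) (by omega) h.symm
  eq_twist i hi := by
    refine ⟨natCast_ne_succ n (by omega), ?_⟩
    rw [artin_bs, sg, dif_pos (by omega)]
    rfl

theorem artin_injective : Function.Injective (artin n) := by
  rw [injective_iff_map_eq_one]
  exact fun b hb => eq_one_of_act_eq_one isTwistAction_artin braidRel_bs le_rfl
    (mem_closure_bs b) hb

theorem artin_descent : artin n (descent (bs n) (n - 1) 0) = delta n := by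
  rw [descent, map_list_prod, List.map_map, delta, List.range_eq_range', Nat.sub_zero]
  congr 2

end Artin

open SphereMCG

section Descents

variable {Γ : Type*} [Group Γ] (s : ℕ → Γ)

theorem descent_succ (m : ℕ) : descent s (m + 1) 0 = descent s m 0 * s m := by
  simp [descent, List.range'_concat]

/-- The product `s (m - 1) ⋯ s 0`. -/
def ascent (m : ℕ) : Γ := ((List.range' 0 m).reverse.map s).prod

theorem ascent_succ (m : ℕ) : ascent s (m + 1) = s m * ascent s m := by
  simp [ascent, List.range'_concat]

theorem ascent_zero : ascent s 0 = 1 := rfl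

theorem descent_zero : descent s 0 0 = 1 := rfl

end Descents

section Sphere

variable {n : ℕ}

theorem σf_of_le {i : ℕ} (h : n ≤ i + 1) : σf n (i + 1) = 1 := dif_neg (by omega)

theorem σf_succ {i : ℕ} (h : i < n - 1) : σf n (i + 1) = of ⟨i, h⟩ := dif_pos (by omega)

variable (n) in
/-- The projection from the braid group to the mapping class group of the punctured sphere. -/
def toM : Braid n →* M n :=
  braidLift (fun i => σ n (i + 1)) (fun i h => by rw [σ, σf_of_le h, map_one])
    { comm := fun i j hij hj => PresentedGroup.mk_eq_mk_of_mul_inv_mem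
        (Or.inl ⟨i + 1, j + 1, by omega, by omega, by omega, by omega, by omega, rfl⟩)
      braid := fun i hi => PresentedGroup.mk_eq_mk_of_mul_inv_mem
        (Or.inr (Or.inl ⟨i + 1, i + 1 + 1, by omega, by omega, by omega, by omega, by omega, rfl⟩)) }

theorem toM_bs (i : ℕ) : toM n (bs n i) = PresentedGroup.mk (rels n) (σf n (i + 1)) :=
  braidLift_bs _ _ _ i

theorem toM_surjective : Function.Surjective (toM n) := by
  rw [← MonoidHom.range_eq_top, eq_top_iff, ← PresentedGroup.closure_range_of, Subgroup.closure_le]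
  rintro _ ⟨i, rfl⟩
  exact ⟨bs n i, by rw [toM_bs, σf_succ i.2]; rfl⟩

theorem hom_σfProd {H : Type*} [Group H] (f : FreeGroup (Gen n) →* H) (m : ℕ) :
    f (σfProd n 1 m) = descent (fun i => f (σf n (i + 1))) m 0 := by
  induction m with
  | zero => simp [σfProd, descent_zero]
  | succ m ih =>
    rw [descent_succ, ← ih, ← map_mul]
    simp [σfProd, List.range'_concat, add_comm]

theorem hom_σfProdRev {H : Type*} [Group H] (f : FreeGroup (Gen n) →* H) (m : ℕ) :
    f (σfProdRev n 1 m) = ascent (fun i => f (σf n (i + 1))) m := by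
  induction m with
  | zero => simp [σfProdRev, ascent_zero]
  | succ m ih =>
    rw [ascent_succ, ← ih, ← map_mul]
    simp [σfProdRev, List.range'_concat, add_comm]

theorem map_descent {Γ H : Type*} [Group Γ] [Group H] (f : Γ →* H) (s : ℕ → Γ) (m k : ℕ) :
    f (descent s m k) = descent (fun i => f (s i)) m k := by
  simp [descent, map_list_prod, Function.comp_def]

theorem map_ascent {Γ H : Type*} [Group Γ] [Group H] (f : Γ →* H) (s : ℕ → Γ) (m : ℕ) :
    f (ascent s m) = ascent (fun i => f (s i)) m := by
  simp [ascent, map_list_prod, Function.comp_def]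

theorem toM_descent (m : ℕ) :
    toM n (descent (bs n) m 0) = PresentedGroup.mk (rels n) (σfProd n 1 m) := by
  rw [map_descent, hom_σfProd]
  simp only [toM_bs]

theorem toM_ascent (m : ℕ) :
    toM n (ascent (bs n) m) = PresentedGroup.mk (rels n) (σfProdRev n 1 m) := by
  rw [map_ascent, hom_σfProdRev]
  simp only [toM_bs]

variable (n) in
/-- The braid carrying the first strand around all the others. -/
def loop : Braid n := descent (bs n) (n - 1) 0 * ascent (bs n) (n - 1)

theorem toM_loop : toM n (loop n) = 1 := by
  rw [loop, map_mul, toM_descent, toM_ascent, ← map_mul]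
  exact PresentedGroup.one_of_mem (Or.inr (Or.inr (Or.inl rfl)))

theorem mem_of_toM_eq_one {K : Subgroup (Braid n)} [K.Normal] (h1 : loop n ∈ K)
    (h2 : descent (bs n) (n - 1) 0 ^ n ∈ K) {b : Braid n} (hb : toM n b = 1) : b ∈ K := by
  let f : Gen n → Braid n ⧸ K := fun i => QuotientGroup.mk' K (bs n i)
  have hf : ∀ i, lift f (σf n (i + 1)) = QuotientGroup.mk' K (bs n i) := by
    intro i
    by_cases h : i < n - 1
    · rw [σf_succ h, FreeGroup.lift_apply_of]
    · rw [σf_of_le (by omega), bs_of_le (by omega), map_one, map_one]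
  have hrel := braidRel_bs (n := n)
  have hb2 : ∀ i, i + 1 < n - 1 → lift f (σf n (i + 1)) * lift f (σf n (i + 1 + 1)) *
      lift f (σf n (i + 1)) = lift f (σf n (i + 1 + 1)) * lift f (σf n (i + 1)) *
      lift f (σf n (i + 1 + 1)) := fun i hi => by
    simp only [hf, ← map_mul]
    rw [hrel.braid i hi]
  have hb1 : ∀ i j, i + 2 ≤ j → j < n - 1 → lift f (σf n (i + 1)) * lift f (σf n (j + 1)) =
      lift f (σf n (j + 1)) * lift f (σf n (i + 1)) := fun i j hij hj => by
    simp only [hf, ← map_mul]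
    rw [(hrel.comm i j hij hj).eq]
  have hr : ∀ r ∈ rels n, lift f r = 1 := by
    rintro r (⟨i, j, hi, hi', hj, hj', hij, rfl⟩ | ⟨i, j, hi, hi', hj, hj', hij, rfl⟩ | rfl | rfl)
    · rw [map_mul, map_mul, map_inv, mul_inv_eq_one, map_mul]
      obtain ⟨i, rfl⟩ : ∃ k, i = k + 1 := ⟨i - 1, by omega⟩
      obtain ⟨j, rfl⟩ : ∃ k, j = k + 1 := ⟨j - 1, by omega⟩
      rcases hij with h | h
      · exact hb1 i j (by omega) (by omega)
      · exact (hb1 j i (by omega) (by omega)).symm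
    · simp only [map_mul, map_inv, mul_inv_eq_one]
      obtain ⟨i, rfl⟩ : ∃ k, i = k + 1 := ⟨i - 1, by omega⟩
      obtain ⟨j, rfl⟩ : ∃ k, j = k + 1 := ⟨j - 1, by omega⟩
      rcases hij with h | h
      · obtain rfl : j = i + 1 := by omega
        exact hb2 i (by omega)
      · obtain rfl : i = j + 1 := by omega
        exact (hb2 j (by omega)).symm
    · rw [map_mul, hom_σfProd, hom_σfProdRev]
      simp only [hf]
      rw [← map_descent, ← map_ascent, ← map_mul]
      exact (QuotientGroup.eq_one_iff _).mpr h1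
    · rw [map_pow, hom_σfProd]
      simp only [hf]
      rw [← map_descent, ← map_pow]
      exact (QuotientGroup.eq_one_iff _).mpr h2
  have hcomp : ∀ b : Braid n, PresentedGroup.toGroup hr (toM n b) = QuotientGroup.mk' K b := by
    intro b
    have : (PresentedGroup.toGroup hr).comp (toM n) = QuotientGroup.mk' K :=
      PresentedGroup.ext fun i => by
        change PresentedGroup.toGroup hr (toM n (bs n i)) = _
        rw [toM_bs]
        exact hf i
    exact DFunLike.congr_fun this b
  have := hcomp b
  rw [hb, map_one] at this
  exact (QuotientGroup.eq_one_iff _).mp this.symm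

end Sphere

section Point

variable {N : ℕ}

/-- The inclusion of braid groups adding one strand. -/
def addStrand (N : ℕ) : Braid N →* Braid (N + 1) :=
  braidLift (fun i => if i + 1 < N then bs (N + 1) i else 1) (fun i h => if_neg (by omega))
    { comm := fun i j hij hj => by
        rw [if_pos (by omega), if_pos (by omega)]
        exact braidRel_bs.comm i j hij (by omega)
      braid := fun i hi => by
        rw [if_pos (by omega), if_pos (by omega)]
        exact braidRel_bs.braid i (by omega) }

theorem addStrand_bs {i : ℕ} (h : i + 1 < N) : addStrand N (bs N i) = bs (N + 1) i :=
  (braidLift_bs _ _ _ i).trans (if_pos h)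

theorem addStrand_descent {m : ℕ} (hm : m < N) :
    addStrand N (descent (bs N) m 0) = descent (bs (N + 1)) m 0 := by
  induction m with
  | zero => exact map_one _
  | succ m ih => rw [descent_succ, descent_succ, map_mul, ih (by omega), addStrand_bs hm]

theorem addStrand_ascent {m : ℕ} (hm : m < N) :
    addStrand N (ascent (bs N) m) = ascent (bs (N + 1)) m := by
  induction m with
  | zero => exact map_one _
  | succ m ih => rw [ascent_succ, ascent_succ, map_mul, ih (by omega), addStrand_bs hm]

theorem toM_lastStab {p : Braid (N + 1)} (hp : p ∈ lastStab (bs (N + 1)) N) :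
    ∃ b, toM (N + 1) (addStrand N b) = toM (N + 1) p := by
  set J := ((toM (N + 1)).comp (addStrand N)).range with hJ
  have hgen : ∀ i, i + 1 < N → toM (N + 1) (bs (N + 1) i) ∈ J := fun i hi =>
    ⟨bs N i, by rw [MonoidHom.comp_apply, addStrand_bs hi]⟩
  have hpure : ∀ k, k + 1 ≤ N → toM (N + 1) (pureGen (bs (N + 1)) N k) ∈ J := by
    intro k hk
    obtain ⟨N, rfl⟩ : ∃ m, N = m + 1 := ⟨N - 1, by omega⟩
    induction (Nat.le_of_succ_le_succ hk) using Nat.decreasingInduction with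
    | self =>
      have h := toM_loop (n := N + 1 + 1)
      rw [loop, Nat.add_sub_cancel, descent_succ, ascent_succ] at h
      refine ⟨(descent (bs (N + 1)) N 0)⁻¹ * (ascent (bs (N + 1)) N)⁻¹, ?_⟩
      rw [MonoidHom.comp_apply, pureGen, descent_self, map_mul, map_inv, map_inv,
        addStrand_descent (by omega), addStrand_ascent (by omega)]
      simp only [map_mul, map_inv, inv_one, one_mul, mul_one, map_pow] at h ⊢
      set X := toM (N + 1 + 1) (descent (bs (N + 1 + 1)) N 0)
      set Y := toM (N + 1 + 1) (ascent (bs (N + 1 + 1)) N)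
      set S := toM (N + 1 + 1) (bs (N + 1 + 1) N)
      calc X⁻¹ * Y⁻¹ = X⁻¹ * (X * S * (S * Y)) * Y⁻¹ := by rw [h, mul_one]
        _ = S ^ 2 := by rw [sq]; group
    | of_succ k hk ih =>
      rw [pureGen_eq braidRel_bs (by omega) (by omega), map_mul, map_mul, map_inv]
      exact mul_mem (mul_mem (hgen k (by omega)) (ih (by omega))) (inv_mem (hgen k (by omega)))
  have hle : lastStab (bs (N + 1)) N ≤ J.comap (toM (N + 1)) := by
    rw [lastStab, Subgroup.closure_le]
    rintro _ (⟨k, hk, rfl⟩ | ⟨i, hi, rfl⟩)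
    · exact hpure k hk
    · exact hgen i hi
  obtain ⟨b, hb⟩ := hle hp
  exact ⟨b, hb⟩

end Point

section Loops

variable {n : ℕ} [hn : Fact (2 ≤ n)]

theorem aut_ext_x {a b : MulAut (FreeGroup (ZMod n))}
    (h : ∀ l : ℕ, l < n → a (x n l) = b (x n l)) : a = b := by
  refine mulAut_ext fun c => ?_
  obtain ⟨k, hk, rfl⟩ := exists_nat_rep c
  exact h k hk

theorem sg_x {i l : ℕ} (hi : i + 1 < n) (hl : l < n) : sg n i (x n l) =
    if l = i then x n i * x n (i + 1) * (x n i)⁻¹ else if l = i + 1 then x n i else x n l := by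
  split_ifs with h1 h2
  · subst h1; exact sg_left hi
  · subst h2; push_cast; exact sg_right hi
  · exact sg_other (by omega) (by omega) (by omega) (by omega)

theorem artin_ascent {m : ℕ} (hm : m < n) :
    artin n (ascent (bs n) m) (x n 0) = Z n m ∧
    (∀ l : ℕ, l < m → artin n (ascent (bs n) m) (x n (l + 1)) = x n l) ∧
    ∀ l : ℕ, m < l → l < n → artin n (ascent (bs n) m) (x n l) = x n l := by
  induction m with
  | zero =>
    refine ⟨?_, fun l hl => by omega, fun l _ _ => by rw [ascent_zero, map_one]; rfl⟩
    rw [ascent_zero, map_one, Nat.cast_zero, Z, D, G_zero]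
    simp
  | succ m ih =>
    obtain ⟨h1, h2, h3⟩ := ih (by omega)
    simp only [ascent_succ, map_mul, MulAut.mul_apply, artin_bs]
    refine ⟨?_, fun l hl => ?_, fun l hl hl' => ?_⟩
    · rw [h1, sg_Z_left hm]; push_cast; rfl
    · rcases Nat.lt_or_ge l m with h | h
      · rw [h2 l h, sg_other (by omega) (by omega) (by omega) (by omega)]
      · obtain rfl : l = m := by omega
        have := h3 (l + 1) (by omega) hm
        push_cast at this
        rw [this, sg_right hm]
    · rw [h3 l (by omega) hl', sg_other (by omega) (by omega) (by omega) (by omega)]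

theorem artin_loop_zero : artin n (loop n) (x n 0) = Del n * x n 0 * (Del n)⁻¹ := by
  have h2 := hn.out
  rw [loop, map_mul, MulAut.mul_apply, (artin_ascent (by omega)).1, artin_descent]
  have h1 := delta_D (n := n) (n - 1 : ℕ) (n - 1 : ℕ)
  have h3 : (((n - 1 : ℕ) : ℤ) + 1) = 0 + n * 1 := by omega
  rw [Z, h1, h3, D_add_right, D_add_left, D, G_zero]
  simp

theorem artin_loop_succ {l : ℕ} (hl : l + 1 < n) :
    artin n (loop n) (x n (l + 1)) = x n 0 * x n (l + 1) * (x n 0)⁻¹ := by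
  have h2 := hn.out
  rw [loop, map_mul, MulAut.mul_apply, (artin_ascent (by omega)).2.1 l (by omega), artin_descent,
    x_eq, map_mul, map_inv, delta_G, delta_G, x_eq, x_eq]
  simp only [zero_add, G_zero]
  group

variable (n) in
/-- The braid carrying the `k`-th strand around all the others. -/
def loopAt : ℕ → Braid n
  | 0 => loop n
  | k + 1 => (bs n k)⁻¹ * loopAt k * bs n k

theorem artin_loopAt {k l : ℕ} (hk : k < n) (hl : l < n) :
    artin n (loopAt n k) (x n l) =
      (if l < k then Del n * x n k * (Del n)⁻¹ else if l = k then Del n else x n k) * x n l *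
      (if l < k then Del n * x n k * (Del n)⁻¹ else if l = k then Del n else x n k)⁻¹ := by
  induction k generalizing l with
  | zero =>
    cases l with
    | zero => simpa [loopAt] using artin_loop_zero
    | succ l => simpa [loopAt] using artin_loop_succ hl
  | succ k ih =>
    have key : ∀ y, artin n (loopAt n k) (sg n k (x n l)) = sg n k y →
        artin n (loopAt n (k + 1)) (x n l) = y := by
      intro y h
      rw [loopAt, map_mul, map_mul, MulAut.mul_apply, MulAut.mul_apply, map_inv, artin_bs, h,
        MulAut.inv_apply_self]
    apply key
    have ek := ih (l := k) (by omega) (by omega)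
    have ek1 := ih (l := k + 1) (by omega) (by omega)
    simp only [lt_irrefl, if_false, if_true, Nat.succ_ne_self, Nat.not_succ_lt_self, Nat.cast_succ] at ek ek1
    rcases lt_trichotomy l k with h | rfl | h
    · rw [if_pos (by omega), sg_x hk hl, if_neg (by omega), if_neg (by omega), ih (by omega) hl,
        if_pos h]
      simp only [map_mul, map_inv, Nat.cast_succ, sg_right hk, sg_Del, sg_x hk hl]
      rw [if_neg (by omega), if_neg (by omega)]
    · rw [if_pos (by omega), sg_x hk hl, if_pos rfl]
      simp only [map_mul, map_inv, Nat.cast_succ, sg_right hk, sg_Del, sg_x hk hl, if_true, ek, ek1]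
    · obtain rfl | h' := Nat.eq_or_lt_of_le h
      · rw [if_neg (by omega), if_pos (by omega), sg_x hk hl, if_neg (by omega), if_pos (by omega),
          ek]
        simp only [map_mul, map_inv, Nat.succ_eq_add_one, Nat.cast_succ, sg_right hk, sg_Del]
      · rw [if_neg (by omega), if_neg (by omega), sg_x hk hl, if_neg (by omega), if_neg (by omega),
          ih (by omega) hl, if_neg (by omega), if_neg (by omega)]
        simp only [map_mul, map_inv, Nat.cast_succ, sg_right hk]
        rw [sg_x hk hl, if_neg (by omega), if_neg (by omega)]

variable (n) in
/-- The product of the first `k` loops. -/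
def loops : ℕ → Braid n
  | 0 => 1
  | k + 1 => loops k * loopAt n k

theorem artin_loops {k l : ℕ} (hk : k ≤ n) (hl : l < n) :
    artin n (loops n k) (x n l) =
      (if l < k then Del n * G n k else G n k) * x n l *
      (if l < k then Del n * G n k else G n k)⁻¹ := by
  induction k generalizing l with
  | zero => simp [loops, G_zero]
  | succ k ih =>
    have eD := A_Del (artin_mem (loops n k))
    have ek := ih (l := k) (by omega) (by omega)
    rw [if_neg (by omega)] at ek
    rw [loops, map_mul, MulAut.mul_apply, artin_loopAt hk hl]
    rcases lt_trichotomy l k with h | rfl | h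
    · rw [if_pos h, if_pos (by omega)]
      simp only [map_mul, map_inv, eD, ek, ih (by omega : k ≤ n) hl, if_pos h, Nat.cast_succ,
        G_add_one]
      group
    · rw [if_neg (by omega), if_pos rfl, if_pos (by omega)]
      simp only [map_mul, map_inv, eD, ek, Nat.cast_succ, G_add_one]
      group
    · rw [if_neg (by omega), if_neg (by omega), if_neg (by omega)]
      simp only [map_mul, map_inv, ek, ih (by omega : k ≤ n) hl, if_neg (by omega : ¬ l < k),
        Nat.cast_succ, G_add_one]
      group

theorem commute_loops {i k : ℕ} (hi : i + 1 < n) (hk : k ≤ n) (hik : k ≠ i + 1) :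
    Commute (bs n i) (loops n k) := by
  rw [commute_iff_eq]
  apply artin_injective
  apply aut_ext_x
  intro l hl
  rw [map_mul, map_mul, MulAut.mul_apply, MulAut.mul_apply, artin_loops hk hl, artin_bs]
  have eG : sg n i (G n k) = G n k := by rw [sg_G_window hi hk, if_neg hik]
  have h1 := artin_loops hk (by omega : i < n)
  have h2 := artin_loops hk hi
  push_cast at h2
  have e : sg n i (if l < k then Del n * G n k else G n k) =
      if l < k then Del n * G n k else G n k := by
    split_ifs <;> simp only [map_mul, sg_Del, eG]
  rw [map_mul, map_mul, map_inv, e, sg_x hi hl]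
  by_cases e1 : l = i
  · subst e1
    simp only [if_true, map_mul, map_inv, h1, h2]
    by_cases h : l < k
    · rw [if_pos h, if_pos (by omega)]; group
    · rw [if_neg h, if_neg (by omega)]; group
  by_cases e2 : l = i + 1
  · subst e2
    rw [if_neg e1, if_pos rfl, h1]
    by_cases h : i < k
    · rw [if_pos h, if_pos (by omega)]
    · rw [if_neg h, if_neg (by omega)]
  rw [if_neg e1, if_neg e2, artin_loops hk hl]

theorem loopAt_eq (k : ℕ) : loopAt n k = (loops n k)⁻¹ * loops n (k + 1) := by
  rw [loops, inv_mul_cancel_left]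

variable (n) in
/-- The homomorphism sending the generators of the free group to the loops. -/
def push : FreeGroup (ZMod n) →* Braid n := lift fun c => loopAt n c.val

theorem push_x {k : ℕ} (hk : k < n) : push n (x n k) = loopAt n k := by
  rw [push, x, FreeGroup.lift_apply_of, Int.cast_natCast, ZMod.val_natCast_of_lt hk]

theorem bs_conj_push {i : ℕ} (hi : i + 1 < n) (w : FreeGroup (ZMod n)) :
    bs n i * push n w * (bs n i)⁻¹ = push n (sg n i w) := by
  have h : (MulAut.conj (bs n i)).toMonoidHom.comp (push n) =
      (push n).comp (sg n i).toMonoidHom := by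
    refine FreeGroup.ext_hom _ _ fun c => ?_
    obtain ⟨l, hl, rfl⟩ := exists_nat_rep c
    change bs n i * push n (x n l) * (bs n i)⁻¹ = push n (sg n i (x n l))
    have hpi := push_x (n := n) (by omega : i < n)
    have hpi1 := push_x hi
    push_cast at hpi1
    have h1 : bs n i * loopAt n (i + 1) * (bs n i)⁻¹ = loopAt n i := by rw [loopAt]; group
    rw [push_x hl, sg_x hi hl]
    split_ifs with e1 e2
    · subst e1
      have h2 : loopAt n l * loopAt n (l + 1) = (loops n l)⁻¹ * loops n (l + 2) := by
        rw [loopAt_eq, loopAt_eq]; group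
      have h3 : Commute (bs n l) (loopAt n l * loopAt n (l + 1)) := by
        rw [h2]
        exact (commute_loops hi (by omega) (by omega)).inv_right.mul_right
          (commute_loops hi (by omega) (by omega))
      rw [map_mul, map_mul, map_inv, hpi, hpi1]
      calc bs n l * loopAt n l * (bs n l)⁻¹
          = bs n l * (loopAt n l * loopAt n (l + 1)) * (bs n l)⁻¹ *
            (bs n l * loopAt n (l + 1) * (bs n l)⁻¹)⁻¹ := by group
        _ = _ := by rw [h1, h3.eq]; group
    · subst e2
      rw [hpi, h1]
    · rw [push_x hl, loopAt_eq, mul_inv_eq_iff_eq_mul]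
      exact (commute_loops hi (by omega) (by omega)).inv_right.mul_right
          (commute_loops hi (by omega) (by omega))
  exact DFunLike.congr_fun h w

theorem conj_push (b : Braid n) (w : FreeGroup (ZMod n)) :
    b * push n w * b⁻¹ = push n (artin n b w) := by
  refine braid_induction (p := fun b => ∀ w, b * push n w * b⁻¹ = push n (artin n b w)) b
    (fun w => by simp) (fun a b ha hb w => ?_) (fun a ha w => ?_) (fun i hi w => ?_) w
  · rw [map_mul, MulAut.mul_apply, ← ha, ← hb]; group
  · have := ha (artin n a⁻¹ w)
    rw [map_inv, MulAut.apply_inv_self] at this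
    rw [map_inv, ← this]; group
  · rw [artin_bs]
    exact bs_conj_push (by omega) w

variable (n) in
/-- The full twist. -/
def fullTwist : Braid n := descent (bs n) (n - 1) 0 ^ n

theorem artin_fullTwist : artin n (fullTwist n) = cD n := by
  rw [fullTwist, map_pow, artin_descent, delta_pow_n, cD]

theorem commute_fullTwist (b : Braid n) : Commute b (fullTwist n) := by
  rw [commute_iff_eq]
  apply artin_injective
  rw [map_mul, map_mul, artin_fullTwist]
  exact commute_cD (artin_mem b)

theorem push_G {k : ℕ} (hk : k ≤ n) : push n (G n k) = loops n k := by
  induction k with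
  | zero => rw [Nat.cast_zero, G_zero, map_one]; rfl
  | succ k ih => rw [Nat.cast_succ, G_add_one, map_mul, ih (by omega), push_x hk, loops]

theorem push_Del : push n (Del n) = fullTwist n ^ 2 := by
  rw [← G_n, push_G le_rfl]
  apply artin_injective
  apply aut_ext_x
  intro l hl
  rw [artin_loops le_rfl hl, if_pos hl, map_pow, artin_fullTwist, G_n, cD, ← map_pow,
    MulAut.conj_apply, sq]

theorem toM_loopAt (k : ℕ) : toM n (loopAt n k) = 1 := by
  induction k with
  | zero => exact toM_loop
  | succ k ih => simp [loopAt, ih]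

theorem toM_push (w : FreeGroup (ZMod n)) : toM n (push n w) = 1 := by
  have : (toM n).comp (push n) = 1 :=
    FreeGroup.ext_hom _ _ fun c => by simp [push, toM_loopAt]
  exact DFunLike.congr_fun this w

theorem exists_eq_push {b : Braid n} (hb : toM n b = 1) :
    ∃ w, ∃ l : ℤ, b = push n w * fullTwist n ^ l := by
  let K : Subgroup (Braid n) :=
    { carrier := {b | ∃ w, ∃ l : ℤ, b = push n w * fullTwist n ^ l}
      one_mem' := ⟨1, 0, by simp⟩
      mul_mem' := by
        rintro _ _ ⟨w, l, rfl⟩ ⟨w', l', rfl⟩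
        refine ⟨w * w', l + l', ?_⟩
        have := ((commute_fullTwist (push n w')).zpow_right l).eq
        rw [map_mul, zpow_add, mul_assoc, ← mul_assoc (_ ^ l), ← this]
        simp only [mul_assoc]
      inv_mem' := by
        rintro _ ⟨w, l, rfl⟩
        refine ⟨w⁻¹, -l, ?_⟩
        have := ((commute_fullTwist (push n w⁻¹)).zpow_right (-l)).eq
        rw [this, mul_inv_rev, zpow_neg, map_inv] }
  have : K.Normal := ⟨by
    rintro _ ⟨w, l, rfl⟩ g
    refine ⟨artin n g w, l, ?_⟩
    have := ((commute_fullTwist g⁻¹).zpow_right l).eq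
    rw [← conj_push, mul_assoc (g * push n w), this]
    simp only [mul_assoc]⟩
  exact mem_of_toM_eq_one (K := K) ⟨x n 0, 0, by
    have := push_x (n := n) (k := 0) (by have := hn.out; omega)
    rw [Nat.cast_zero] at this
    rw [this, zpow_zero, mul_one, loopAt]⟩ ⟨1, 1, by rw [map_one, zpow_one, one_mul]; rfl⟩ hb

end Loops

section Capping

variable {N : ℕ} [hN : Fact (2 ≤ N)]

instance two_le_succ : Fact (2 ≤ N + 1) := ⟨by have := hN.out; omega⟩

omit hN in
theorem hom_ext_x {H : Type*} [Group H] [Fact (2 ≤ N)] {f g : FreeGroup (ZMod N) →* H}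
    (h : ∀ l : ℕ, l < N → f (x N l) = g (x N l)) : f = g := by
  refine FreeGroup.ext_hom _ _ fun c => ?_
  obtain ⟨k, hk, rfl⟩ := exists_nat_rep c
  exact h k hk

variable (N) in
/-- The quotient map killing the boundary element. -/
def cap : FreeGroup (ZMod (N + 1)) →* FreeGroup (ZMod N) :=
  lift fun c => if c.val < N then x N c.val else (Del N)⁻¹

variable (N) in
/-- The section of `cap` given by the inclusion of the first generators. -/
def inc : FreeGroup (ZMod N) →* FreeGroup (ZMod (N + 1)) := lift fun c => x (N + 1) c.val

theorem cap_x {k : ℕ} (hk : k < N) : cap N (x (N + 1) k) = x N k := by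
  rw [cap, x, FreeGroup.lift_apply_of, Int.cast_natCast, ZMod.val_natCast_of_lt (by omega),
    if_pos hk]

theorem cap_x_last : cap N (x (N + 1) N) = (Del N)⁻¹ := by
  rw [cap, x, FreeGroup.lift_apply_of, Int.cast_natCast, ZMod.val_natCast_of_lt (by omega),
    if_neg (lt_irrefl _)]

theorem inc_x {k : ℕ} (hk : k < N) : inc N (x N k) = x (N + 1) k := by
  rw [inc, x, FreeGroup.lift_apply_of, Int.cast_natCast, ZMod.val_natCast_of_lt hk]

theorem cap_inc (y : FreeGroup (ZMod N)) : cap N (inc N y) = y := by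
  have : (cap N).comp (inc N) = MonoidHom.id _ :=
    hom_ext_x fun l hl => by simp [inc_x hl, cap_x hl]
  exact DFunLike.congr_fun this y

theorem cap_surjective : Function.Surjective (cap N) := fun y => ⟨_, cap_inc y⟩

theorem inc_G {k : ℕ} (hk : k ≤ N) : inc N (G N k) = G (N + 1) k := by
  induction k with
  | zero => rw [Nat.cast_zero, G_zero, G_zero, map_one]
  | succ k ih => rw [Nat.cast_succ, G_add_one, G_add_one, map_mul, ih (by omega), inc_x hk]

theorem inc_Del : inc N (Del N) = G (N + 1) N := by rw [← G_n, inc_G le_rfl]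

theorem x_last : x (N + 1) N = (inc N (Del N))⁻¹ * Del (N + 1) := by
  rw [inc_Del, x_eq, ← G_n (n := N + 1), Nat.cast_succ]

theorem cap_Del : cap N (Del (N + 1)) = 1 := by
  have h := cap_x_last (N := N)
  rw [x_last, map_mul, map_inv, cap_inc] at h
  exact mul_eq_left.mp h

theorem cap_apply_inc_cap {a : MulAut (FreeGroup (ZMod (N + 1)))} (ha : a ∈ A (N + 1))
    (y : FreeGroup (ZMod (N + 1))) : cap N (a (inc N (cap N y))) = cap N (a y) := by
  have : (cap N).comp (a.toMonoidHom.comp ((inc N).comp (cap N))) =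
      (cap N).comp a.toMonoidHom := by
    refine hom_ext_x fun l hl => ?_
    change cap N (a (inc N (cap N (x (N + 1) l)))) = cap N (a (x (N + 1) l))
    rcases Nat.lt_succ_iff_lt_or_eq.mp hl with h | rfl
    · rw [cap_x h, inc_x h]
    · rw [cap_x_last, x_last, map_mul, map_mul, A_Del ha, cap_Del, mul_one, map_inv]
  exact DFunLike.congr_fun this y

theorem exists_capped {a : MulAut (FreeGroup (ZMod (N + 1)))} (ha : a ∈ A (N + 1)) :
    ∃ φ : MulAut (FreeGroup (ZMod N)), ∀ y, cap N (a y) = φ (cap N y) := by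
  refine ⟨MonoidHom.toMulEquiv ((cap N).comp (a.toMonoidHom.comp (inc N)))
    ((cap N).comp ((a⁻¹).toMonoidHom.comp (inc N))) ?_ ?_, fun y => ?_⟩
  · ext1 c
    change cap N (a⁻¹ (inc N (cap N (a (inc N (of c)))))) = of c
    rw [cap_apply_inc_cap (inv_mem ha), MulAut.inv_apply_self, cap_inc]
  · ext1 c
    change cap N (a (inc N (cap N (a⁻¹ (inc N (of c)))))) = of c
    rw [cap_apply_inc_cap ha, MulAut.apply_inv_self, cap_inc]
  · exact (cap_apply_inc_cap ha y).symm

theorem cap_addStrand (b : Braid N) (y : FreeGroup (ZMod (N + 1))) :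
    cap N (artin (N + 1) (addStrand N b) y) = artin N b (cap N y) := by
  refine braid_induction
    (p := fun b => ∀ y, cap N (artin (N + 1) (addStrand N b) y) = artin N b (cap N y)) b
    (fun y => by simp) (fun a b ha hb y => ?_) (fun a ha y => ?_) (fun i hi y => ?_) y
  · rw [map_mul, map_mul, map_mul, MulAut.mul_apply, MulAut.mul_apply, ha, hb]
  · have := ha (artin (N + 1) (addStrand N a)⁻¹ y)
    rw [map_inv, MulAut.apply_inv_self] at this
    rw [map_inv, map_inv, map_inv, this, MulAut.inv_apply_self]
  · have hi : i + 1 < N := by omega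
    rw [addStrand_bs hi, artin_bs, artin_bs]
    have : (cap N).comp (sg (N + 1) i).toMonoidHom = (sg N i).toMonoidHom.comp (cap N) := by
      refine hom_ext_x fun l hl => ?_
      change cap N (sg (N + 1) i (x (N + 1) l)) = sg N i (cap N (x (N + 1) l))
      rw [sg_x (by omega) hl]
      rcases Nat.lt_succ_iff_lt_or_eq.mp hl with h | rfl
      · have h1 := cap_x (N := N) (by omega : i < N)
        have h2 := cap_x (N := N) hi
        push_cast at h2
        rw [cap_x h, sg_x hi h]
        split_ifs
        · rw [map_mul, map_mul, map_inv, h1, h2]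
        · exact h1
        · exact cap_x h
      · rw [if_neg (by omega), if_neg (by omega), cap_x_last, map_inv, sg_Del]
    exact DFunLike.congr_fun this y

theorem cap_push (w y : FreeGroup (ZMod (N + 1))) :
    cap N (artin (N + 1) (push (N + 1) w) y) = cap N w * cap N y * (cap N w)⁻¹ := by
  have hinv : ∀ w, (∀ y, cap N (artin (N + 1) (push (N + 1) w) y) =
      cap N w * cap N y * (cap N w)⁻¹) → ∀ y, cap N (artin (N + 1) (push (N + 1) w⁻¹) y) =
      cap N w⁻¹ * cap N y * (cap N w⁻¹)⁻¹ := fun w hw y => by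
    have := hw (artin (N + 1) (push (N + 1) w)⁻¹ y)
    rw [map_inv, MulAut.apply_inv_self] at this
    rw [this, map_inv, map_inv, map_inv]
    group
  induction w using FreeGroup.induction_on generalizing y with
  | C1 => simp
  | of c =>
    obtain ⟨k, hk, rfl⟩ := exists_nat_rep c
    have : (cap N).comp (artin (N + 1) (push (N + 1) (x (N + 1) k))).toMonoidHom =
        (MulAut.conj (cap N (x (N + 1) k))).toMonoidHom.comp (cap N) := by
      refine hom_ext_x fun l hl => ?_
      change cap N (artin (N + 1) (push (N + 1) (x (N + 1) k)) (x (N + 1) l)) =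
        cap N (x (N + 1) k) * cap N (x (N + 1) l) * (cap N (x (N + 1) k))⁻¹
      rw [push_x hk, artin_loopAt hk hl]
      rcases lt_trichotomy l k with h | rfl | h
      · simp [if_pos h, cap_Del]
      · simp [cap_Del]
      · simp [if_neg (by omega : ¬ l < k), if_neg (by omega : l ≠ k)]
    exact DFunLike.congr_fun this y
  | inv_of c h => exact hinv _ h y
  | mul v w hv hw =>
    rw [map_mul, map_mul, MulAut.mul_apply, hv, hw, map_mul]
    group

theorem cap_cD_zpow (l : ℤ) (y : FreeGroup (ZMod (N + 1))) :
    cap N ((cD (N + 1) ^ l) y) = cap N y := by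
  rw [cD_zpow_apply]
  simp [cap_Del]

theorem cap_of_toM_eq_one {b : Braid (N + 1)} (hb : toM (N + 1) b = 1) :
    ∃ w, ∀ y, cap N (artin (N + 1) b y) = w * cap N y * w⁻¹ := by
  obtain ⟨w, l, rfl⟩ := exists_eq_push hb
  refine ⟨cap N w, fun y => ?_⟩
  rw [map_mul, MulAut.mul_apply, cap_push, map_zpow, artin_fullTwist, cap_cD_zpow]

theorem push_eq (w : FreeGroup (ZMod (N + 1))) :
    ∃ l : ℤ, push (N + 1) w = push (N + 1) (inc N (cap N w)) * fullTwist (N + 1) ^ l := by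
  have hinv : ∀ w, (∃ l : ℤ, push (N + 1) w =
      push (N + 1) (inc N (cap N w)) * fullTwist (N + 1) ^ l) → ∃ l : ℤ, push (N + 1) w⁻¹ =
      push (N + 1) (inc N (cap N w⁻¹)) * fullTwist (N + 1) ^ l := by
    rintro w ⟨l, h⟩
    refine ⟨-l, ?_⟩
    rw [map_inv, h, ((commute_fullTwist _).zpow_right l).eq, mul_inv_rev]
    simp
  induction w using FreeGroup.induction_on with
  | C1 => exact ⟨0, by simp⟩
  | of c =>
    obtain ⟨k, hk, rfl⟩ := exists_nat_rep c
    change ∃ l : ℤ, push (N + 1) (x (N + 1) k) =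
      push (N + 1) (inc N (cap N (x (N + 1) k))) * fullTwist (N + 1) ^ l
    rcases Nat.lt_succ_iff_lt_or_eq.mp hk with h | rfl
    · exact ⟨0, by rw [cap_x h, inc_x h, zpow_zero, mul_one]⟩
    · refine ⟨2, ?_⟩
      rw [cap_x_last, x_last, map_mul, push_Del, map_inv, map_inv, map_inv]
      rfl
  | inv_of c h => exact hinv _ h
  | mul v w hv hw =>
    obtain ⟨l, hl⟩ := hv
    obtain ⟨l', hl'⟩ := hw
    refine ⟨l + l', ?_⟩
    rw [map_mul, hl, hl', map_mul, map_mul, map_mul, zpow_add, mul_assoc, ← mul_assoc (_ ^ l),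
      ← ((commute_fullTwist _).zpow_right l).eq]
    simp only [mul_assoc]

theorem artin_eq_of_cap_eq {b : Braid (N + 1)} (hb : toM (N + 1) b = 1)
    (h : ∀ y, cap N (artin (N + 1) b y) = cap N y) : ∃ K : ℤ, artin (N + 1) b = cD (N + 1) ^ K := by
  obtain ⟨w, l, rfl⟩ := exists_eq_push hb
  have hw : cap N w = 1 := by
    refine eq_one_of_forall_commute fun i => ?_
    obtain ⟨y, hy⟩ := cap_surjective (of i)
    have := h y
    rw [map_mul, MulAut.mul_apply, cap_push, map_zpow, artin_fullTwist, cap_cD_zpow, hy,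
      mul_inv_eq_iff_eq_mul] at this
    exact this
  obtain ⟨k, hk⟩ := push_eq w
  refine ⟨k + l, ?_⟩
  rw [hk, hw, map_one, map_one, one_mul, ← zpow_add, map_zpow, artin_fullTwist]

theorem exists_cap_eq_conj (g : FreeGroup (ZMod N)) : ∃ s : Braid (N + 1), toM (N + 1) s = 1 ∧
    ∀ y, cap N (artin (N + 1) s y) = g * cap N y * g⁻¹ :=
  ⟨push (N + 1) (inc N g), toM_push _, fun y => by rw [cap_push, cap_inc]⟩

theorem expSum_x {k l : ℕ} (hk : k < N) (hl : l < N) :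
    (expSum ((k : ℤ) : ZMod N) (x N l)).toAdd = if l = k then 1 else 0 := by
  rw [x, expSum_of]
  rcases lt_trichotomy l k with h | rfl | h
  · rw [if_neg h.ne, if_neg (intCast_ne (by omega) (by omega))]
  · simp
  · rw [if_neg h.ne', if_neg (intCast_ne (by omega) (by omega)).symm]

theorem expSum_G {k l : ℕ} (hk : k < N) (hl : l ≤ N) :
    (expSum ((k : ℤ) : ZMod N) (G N l)).toAdd = if k < l then 1 else 0 := by
  induction l with
  | zero => simp [G_zero]
  | succ l ih =>
    rw [Nat.cast_succ, G_add_one, map_mul, toAdd_mul, ih (by omega), expSum_x hk hl]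
    split_ifs <;> omega

theorem expSum_Del (c : ZMod N) : (expSum c (Del N)).toAdd = 1 := by
  obtain ⟨k, hk, rfl⟩ := exists_nat_rep c
  rw [← G_n, expSum_G hk le_rfl, if_pos hk]

end Capping

section Classification

variable {N : ℕ} [hN : Fact (2 ≤ N)]

theorem isConj_zpow_of_braid {n : ℕ} {H : Type*} [Group H] (F : Braid n →* H) {b g e : Braid n}
    {r : ℤ} (h : b * g = g * e ^ r) : IsConj (F e ^ r) (F b) := by
  refine isConj_iff.mpr ⟨F g, ?_⟩
  rw [← map_zpow, ← map_inv, ← map_mul, ← map_mul, ← h, mul_inv_cancel_right]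

theorem exists_braid_rotation {n : ℕ} [Fact (2 ≤ n)] {b : Braid n} {m : ℕ} (hm : 0 < m) {K : ℤ}
    (hK : artin n b ^ m = cD n ^ K) : ∃ g : Braid n, ∃ r : ℤ,
      b * g = g * descent (bs n) (n - 1) 0 ^ r ∨
      b * g = g * (descent (bs n) (n - 1) 0 * bs n (n - 2)) ^ r := by
  obtain ⟨a, ha, r, h⟩ := exists_conj_rotation (artin_mem b) hm hK
  obtain ⟨g, rfl⟩ := exists_artin_eq ha
  refine ⟨g, r, h.imp (fun h => artin_injective ?_) fun h => artin_injective ?_⟩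
  · simpa only [map_mul, map_zpow, artin_descent] using h
  · simpa only [map_mul, map_zpow, artin_descent, artin_bs, eps] using h

theorem conj_of_fixed {b : Braid (N + 1)} {m : ℕ} (hm : 0 < m) (hb : toM (N + 1) b ^ m = 1)
    (hc : IsConj (of ((N : ℤ) : ZMod (N + 1))) (artin (N + 1) b (of ((N : ℤ) : ZMod (N + 1))))) :
    ∃ k : ℤ, IsConj (α₁ (N + 1) ^ k) (toM (N + 1) b) ∨
      IsConj (α₂ (N + 1) ^ k) (toM (N + 1) b) := by
  have h2 := hN.out
  have hmem : b ∈ lastStab (bs (N + 1)) N := by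
    have hT := isTwistAction_artin (n := N + 1)
    obtain ⟨k, hk, p, hp, rfl⟩ := exists_coset (N := N) braidRel_bs le_rfl (mem_closure_bs b)
    have h1 := lastStab_fixes hT braidRel_bs le_rfl hp
    have h3 := apply_isConj (artin (N + 1) (descent (bs (N + 1)) N k)) h1
    have h4 := act_descent hT le_rfl hk
    simp only [Nat.add_sub_cancel] at h3 h4
    rw [h4] at h3
    rw [map_mul, MulAut.mul_apply] at hc
    have h5 := isConj_of_iff.mp (h3.trans hc.symm)
    have h6 := hT.inj k (by omega) N (by omega) h5
    rw [h6, descent_self, one_mul]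
    exact hp
  obtain ⟨b', hb'⟩ := toM_lastStab hmem
  rw [← hb', ← map_pow, ← map_pow] at hb
  obtain ⟨w, hw⟩ := cap_of_toM_eq_one hb
  have hw' : artin N b' ^ m = MulAut.conj w := by
    refine MulEquiv.ext fun y => ?_
    obtain ⟨y, rfl⟩ := cap_surjective y
    rw [← map_pow, ← cap_addStrand, hw, MulAut.conj_apply]
  have hcomm : Commute w (Del N) := by
    have := A_Del (pow_mem (artin_mem b') m)
    rw [hw', MulAut.conj_apply, mul_inv_eq_iff_eq_mul] at this
    exact this
  obtain ⟨K, hK⟩ := Subgroup.mem_zpowers_iff.mp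
    (mem_zpowers_of_commute (expSum 0) (Multiplicative.toAdd.injective (expSum_Del 0)) hcomm)
  obtain ⟨g, r, h⟩ := exists_braid_rotation (K := K) hm
    (by rw [hw', ← hK, cD, ← map_zpow])
  have e1 : toM (N + 1) (addStrand N (descent (bs N) (N - 1) 0)) = α₁ (N + 1) := by
    rw [addStrand_descent (by omega), toM_descent]; rfl
  have e2 : toM (N + 1) (addStrand N (descent (bs N) (N - 1) 0 * bs N (N - 2))) =
      α₂ (N + 1) := by
    rw [map_mul, map_mul, e1, addStrand_bs (by omega), toM_bs, α₁, ← map_mul, α₂,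
      show N - 2 + 1 = N + 1 - 2 by omega]
  refine ⟨r, ?_⟩
  rw [← hb', ← e1, ← e2]
  exact h.imp (isConj_zpow_of_braid ((toM (N + 1)).comp (addStrand N)))
    (isConj_zpow_of_braid ((toM (N + 1)).comp (addStrand N)))

theorem exists_conj_fixing_last {n : ℕ} [Fact (2 ≤ n)] {b : Braid n} {c : ZMod n}
    (hc : IsConj (of c) (artin n b (of c))) : ∃ g : Braid n,
      IsConj (of ((n - 1 : ℤ) : ZMod n)) (artin n (g * b * g⁻¹) (of ((n - 1 : ℤ) : ZMod n))) := by
  obtain ⟨k, hk, rfl⟩ := exists_nat_rep c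
  have key : ∀ (a : MulAut (FreeGroup (ZMod n))) (l : ℤ),
      IsConj (of (l : ZMod n)) (a (of (l : ZMod n))) ↔ IsConj (Z n l) (a (Z n l)) := fun a l =>
    ⟨fun h => (Z_conj l).symm.trans (h.trans (apply_isConj a (Z_conj l))),
      fun h => (Z_conj l).trans (h.trans (apply_isConj a (Z_conj l).symm))⟩
  rw [key] at hc
  refine ⟨descent (bs n) (n - 1) 0 ^ ((n : ℤ) - 1 - k), ?_⟩
  rw [key, map_mul, map_mul, map_inv, map_zpow, artin_descent, MulAut.mul_apply,
    MulAut.mul_apply]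
  have e := delta_zpow_Z (n := n) ((n : ℤ) - 1 - k) k
  rw [show (k : ℤ) + ((n : ℤ) - 1 - k) = n - 1 by ring] at e
  rw [← e, MulAut.inv_apply_self]
  exact apply_isConj _ hc

theorem conj_of_not_fixed {b : Braid (N + 1)} {m : ℕ} (hm : 0 < m) (hb : toM (N + 1) b ^ m = 1)
    (hc : ∀ b', toM (N + 1) b' = toM (N + 1) b → ∀ c, ¬ IsConj (of c) (artin (N + 1) b' (of c))) :
    ∃ k : ℤ, IsConj (α₀ (N + 1) ^ k) (toM (N + 1) b) := by
  have h2 := hN.out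
  obtain ⟨φ, hφ⟩ := exists_capped (artin_mem b)
  have hpow : ∀ (b : Braid (N + 1)) (φ : MulAut (FreeGroup (ZMod N))),
      (∀ y, cap N (artin (N + 1) b y) = φ (cap N y)) →
      ∀ (m : ℕ) y, cap N (artin (N + 1) (b ^ m) y) = (φ ^ m) (cap N y) := by
    intro b φ h m
    induction m with
    | zero => intro y; simp
    | succ m ih =>
      intro y
      rw [pow_succ, pow_succ, map_mul, MulAut.mul_apply, MulAut.mul_apply, ih, h]
  obtain ⟨w, hw⟩ := cap_of_toM_eq_one ((map_pow _ _ _).trans hb)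
  have hφm : φ ^ m = MulAut.conj w := by
    refine MulEquiv.ext fun y => ?_
    obtain ⟨y, rfl⟩ := cap_surjective y
    rw [← hpow b φ hφ, hw, MulAut.conj_apply]
  obtain ⟨π, hπ⟩ := A_perm (artin_mem b)
  have htr : ∑ i, (expSum i (φ (of i))).toAdd ≠ 1 := by
    refine (lt_of_le_of_lt (Finset.sum_nonpos fun c _ => ?_) zero_lt_one).ne
    obtain ⟨k, hk, rfl⟩ := exists_nat_rep c
    change (expSum ((k : ℤ) : ZMod N) (φ (x N k))).toAdd ≤ 0
    have hne : π ((k : ℤ) : ZMod (N + 1)) ≠ ((k : ℤ) : ZMod (N + 1)) := fun h =>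
      hc b rfl _ (by simpa only [h] using hπ ((k : ℤ) : ZMod (N + 1)))
    obtain ⟨g, hg⟩ := isConj_iff.mp (hπ ((k : ℤ) : ZMod (N + 1)))
    obtain ⟨l, hl, hl'⟩ := exists_nat_rep (π ((k : ℤ) : ZMod (N + 1)))
    rw [← hl'] at hne hg
    rw [← cap_x hk, ← hφ, x, ← hg]
    change (expSum ((k : ℤ) : ZMod N) (cap N (g * x (N + 1) l * g⁻¹))).toAdd ≤ 0
    rw [map_mul (cap N), map_mul (cap N), map_inv (cap N), map_mul (expSum _),
      map_mul (expSum _), map_inv (expSum _), mul_right_comm, mul_inv_cancel, one_mul]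
    rcases Nat.lt_succ_iff_lt_or_eq.mp hl with h | rfl
    · rw [cap_x h, expSum_x hk h, if_neg (fun e => hne (by rw [e]))]
    · rw [cap_x_last, map_inv, toAdd_inv, expSum_Del]
      decide
  obtain ⟨g, hg⟩ := exists_conj_mul_pow_eq_one hm hφm htr
  obtain ⟨s, hs, hs'⟩ := exists_cap_eq_conj (N := N) g
  have hsb : toM (N + 1) (s * b) = toM (N + 1) b := by rw [map_mul, hs, one_mul]
  obtain ⟨K, hK⟩ := artin_eq_of_cap_eq (b := (s * b) ^ m) (by rw [map_pow, hsb, hb]) (fun y => by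
    rw [hpow (s * b) (MulAut.conj g * φ) (fun y => by
      rw [map_mul, MulAut.mul_apply, MulAut.mul_apply, hs', hφ, MulAut.conj_apply]), hg]
    rfl)
  rw [map_pow] at hK
  obtain ⟨a, ha, r, h | h⟩ := exists_conj_rotation (artin_mem (s * b)) hm hK
  · obtain ⟨a, rfl⟩ := exists_artin_eq ha
    rw [← artin_descent, ← map_zpow, ← map_mul, ← map_mul] at h
    have := isConj_zpow_of_braid (toM (N + 1)) (artin_injective h)
    rw [hsb, toM_descent] at this
    exact ⟨r, this⟩
  · exfalso
    obtain ⟨π, hπ⟩ := A_perm ha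
    have h1 := apply_isConj a (eps_fixes_class (n := N + 1) r)
    rw [← MulAut.mul_apply, ← h, MulAut.mul_apply] at h1
    have h3 := (hπ _).trans (apply_isConj a (Z_conj ((N + 1 : ℕ) - 1)))
    exact hc (s * b) hsb _ (h3.trans (h1.trans (apply_isConj _ h3.symm)))

end Classification

end BraidAction

open SphereMCG in
/-- For `n ≥ 3`, every finite-order element of the mapping class group of the
`n`-punctured sphere is conjugate to a power of `α₀`, `α₁` or `α₂`. -/
theorem finite_order_conjugate_to_power (n : ℕ) (hn : 3 ≤ n)
    (f : M n) (hf : IsOfFinOrder f) :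
    ∃ k : ℤ, IsConj (α₀ n ^ k) f ∨ IsConj (α₁ n ^ k) f ∨ IsConj (α₂ n ^ k) f := by
  obtain ⟨N, rfl⟩ : ∃ N, n = N + 1 := ⟨n - 1, by omega⟩
  have : Fact (2 ≤ N) := ⟨by omega⟩
  obtain ⟨m, hm, hfm⟩ := isOfFinOrder_iff_pow_eq_one.mp hf
  by_cases h : ∃ b, BraidAction.toM (N + 1) b = f ∧
      ∃ c, IsConj (FreeGroup.of c) (BraidAction.artin (N + 1) b (FreeGroup.of c))
  · obtain ⟨b, rfl, c, hc⟩ := h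
    obtain ⟨g, hg⟩ := BraidAction.exists_conj_fixing_last hc
    have hconj : IsConj (BraidAction.toM (N + 1) (g * b * g⁻¹)) (BraidAction.toM (N + 1) b) := by
      rw [map_mul, map_mul, map_inv]
      exact (isConj_iff.mpr ⟨_, rfl⟩ : IsConj _ _).symm
    obtain ⟨k, hk⟩ := BraidAction.conj_of_fixed (b := g * b * g⁻¹) hm
      (by rw [map_mul, map_mul, map_inv, conj_pow, hfm]; simp)
      (by simpa only [Nat.cast_succ, add_sub_cancel_right] using hg)
    exact ⟨k, Or.inr (hk.imp (·.trans hconj) (·.trans hconj))⟩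
  · obtain ⟨b, rfl⟩ := BraidAction.toM_surjective f
    obtain ⟨k, hk⟩ := BraidAction.conj_of_not_fixed hm hfm
      fun b' hb' c hc => h ⟨b', hb', c, hc⟩
    exact ⟨k, Or.inl hk⟩
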